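/- For each K ≥ 1, the K-bounded boundedness problem for DCPS is decidable: there is an algorithm that, given a DCPS A, decides whether every K-context switch bounded run of A is bounded, where a run is bounded if there is a bound B ∈ ℕ such that the number of pending threads in every configuration along the run is at most B. -/

import Mathlib

/-!
Formalization of context-bounded liveness for dynamic networks of concurrent
pushdown systems (DCPS) and VASS with balloons (VASSB).
Global states, stack symbols, places, balloon states etc. are drawn from ℕ;
the finite components of the systems are recorded as `Finset`s.
-/

noncomputable section

namespace CBL

/-! ### Dynamic networks of concurrent pushdown systems (DCPS) -/

/-- A local configuration of a thread: its stack content (top of stack is the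
head of the list) together with its context-switch number. -/
abbrev Loc : Type := List ℕ × ℕ

/-- A DCPS `(G, Γ, Δ, g0, γ0)`.  The transition rules `Δ` are split into the
four kinds.  A creation rule `g|γ ↪ g'|w' (▷ γ')` is recorded as
`(g, γ, g', w', none/some γ')`; an interruption rule `g|γ ↦ g'|w'` as
`(g, γ, g', w')`; a resumption rule `g ↦ g' ◁ γ` as `(g, g', γ)`; a
termination rule `g ↦ g'` as `(g, g')`. -/
structure DCPS where
  glob : Finset ℕ
  alph : Finset ℕ
  creation : Finset (ℕ × ℕ × ℕ × List ℕ × Option ℕ)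
  interruption : Finset (ℕ × ℕ × ℕ × List ℕ)
  resumption : Finset (ℕ × ℕ × ℕ)
  termination : Finset (ℕ × ℕ)
  g0 : ℕ
  gamma0 : ℕ
  creation_wf : ∀ r ∈ creation, r.2.2.2.1.length ≤ 2
  interruption_wf : ∀ r ∈ interruption, 1 ≤ r.2.2.2.length ∧ r.2.2.2.length ≤ 2

/-- A configuration `⟨g, t, m⟩` of a DCPS: global state, active slot
(`none` denotes the schedule point `#`), and the multiset of local
configurations of the inactive threads. -/
structure DConfig where
  g : ℕ
  act : Option Loc
  pend : Multiset Loc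

/-- The initial configuration `⟨g0, #, {(γ0, 0)}⟩`. -/
def DCPS.init (A : DCPS) : DConfig :=
  ⟨A.g0, none, {([A.gamma0], 0)}⟩

/-- The multiset of freshly spawned threads of a creation rule. -/
def spawnOf : Option ℕ → Multiset Loc
  | none => 0
  | some gam => {([gam], 0)}

/-- A thread step: a creation rule rewrites the global state and the top of
stack of the active thread, possibly spawning a new thread. -/
def ThreadStep (A : DCPS) (c c' : DConfig) : Prop :=
  ∃ (gam : ℕ) (w : List ℕ) (i : ℕ) (g' : ℕ) (w' : List ℕ) (sp : Option ℕ),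
    (c.g, gam, g', w', sp) ∈ A.creation ∧
    c.act = some (gam :: w, i) ∧ c'.g = g' ∧ c'.act = some (w' ++ w, i) ∧
    c'.pend = c.pend + spawnOf sp

/-- The scheduler step `Swap`. -/
def SwapStep (A : DCPS) (c c' : DConfig) : Prop :=
  ∃ (gam : ℕ) (w : List ℕ) (i : ℕ) (g' : ℕ) (w' : List ℕ),
    (c.g, gam, g', w') ∈ A.interruption ∧
    c.act = some (gam :: w, i) ∧ c'.g = g' ∧ c'.act = none ∧
    c'.pend = c.pend + {(w' ++ w, i + 1)}

/-- The scheduler step `Resume`, resuming (an instance of) the local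
configuration `t`. -/
def ResumeStep (A : DCPS) (t : Loc) (c c' : DConfig) : Prop :=
  ∃ (gam : ℕ) (w : List ℕ) (i : ℕ) (g' : ℕ) (p0 : Multiset Loc),
    (c.g, g', gam) ∈ A.resumption ∧ t = (gam :: w, i) ∧
    c.act = none ∧ c.pend = p0 + {t} ∧
    c'.g = g' ∧ c'.act = some t ∧ c'.pend = p0

/-- The scheduler step `Term`, removing the active thread when its stack is
empty. -/
def TermStep (A : DCPS) (c c' : DConfig) : Prop :=
  ∃ (i : ℕ) (g' : ℕ),
    (c.g, g') ∈ A.termination ∧ c.act = some ([], i) ∧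
    c'.g = g' ∧ c'.act = none ∧ c'.pend = c.pend

/-- Any single step of the DCPS. -/
def DStep (A : DCPS) (c c' : DConfig) : Prop :=
  ThreadStep A c c' ∨ SwapStep A c c' ∨ (∃ t, ResumeStep A t c c') ∨ TermStep A c c'

/-- An infinite run of a DCPS: it starts in the initial configuration, takes a
step at each moment, performs at least one thread step between consecutive
scheduler steps (every scheduled thread executes a nonempty sequence of thread
steps), and alternates thread executions with scheduler steps forever (there
are infinitely many scheduler steps, witnessed by schedule points `#`). -/
def IsInfRunD (A : DCPS) (rho : ℕ → DConfig) : Prop :=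
  rho 0 = A.init ∧ (∀ i, DStep A (rho i) (rho (i + 1))) ∧
  (∀ i, (rho i).act = none → (rho (i + 2)).act ≠ none) ∧
  (∀ i, ∃ j ≥ i, (rho j).act = none)

/-- A finite run of length `n` of a DCPS (the first `n` steps of `rho`). -/
def IsFinRunD (A : DCPS) (rho : ℕ → DConfig) (n : ℕ) : Prop :=
  rho 0 = A.init ∧ (∀ i < n, DStep A (rho i) (rho (i + 1))) ∧
  (∀ i, i + 2 ≤ n → (rho i).act = none → (rho (i + 2)).act ≠ none)

/-- A run is `K`-context switch bounded if in every configuration the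
context-switch number of the active thread is at most `K`. -/
def KBoundedD (K : ℕ) (rho : ℕ → DConfig) : Prop :=
  ∀ i w j, (rho i).act = some (w, j) → j ≤ K

/-- `K`-context switch boundedness for the first `n + 1` configurations. -/
def KBoundedUpToD (K n : ℕ) (rho : ℕ → DConfig) : Prop :=
  ∀ i ≤ n, ∀ w j, (rho i).act = some (w, j) → j ≤ K

/-- The thread `t = (γw, i)` is ready at configuration `c = ⟨g, #, m⟩`. -/
def ReadyAt (A : DCPS) (t : Loc) (c : DConfig) : Prop :=
  c.act = none ∧ t ∈ c.pend ∧
  ∃ (gam : ℕ) (w : List ℕ) (g' : ℕ), t.1 = gam :: w ∧ (c.g, g', gam) ∈ A.resumption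

/-- The thread `t` is resumed (made active) at moment `k` of the run `rho`. -/
def ResumedAt (A : DCPS) (rho : ℕ → DConfig) (k : ℕ) (t : Loc) : Prop :=
  ResumeStep A t (rho k) (rho (k + 1))

/-- Fairness: no thread is ready at infinitely many configurations while being
resumed only finitely often. -/
def FairD (A : DCPS) (rho : ℕ → DConfig) : Prop :=
  ∀ t : Loc, (∀ N, ∃ k ≥ N, ReadyAt A t (rho k)) → (∀ N, ∃ k ≥ N, ResumedAt A rho k t)

/-- Progressiveness for a context-switch bound `K`:  the rule `Term` is only
ever applied to an active thread with exactly `K` context switches (from an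
active thread with empty stack only `Term` steps are possible, so this is
expressed by requiring that an active thread with an empty stack has
context-switch number `K`), and every local configuration of an inactive
thread is resumed at some later point of the run. -/
def ProgressiveD (A : DCPS) (K : ℕ) (rho : ℕ → DConfig) : Prop :=
  (∀ k i, (rho k).act = some ([], i) → i = K) ∧
  (∀ k, ∀ t ∈ (rho k).pend, ∃ j ≥ k, ResumedAt A rho j t)

/-- All threads (active and inactive) of a configuration. -/
def allThreads (c : DConfig) : Multiset Loc :=
  c.pend + (match c.act with | none => 0 | some t => {t})

/-- The thread `t = (w, i)` is starved in the run `rho`: from some moment `j`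
on, at least one thread with local configuration `t` is always present, and
whenever `t` is resumed there are at least two of them. -/
def StarvesD (A : DCPS) (rho : ℕ → DConfig) (t : Loc) : Prop :=
  ∃ j, (∀ k ≥ j, 1 ≤ (allThreads (rho k)).count t) ∧
       (∀ k ≥ j, ResumedAt A rho k t → 2 ≤ (allThreads (rho k)).count t)

/-- Step `k` of the run is a thread step spawning a new thread. -/
def SpawnAt (rho : ℕ → DConfig) (k : ℕ) : Prop :=
  (rho k).act ≠ none ∧ (rho (k + 1)).act ≠ none ∧
  ∃ gam : ℕ, (rho (k + 1)).pend = (rho k).pend + {([gam], 0)}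

/-- A run is shallow if there is a bound `B ∈ ℕ` on the number of threads
spawned by each thread along the run, i.e. on the number of spawns performed
during any contiguous interval of the run in which a single thread stays
active. -/
def ShallowD (rho : ℕ → DConfig) : Prop :=
  ∃ B, ∀ a b : ℕ, (∀ k, a ≤ k → k ≤ b → (rho k).act ≠ none) →
    Set.ncard {k | a ≤ k ∧ k < b ∧ SpawnAt rho k} ≤ B

/-- The number of pending threads of a configuration: the size of the multiset
of inactive threads, plus one if there is an active thread. -/
def pendCount (c : DConfig) : ℕ :=
  Multiset.card c.pend + (match c.act with | none => 0 | some _ => 1)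

/-! ### Effective encodings of DCPS and their configurations -/

/-- An effective encoding of DCPS by natural numbers. -/
def encodeDCPS (A : DCPS) : ℕ :=
  Encodable.encode (A.glob.val, A.alph.val, A.creation.val, A.interruption.val,
    A.resumption.val, A.termination.val, A.g0, A.gamma0)

/-- An effective encoding of DCPS configurations by natural numbers. -/
def encodeDConfig (c : DConfig) : ℕ :=
  Encodable.encode (c.g, c.act, c.pend)

/-! ### Existential predicates over primitive recursive ones -/

section Sig

variable {α : Type*} {β : Type*} [Primcodable α] [Primcodable β]

/-- Predicates obtained by unbounded existential quantification over a primitive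
recursive predicate. -/
def Sig (p : α → Prop) : Prop :=
  ∃ q : α × ℕ → Prop, PrimrecPred q ∧ ∀ a, p a ↔ ∃ n, q (a, n)

theorem Sig.of_primrec {p : α → Prop} (hp : PrimrecPred p) : Sig p :=
  ⟨fun x => p x.1, hp.comp Primrec.fst, fun _ => by simp⟩

theorem Sig.of_iff {p q : α → Prop} (hp : Sig p) (h : ∀ a, q a ↔ p a) : Sig q := by
  have : q = p := funext fun a => propext (h a)
  rwa [this]

theorem Sig.comp {p : β → Prop} {f : α → β} (hp : Sig p) (hf : Primrec f) :
    Sig fun a => p (f a) := by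
  obtain ⟨q, hq, h⟩ := hp
  exact ⟨fun x => q (f x.1, x.2),
    hq.comp ((hf.comp Primrec.fst).pair Primrec.snd), fun a => h _⟩

theorem Sig.and {p q : α → Prop} (hp : Sig p) (hq : Sig q) : Sig fun a => p a ∧ q a := by
  obtain ⟨p', hp', h⟩ := hp
  obtain ⟨q', hq', h'⟩ := hq
  refine ⟨fun x => p' (x.1, x.2.unpair.1) ∧ q' (x.1, x.2.unpair.2), ?_, fun a => ?_⟩
  · exact (hp'.comp (Primrec.fst.pair ((Primrec.fst.comp Primrec.unpair).comp Primrec.snd))).and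
      (hq'.comp (Primrec.fst.pair ((Primrec.snd.comp Primrec.unpair).comp Primrec.snd)))
  · show p a ∧ q a ↔ _
    rw [h, h']
    constructor
    · rintro ⟨⟨m, hm⟩, n, hn⟩
      exact ⟨Nat.pair m n, by simpa using hm, by simpa using hn⟩
    · rintro ⟨n, h1, h2⟩
      exact ⟨⟨_, h1⟩, _, h2⟩

theorem Sig.or {p q : α → Prop} (hp : Sig p) (hq : Sig q) : Sig fun a => p a ∨ q a := by
  obtain ⟨p', hp', h⟩ := hp
  obtain ⟨q', hq', h'⟩ := hq
  exact ⟨fun x => p' x ∨ q' x, hp'.or hq', fun a => by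
    show p a ∨ q a ↔ _
    rw [h, h', ← exists_or]⟩

theorem Sig.ex {p : α → β → Prop} (hp : Sig fun x : α × β => p x.1 x.2) :
    Sig fun a => ∃ b, p a b := by
  classical
  obtain ⟨q, hq, h⟩ := hp
  have hq' : PrimrecPred fun x : (α × ℕ) × β => q ((x.1.1, x.2), x.1.2.unpair.2) :=
    hq.comp (((Primrec.fst.comp Primrec.fst).pair Primrec.snd).pair
      ((Primrec.snd.comp Primrec.unpair).comp (Primrec.snd.comp Primrec.fst)))
  let f : α × ℕ → Bool := fun x => Option.casesOn (Encodable.decode (α := β) x.2.unpair.1) false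
    fun b => decide (q ((x.1, b), x.2.unpair.2))
  have hf : Primrec f := by
    refine Primrec.option_casesOn
      (Primrec.decode.comp ((Primrec.fst.comp Primrec.unpair).comp Primrec.snd))
      (Primrec.const false) hq'.decide
  refine ⟨fun x => f x = true, Primrec.eq.comp hf (Primrec.const true), fun a => ?_⟩
  constructor
  · rintro ⟨b, hb⟩
    obtain ⟨n, hn⟩ := (h (a, b)).1 hb
    exact ⟨Nat.pair (Encodable.encode b) n, by simpa [f] using hn⟩
  · rintro ⟨n, hn⟩
    simp only [f] at hn
    cases hd : Encodable.decode (α := β) n.unpair.1 with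
    | none => rw [hd] at hn; simp at hn
    | some b =>
      rw [hd] at hn
      exact ⟨b, (h (a, b)).2 ⟨_, of_decide_eq_true hn⟩⟩

theorem Sig.ball {p : α → β → Prop} {l : α → List β} (hp : Sig fun x : α × β => p x.1 x.2)
    (hl : Primrec l) : Sig fun a => ∀ b ∈ l a, p a b := by
  obtain ⟨q, hq, h⟩ := hp
  have h0 : PrimrecRel fun (L : List ℕ) (x : α × β) => ∃ k ∈ L, q (x, k) :=
    PrimrecRel.exists_mem_list (R := fun (k : ℕ) (x : α × β) => q (x, k))
      (hq.comp (Primrec.snd.pair Primrec.fst))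
  have h1 : PrimrecRel fun (n : ℕ) (x : α × β) => ∃ k < n, q (x, k) :=
    (PrimrecRel.comp h0 (Primrec.list_range.comp Primrec.fst) Primrec.snd).of_eq
      fun x => by simp only [List.mem_range]
  have h2 : PrimrecRel fun (L : List β) (x : α × ℕ) => ∀ b ∈ L, ∃ k < x.2, q ((x.1, b), k) :=
    PrimrecRel.forall_mem_list (R := fun (b : β) (x : α × ℕ) => ∃ k < x.2, q ((x.1, b), k))
      (PrimrecRel.comp h1 (Primrec.snd.comp Primrec.snd)
        ((Primrec.fst.comp Primrec.snd).pair Primrec.fst))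
  refine ⟨fun x => ∀ b ∈ l x.1, ∃ k < x.2, q ((x.1, b), k),
    PrimrecRel.comp h2 (hl.comp Primrec.fst) Primrec.id, fun a => ?_⟩
  show (∀ b ∈ l a, p a b) ↔ ∃ n, ∀ b ∈ l a, ∃ k < n, q ((a, b), k)
  constructor
  · intro H
    generalize l a = L at H ⊢
    induction L with
    | nil => exact ⟨0, by simp⟩
    | cons b L ih =>
      obtain ⟨n, hn⟩ := ih fun b hb => H b (List.mem_cons_of_mem _ hb)
      obtain ⟨m, hm⟩ := (h (a, b)).1 (H b List.mem_cons_self)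
      refine ⟨max n (m + 1), fun c hc => ?_⟩
      rcases List.mem_cons.1 hc with rfl | hc
      · exact ⟨m, by simp, hm⟩
      · obtain ⟨k, hk, hk'⟩ := hn c hc
        exact ⟨k, by simp [hk], hk'⟩
  · rintro ⟨n, hn⟩ b hb
    obtain ⟨k, _, hk⟩ := hn b hb
    exact (h (a, b)).2 ⟨k, hk⟩

theorem Sig.re {p : α → Prop} (hp : Sig p) : REPred p := by
  classical
  obtain ⟨q, hq, h⟩ := hp
  let f : α → ℕ → Bool := fun a n => decide (q (a, n))
  have hf : Computable₂ f := (Primrec.to_comp hq.decide)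
  have : Partrec fun a => (Nat.rfind fun n => Part.some (f a n)).map fun _ => () :=
    (Partrec.rfind hf.partrec₂).map (Computable.const ()).to₂
  refine this.of_eq fun a => ?_
  ext u
  rw [Part.mem_map_iff, Part.mem_assert_iff]
  constructor
  · rintro ⟨n, hn, _⟩
    have hn := (Nat.mem_rfind.1 hn).1
    exact ⟨(h a).2 ⟨n, by simpa [f] using hn⟩, by simp⟩
  · rintro ⟨hn, _⟩
    have hn := (h a).1 hn
    refine ⟨Nat.find hn, Nat.mem_rfind.2 ⟨?_, ?_⟩, rfl⟩
    · simpa [f] using Nat.find_spec hn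
    · intro m hm
      have := Nat.find_min hn hm
      simpa [f] using this

theorem Sig.eq {f g : α → β} (hf : Primrec f) (hg : Primrec g) : Sig fun a => f a = g a :=
  haveI := Classical.decEq β
  .of_primrec (Primrec.eq.comp hf hg)

theorem Sig.mem {f : α → β} {l : α → List β} (hf : Primrec f) (hl : Primrec l) :
    Sig fun a => f a ∈ l a := by
  have h1 : PrimrecRel fun (L : List β) (b : β) => ∃ a ∈ L, a = b :=
    PrimrecRel.exists_mem_list (R := fun a b : β => a = b) Primrec.eq
  refine (Sig.of_primrec (PrimrecRel.comp h1 hl hf)).of_iff fun a => by simp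

theorem Sig.bex {p : α → β → Prop} {l : α → List β} (hp : Sig fun x : α × β => p x.1 x.2)
    (hl : Primrec l) : Sig fun a => ∃ b ∈ l a, p a b :=
  Sig.ex ((Sig.mem Primrec.snd (hl.comp Primrec.fst)).and hp)

theorem Sig.lt {f g : α → ℕ} (hf : Primrec f) (hg : Primrec g) : Sig fun a => f a < g a :=
  .of_primrec (Primrec.nat_lt.comp hf hg)

theorem primrec_count [DecidableEq β] {f : α → β} {l : α → List β} (hf : Primrec f)
    (hl : Primrec l) : Primrec fun a => (l a).count (f a) := by
  have h := PrimrecRel.listFilter (R := fun a b : β => a = b) Primrec.eq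
  refine (Primrec.list_length.comp (h.comp hl hf)).of_eq fun a => ?_
  rw [List.count_eq_length_filter]
  congr 1

theorem Sig.perm {f g : α → List β} (hf : Primrec f) (hg : Primrec g) :
    Sig fun a => (f a).Perm (g a) := by
  classical
  have : Sig fun a => ∀ b ∈ f a ++ g a, (f a).count b = (g a).count b :=
    Sig.ball (Sig.eq (primrec_count Primrec.snd (hf.comp Primrec.fst))
      (primrec_count Primrec.snd (hg.comp Primrec.fst))) (Primrec.list_append.comp hf hg)
  refine this.of_iff fun a => ?_
  rw [List.perm_iff_count]
  refine ⟨fun h b _ => h b, fun h b => ?_⟩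
  by_cases hb : b ∈ f a ++ g a
  · exact h b hb
  · simp only [List.mem_append, not_or] at hb
    rw [List.count_eq_zero_of_not_mem hb.1, List.count_eq_zero_of_not_mem hb.2]

theorem Sig.reflTransGen {R : α → β → β → Prop}
    (hR : Sig fun x : α × β × β => R x.1 x.2.1 x.2.2) :
    Sig fun x : α × β × β => Relation.ReflTransGen (R x.1) x.2.1 x.2.2 := by
  have h1 : Sig fun x : (α × β × β) × List (β × ℕ) => ∃ e ∈ x.2, e.1 = x.1.2.2 :=
    Sig.bex (p := fun (x : (α × β × β) × List (β × ℕ)) (e : β × ℕ) => e.1 = x.1.2.2)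
      (Sig.eq (Primrec.fst.comp Primrec.snd) (Primrec.snd.comp (Primrec.snd.comp
        (Primrec.fst.comp Primrec.fst)))) Primrec.snd
  have h2 : Sig fun x : ((α × β × β) × List (β × ℕ)) × (β × ℕ) =>
      ∃ e' ∈ x.1.2, e'.2 < x.2.2 ∧ R x.1.1.1 e'.1 x.2.1 :=
    Sig.bex (p := fun (x : ((α × β × β) × List (β × ℕ)) × (β × ℕ)) (e' : β × ℕ) =>
        e'.2 < x.2.2 ∧ R x.1.1.1 e'.1 x.2.1)
      (Sig.and (Sig.lt (Primrec.snd.comp Primrec.snd)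
        (Primrec.snd.comp (Primrec.snd.comp Primrec.fst)))
        (hR.comp (f := fun y : (((α × β × β) × List (β × ℕ)) × (β × ℕ)) × (β × ℕ) =>
          (y.1.1.1.1, y.2.1, y.1.2.1))
          ((Primrec.fst.comp (Primrec.fst.comp (Primrec.fst.comp Primrec.fst))).pair
            ((Primrec.fst.comp Primrec.snd).pair
              (Primrec.fst.comp (Primrec.snd.comp Primrec.fst))))))
      (Primrec.snd.comp Primrec.fst)
  have h3 : Sig fun x : (α × β × β) × List (β × ℕ) =>
      ∀ e ∈ x.2, e.1 = x.1.2.1 ∨ ∃ e' ∈ x.2, e'.2 < e.2 ∧ R x.1.1 e'.1 e.1 :=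
    Sig.ball (p := fun (x : (α × β × β) × List (β × ℕ)) (e : β × ℕ) =>
        e.1 = x.1.2.1 ∨ ∃ e' ∈ x.2, e'.2 < e.2 ∧ R x.1.1 e'.1 e.1)
      (Sig.or (Sig.eq (Primrec.fst.comp Primrec.snd) (Primrec.fst.comp (Primrec.snd.comp
        (Primrec.fst.comp Primrec.fst)))) h2) Primrec.snd
  have key : Sig fun x : α × β × β => ∃ l : List (β × ℕ), (∃ e ∈ l, e.1 = x.2.2) ∧
      ∀ e ∈ l, e.1 = x.2.1 ∨ ∃ e' ∈ l, e'.2 < e.2 ∧ R x.1 e'.1 e.1 :=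
    Sig.ex (Sig.and h1 h3)
  refine key.of_iff ?_
  rintro ⟨a, b, c⟩
  simp only
  constructor
  · intro h
    suffices H : ∃ (l : List (β × ℕ)) (n : ℕ), (c, n) ∈ l ∧ (∀ e ∈ l, e.2 ≤ n) ∧
        ∀ e ∈ l, e.1 = b ∨ ∃ e' ∈ l, e'.2 < e.2 ∧ R a e'.1 e.1 by
      obtain ⟨l, n, h1, _, h2⟩ := H
      exact ⟨l, ⟨_, h1, rfl⟩, h2⟩
    induction h with
    | refl => exact ⟨[(b, 0)], 0, by simp, by simp, by simp⟩
    | tail _ hs ih =>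
      obtain ⟨l, n, h1, h2, h3⟩ := ih
      refine ⟨(_, n + 1) :: l, n + 1, List.mem_cons_self, ?_, ?_⟩
      · intro e he
        rcases List.mem_cons.1 he with rfl | he
        · exact le_rfl
        · exact (h2 e he).trans (Nat.le_succ _)
      · intro e he
        rcases List.mem_cons.1 he with rfl | he
        · exact Or.inr ⟨_, List.mem_cons_of_mem _ h1, Nat.lt_succ_self _, hs⟩
        · exact (h3 e he).imp id fun ⟨e', h, h'⟩ => ⟨e', List.mem_cons_of_mem _ h, h'⟩
  · rintro ⟨l, ⟨e, he, rfl⟩, hl⟩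
    suffices H : ∀ n, ∀ e ∈ l, e.2 = n → Relation.ReflTransGen (R a) b e.1 from H _ e he rfl
    intro n
    induction n using Nat.strong_induction_on with
    | _ n ih =>
      rintro e he rfl
      rcases hl e he with h | ⟨e', he', hlt, hr⟩
      · rw [h]
      · exact (ih _ hlt e' he' rfl).tail hr

end Sig

/-! ### A transposition theorem for integer vectors -/

section Farkas

theorem farkas_dual {V ι : Type*} [AddCommGroup V] [Module ℚ V] (s : Finset ι) :
    ∀ (α : ι → Module.Dual ℚ V) (γ : Module.Dual ℚ V),
      (∀ x, (∀ i ∈ s, α i x ≤ 0) → γ x ≤ 0) →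
      ∃ u : ι → ℚ, (∀ i, 0 ≤ u i) ∧ γ = ∑ i ∈ s, u i • α i := by
  classical
  induction s using Finset.induction_on with
  | empty =>
    intro α γ h
    refine ⟨fun _ => 0, fun _ => le_rfl, ?_⟩
    ext x
    have h1 := h x (by simp)
    have h2 := h (-x) (by simp)
    simp only [map_neg] at h2
    simp only [Finset.sum_empty, LinearMap.zero_apply]
    linarith
  | insert j s hj ih =>
    intro α γ h
    by_cases hc : ∀ x, (∀ i ∈ s, α i x ≤ 0) → γ x ≤ 0
    · obtain ⟨u, hu, hγ⟩ := ih α γ hc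
      refine ⟨fun i => if i = j then 0 else u i, fun i => by
        show 0 ≤ if i = j then _ else _
        split <;> simp [hu], ?_⟩
      rw [Finset.sum_insert hj, hγ]
      simp only [if_true, zero_smul, zero_add]
      refine Finset.sum_congr rfl fun i hi => ?_
      rw [if_neg (by rintro rfl; exact hj hi)]
    · push Not at hc
      obtain ⟨x₀, hx₀, hγ₀⟩ := hc
      have hj0 : 0 < α j x₀ := by
        by_contra hle
        push Not at hle
        have := h x₀ fun i hi => (Finset.mem_insert.1 hi).elim (fun e => e ▸ hle) (hx₀ i)
        linarith
      obtain ⟨z, hz1, hz2, hz3⟩ : ∃ z, α j z = 1 ∧ (∀ i ∈ s, α i z ≤ 0) ∧ 0 < γ z := by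
        refine ⟨(α j x₀)⁻¹ • x₀, ?_, fun i hi => ?_, ?_⟩
        · simp [hj0.ne']
        · simp only [map_smul, smul_eq_mul]
          exact mul_nonpos_of_nonneg_of_nonpos (inv_nonneg.2 hj0.le) (hx₀ i hi)
        · simp only [map_smul, smul_eq_mul]
          positivity
      obtain ⟨u, hu, hγ⟩ := ih (fun i => α i - α i z • α j) (γ - γ z • α j) (by
        intro x hx
        have := h (x - α j x • z) (by
          intro i hi
          rcases Finset.mem_insert.1 hi with rfl | hi
          · simp [hz1]
          · have := hx i hi
            simp only [LinearMap.sub_apply, LinearMap.smul_apply, smul_eq_mul, map_sub,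
              map_smul] at this ⊢
            linarith)
        simp only [LinearMap.sub_apply, LinearMap.smul_apply, smul_eq_mul, map_sub,
              map_smul] at this ⊢
        linarith)
      have hc : 0 ≤ γ z - ∑ i ∈ s, u i * α i z := by
        have : ∑ i ∈ s, u i * α i z ≤ 0 :=
          Finset.sum_nonpos fun i hi => mul_nonpos_of_nonneg_of_nonpos (hu i) (hz2 i hi)
        linarith
      refine ⟨fun i => if i = j then γ z - ∑ i ∈ s, u i * α i z else u i,
        fun i => by
          show 0 ≤ if i = j then _ else _
          split
          · exact hc
          · exact hu i, ?_⟩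
      rw [Finset.sum_insert hj]
      simp only [if_true]
      rw [Finset.sum_congr rfl (g := fun i => u i • α i) fun i hi => by
        rw [if_neg (by rintro rfl; exact hj hi)]]
      ext x
      have := congrArg (fun f => f x) hγ
      simp only [LinearMap.sub_apply, LinearMap.smul_apply, smul_eq_mul, LinearMap.sum_apply,
        LinearMap.add_apply] at this ⊢
      have e : ∑ i ∈ s, u i * (α i x - α i z * α j x)
          = ∑ i ∈ s, u i * α i x - (∑ i ∈ s, u i * α i z) * α j x := by
        rw [Finset.sum_mul, ← Finset.sum_sub_distrib]
        exact Finset.sum_congr rfl fun i _ => by ring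
      rw [e] at this
      linarith

theorem exists_nat_scaling {ι : Type*} [Finite ι] (x : ι → ℚ) (hx : ∀ i, 0 ≤ x i) :
    ∃ (D : ℕ) (z : ι → ℕ), 0 < D ∧ ∀ i, (z i : ℚ) = D * x i := by
  cases nonempty_fintype ι
  refine ⟨∏ i, (x i).den, fun i => ((∏ i, (x i).den) / (x i).den) * (x i).num.toNat,
    Finset.prod_pos fun i _ => (x i).den_pos, fun i => ?_⟩
  have hd : (x i).den ∣ ∏ i, (x i).den := Finset.dvd_prod_of_mem _ (Finset.mem_univ i)
  obtain ⟨k, hk⟩ := hd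
  have h0 : ((x i).den : ℚ) ≠ 0 := by exact_mod_cast (x i).den_nz
  have hn : (((x i).num.toNat : ℕ) : ℚ) = ((x i).num : ℚ) := by
    have := Int.toNat_of_nonneg (Rat.num_nonneg.2 (hx i))
    exact_mod_cast this
  show ((((∏ i, (x i).den) / (x i).den) * (x i).num.toNat : ℕ) : ℚ) = _
  rw [hk, Nat.mul_div_cancel_left _ (x i).den_pos]
  push_cast
  rw [hn]
  have e := Rat.mul_den_eq_num (x i)
  rw [← e]
  ring

theorem transposition {ι κ : Type*} [Fintype ι] [Fintype κ] (a : ι → κ → ℤ) :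
    (∃ x : ι → ℕ, (∀ i, 0 < x i) ∧ ∀ k, 0 ≤ ∑ i, (x i : ℤ) * a i k) ∨
    (∃ y : κ → ℕ, (∀ i, ∑ k, (y k : ℤ) * a i k ≤ 0) ∧ ∃ i, ∑ k, (y k : ℤ) * a i k < 0) := by
  classical
  rw [or_iff_not_imp_right]
  intro hno
  have step : ∀ i₀, ∃ u : ι → ℚ, (∀ i, 0 ≤ u i) ∧ ∀ k, 0 ≤ (a i₀ k : ℚ) + ∑ i, u i * a i k := by
    intro i₀
    let φ : (κ → ℤ) → Module.Dual ℚ (κ → ℚ) := fun c => ∑ k, (c k : ℚ) • LinearMap.proj k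
    have hφ : ∀ c y, φ c y = ∑ k, y k * (c k : ℚ) := fun c y => by
      simp only [φ, LinearMap.sum_apply, LinearMap.smul_apply, LinearMap.proj_apply, smul_eq_mul]
      exact Finset.sum_congr rfl fun _ _ => mul_comm _ _
    let α : ι ⊕ κ → Module.Dual ℚ (κ → ℚ) :=
      Sum.elim (fun i => φ (a i)) fun k => -LinearMap.proj k
    obtain ⟨u, hu, h⟩ := farkas_dual Finset.univ α (-φ (a i₀)) (by
      intro y hy
      by_contra hlt
      push Not at hlt
      refine hno ?_
      have hy0 : ∀ k, 0 ≤ y k := fun k => by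
        have := hy (Sum.inr k) (Finset.mem_univ _)
        simpa [α] using this
      obtain ⟨D, z, hD, hz⟩ := exists_nat_scaling y hy0
      have hval : ∀ i, ((∑ k, (z k : ℤ) * a i k : ℤ) : ℚ) = D * φ (a i) y := fun i => by
        push_cast
        rw [hφ, Finset.mul_sum]
        refine Finset.sum_congr rfl fun k _ => ?_
        rw [hz]
        ring
      have hDq : (0 : ℚ) < D := by exact_mod_cast hD
      refine ⟨z, fun i => ?_, i₀, ?_⟩
      · have := hy (Sum.inl i) (Finset.mem_univ _)
        have h' : ((∑ k, (z k : ℤ) * a i k : ℤ) : ℚ) ≤ 0 := by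
          rw [hval]
          exact mul_nonpos_of_nonneg_of_nonpos hDq.le this
        exact_mod_cast h'
      · have h' : ((∑ k, (z k : ℤ) * a i₀ k : ℤ) : ℚ) < 0 := by
          rw [hval]
          simp only [LinearMap.neg_apply] at hlt
          exact mul_neg_of_pos_of_neg hDq (by linarith)
        exact_mod_cast h')
    refine ⟨fun i => u (Sum.inl i), fun i => hu _, fun k => ?_⟩
    have := congrArg (fun f => f (Pi.single k 1)) h
    rw [Fintype.sum_sum_type] at this
    simp only [LinearMap.neg_apply, LinearMap.add_apply, LinearMap.sum_apply,
      LinearMap.smul_apply, smul_eq_mul, α, Sum.elim_inl, Sum.elim_inr, hφ, LinearMap.proj_apply,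
      Pi.single_apply, ite_mul, one_mul, zero_mul, Finset.sum_ite_eq', Finset.mem_univ,
      if_true] at this
    have h1 : ∑ x, u (Sum.inr x) * -(if x = k then (1 : ℚ) else 0) = - u (Sum.inr k) := by
      simp
    rw [h1] at this
    have := hu (Sum.inr k)
    linarith
  choose u hu hk using step
  obtain ⟨D, x, hD, hx⟩ := exists_nat_scaling (fun i => 1 + ∑ i₀, u i₀ i) fun i =>
    add_nonneg zero_le_one (Finset.sum_nonneg fun i₀ _ => hu i₀ i)
  have hDq : (0 : ℚ) < D := by exact_mod_cast hD
  refine ⟨x, fun i => ?_, fun k => ?_⟩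
  · have h' : (0 : ℚ) < x i := by
      rw [hx]
      have : 0 ≤ ∑ i₀, u i₀ i := Finset.sum_nonneg fun i₀ _ => hu i₀ i
      positivity
    exact_mod_cast h'
  · have h' : (0 : ℚ) ≤ ((∑ i, (x i : ℤ) * a i k : ℤ) : ℚ) := by
      push_cast
      have e : ∑ i, (x i : ℚ) * a i k
          = D * ∑ i₀, ((a i₀ k : ℚ) + ∑ i, u i₀ i * a i k) := by
        rw [Finset.sum_add_distrib, Finset.sum_comm, ← Finset.sum_add_distrib, Finset.mul_sum]
        refine Finset.sum_congr rfl fun i _ => ?_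
        rw [hx, ← Finset.sum_mul]
        ring
      rw [e]
      exact mul_nonneg hDq.le (Finset.sum_nonneg fun i₀ _ => hk i₀ k)
    exact_mod_cast h'

end Farkas

/-! ### Closed walks through balanced connected multigraphs -/

section Euler

variable {ι V : Type*} (src dst : ι → V)

/-- `IsWalk src dst a w b`: the list of edges `w` is a walk from `a` to `b`. -/
def IsWalk (a : V) : List ι → V → Prop
  | [], b => a = b
  | e :: w, b => src e = a ∧ IsWalk (dst e) w b

variable {src dst}

theorem isWalk_append {w w' : List ι} : ∀ {a c : V},
    IsWalk src dst a (w ++ w') c ↔ ∃ b, IsWalk src dst a w b ∧ IsWalk src dst b w' c := by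
  induction w with
  | nil => simp [IsWalk]
  | cons e w ih => simp [IsWalk, ih, and_assoc]

theorem IsWalk.countP_eq [DecidableEq V] {w : List ι} : ∀ {a b : V}, IsWalk src dst a w b →
    ∀ v, w.countP (fun e => src e = v) + (if b = v then 1 else 0)
      = w.countP (fun e => dst e = v) + (if a = v then 1 else 0) := by
  induction w with
  | nil => rintro a b rfl v; simp
  | cons e w ih =>
    rintro a b ⟨rfl, h⟩ v
    have := ih h v
    simp only [List.countP_cons, decide_eq_true_eq]
    omega

theorem exists_closed_walk (M : Multiset ι) (hM : M ≠ 0)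
    (hbal : ∀ v, ∀ [DecidableEq V], M.countP (fun e => src e = v) = M.countP (fun e => dst e = v))
    (hconn : ∀ U : Set V, (∀ e ∈ M, (src e ∈ U ↔ dst e ∈ U)) → (∃ e ∈ M, src e ∈ U) →
      ∀ e ∈ M, src e ∈ U) :
    ∃ (w : List ι) (a : V), (w : Multiset ι) = M ∧ IsWalk src dst a w a := by
  classical
  let P : Set (List ι) := {w | (w : Multiset ι) ≤ M ∧ ∃ a b, IsWalk src dst a w b}
  obtain ⟨e₀, he₀⟩ := Multiset.exists_mem_of_ne_zero hM
  have hne : P.Nonempty := ⟨[e₀], by simpa using he₀, src e₀, dst e₀, by simp [IsWalk]⟩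
  let f : List ι → ℕ := fun w => Multiset.card M - w.length
  obtain ⟨w, ⟨hwM, a, b, hw⟩, hmin⟩ := (measure f).wf.has_min P hne
  have hmax : ∀ w' ∈ P, w'.length ≤ w.length := by
    intro w' hw'
    by_contra hlt
    refine hmin w' hw' ?_
    have h1 := Multiset.card_le_card hw'.1
    simp only [Multiset.coe_card] at h1
    show Multiset.card M - w'.length < Multiset.card M - w.length
    omega
  have hext : ∀ (w' : List ι) (a' b' : V) (e : ι), IsWalk src dst a' w' b' → List.Perm w' w →
      e ∈ M - (w : Multiset ι) → src e ≠ b' := by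
    intro w' a' b' e hw' hp he heq
    have : w' ++ [e] ∈ P := by
      refine ⟨?_, a', dst e, isWalk_append.2 ⟨b', hw', heq, rfl⟩⟩
      have h1 : ({e} : Multiset ι) ≤ M - w := by simpa using he
      have h2 := add_le_add_right h1 (w : Multiset ι)
      rw [add_tsub_cancel_of_le hwM] at h2
      refine le_trans (le_of_eq ?_) h2
      rw [← Multiset.coe_add, Multiset.coe_eq_coe.2 hp]
      rfl
    have := hmax _ this
    rw [List.length_append, hp.length_eq] at this
    simp at this
  have hR : ∀ v, (M - w).countP (fun e => src e = v) + w.countP (fun e => src e = v)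
      = (M - w).countP (fun e => dst e = v) + w.countP (fun e => dst e = v) := by
    intro v
    have h := hbal v
    rw [← tsub_add_cancel_of_le hwM, Multiset.countP_add, Multiset.countP_add,
      Multiset.coe_countP, Multiset.coe_countP] at h
    exact h
  have hab : a = b := by
    by_contra hne
    have h1 := hR b
    have h2 := hw.countP_eq b
    rw [if_pos rfl, if_neg hne] at h2
    have h3 : 0 < (M - w).countP (fun e => src e = b) := by omega
    obtain ⟨e, he, hs⟩ := Multiset.countP_pos.1 h3
    exact hext w a b e hw (List.Perm.refl _) he hs
  subst hab
  refine ⟨w, a, ?_, hw⟩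
  by_contra hneq
  have hbalR : ∀ v, (M - w).countP (fun e => src e = v) = (M - w).countP (fun e => dst e = v) := by
    intro v
    have h1 := hR v
    have h2 := hw.countP_eq v
    omega
  let U : Set V := {v | ∃ e ∈ w, src e = v}
  have hrot : ∀ e' ∈ w, ∃ w', List.Perm w' w ∧ IsWalk src dst (src e') w' (src e') := by
    intro e' he'
    obtain ⟨w1, w2, rfl⟩ := List.append_of_mem he'
    obtain ⟨c, hc1, hc2, hc3⟩ := isWalk_append.1 hw
    refine ⟨(e' :: w2) ++ w1, List.perm_append_comm, ?_⟩
    subst hc2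
    exact isWalk_append.2 ⟨a, ⟨rfl, hc3⟩, hc1⟩
  have hRsrc : ∀ e ∈ M - (w : Multiset ι), src e ∉ U := by
    rintro e he ⟨e', he', heq⟩
    obtain ⟨w', hp, hw'⟩ := hrot e' he'
    exact hext w' _ _ e hw' hp he heq.symm
  have hRdst : ∀ e ∈ M - (w : Multiset ι), dst e ∉ U := by
    intro e he hU
    have h1 : 0 < (M - w).countP (fun e' => dst e' = dst e) :=
      Multiset.countP_pos.2 ⟨e, he, rfl⟩
    rw [← hbalR] at h1
    obtain ⟨e', he', hs⟩ := Multiset.countP_pos.1 h1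
    exact hRsrc e' he' (hs ▸ hU)
  have hwdst : ∀ e ∈ w, dst e ∈ U := by
    intro e he
    have h2 := hw.countP_eq (dst e)
    have h3 : 0 < w.countP (fun e' => dst e' = dst e) := List.countP_pos_iff.2 ⟨e, he, by simp⟩
    have h4 : 0 < w.countP (fun e' => src e' = dst e) := by omega
    obtain ⟨e', he', hs⟩ := List.countP_pos_iff.1 h4
    exact ⟨e', he', by simpa using hs⟩
  have hsplit : ∀ e ∈ M, e ∈ M - (w : Multiset ι) ∨ e ∈ w := by
    intro e he
    rw [← tsub_add_cancel_of_le hwM, Multiset.mem_add] at he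
    simpa using he
  have hwne : w ≠ [] := by
    rintro rfl
    have := hmax [e₀] ⟨by simpa using he₀, src e₀, dst e₀, by simp [IsWalk]⟩
    simp at this
  obtain ⟨e₁, he₁⟩ := List.exists_mem_of_ne_nil w hwne
  have hall := hconn U (fun e he => by
    rcases hsplit e he with h | h
    · exact iff_of_false (hRsrc e h) (hRdst e h)
    · exact iff_of_true ⟨e, h, rfl⟩ (hwdst e h))
    ⟨e₁, Multiset.mem_of_le hwM (by simpa using he₁), e₁, he₁, rfl⟩
  have hne : M - (w : Multiset ι) ≠ 0 := fun h =>
    hneq (le_antisymm hwM (tsub_eq_zero_iff_le.1 h))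
  obtain ⟨e, he⟩ := Multiset.exists_mem_of_ne_zero hne
  exact hRsrc e he (hall e (Multiset.mem_of_le tsub_le_self he))

end Euler

/-! ### Lossy nets with unbounded outputs -/

section Net

variable {τ : Type} [DecidableEq τ]

/-- A vector over `ℕ∞`: a list recording finite multiplicities, and the list of infinite
coordinates. -/
abbrev Vec (τ : Type) : Type := List τ × List τ

/-- The value of a vector at a coordinate. -/
def Vec.val (u : Vec τ) (x : τ) : ℕ∞ := if x ∈ u.2 then ⊤ else (u.1.count x : ℕ∞)

/-- A transition: its effect on the global state, its precondition, its output, and whether it is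
productive. -/
abbrev Trn (τ : Type) : Type := Option (ℕ × ℕ) × List τ × Vec τ × Bool

/-- The possible successors of a global state. -/
def ctl (o : Option (ℕ × ℕ)) (g : ℕ) : List ℕ :=
  Option.casesOn o [g] fun x => if x.1 = g then [x.2] else []

abbrev Node (τ : Type) : Type := ℕ × Vec τ

abbrev Edge (τ : Type) : Type := Node τ × Trn τ × Node τ

/-- One step of the lossy net; the output may use coordinates with infinite output arbitrarily
often. -/
def Fires (t : Trn τ) (c c' : ℕ × Multiset τ) : Prop :=
  c'.1 ∈ ctl t.1 c.1 ∧ ∃ rest u u2 : Multiset τ, c.2 = (t.2.1 : Multiset τ) + rest ∧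
    c'.2 = rest + u ∧ u ≤ (t.2.2.1.1 : Multiset τ) + u2 ∧ ∀ p ∈ u2, p ∈ t.2.2.1.2

/-- The covering condition for an edge of a certificate. -/
def EdgeOK (n : Node τ) (t : Trn τ) (n' : Node τ) : Prop :=
  ∀ x, n.2.val x + t.2.2.1.val x ≤ n'.2.val x + (t.2.1.count x : ℕ∞)

/-- The weight of a list of tokens. -/
def dot (y F : List τ) : ℕ := (F.map fun p => y.count p).sum

/-- All sublists of a list. -/
def subs {α : Type*} (l : List α) : List (List α) :=
  l.foldr (fun a r => r ++ r.map (a :: ·)) [[]]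

/-- A set of edges that cannot be the set of edges used infinitely often by a run with infinitely
many productive steps. -/
def Good (F : List (Edge τ)) : Prop :=
  (∀ e ∈ F, e.2.1.2.2.2 = false) ∨
  (∃ (y : List τ) (z : List (Node τ)),
    (∀ e ∈ F, (∀ p ∈ y, p ∉ e.2.1.2.2.1.2) ∧
      dot y e.2.1.2.2.1.1 + z.count e.2.2 ≤ dot y e.2.1.2.1 + z.count e.1) ∧
    ∃ e ∈ F, dot y e.2.1.2.2.1.1 + z.count e.2.2 < dot y e.2.1.2.1 + z.count e.1) ∨
  (∃ U : List (Node τ), (∀ e ∈ F, (e.1 ∈ U ∧ e.2.2 ∈ U) ∨ (e.1 ∉ U ∧ e.2.2 ∉ U)) ∧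
    (∃ e ∈ F, e.1 ∈ U) ∧ ∃ e ∈ F, e.1 ∉ U)

/-- A certificate for the absence of runs with infinitely many productive steps. -/
structure Cert (Tr : List (Trn τ)) (g0 : ℕ) (c0 : List τ) (M : List (Node τ))
    (E : List (Edge τ)) : Prop where
  init : ∃ n ∈ M, n.1 = g0 ∧ ∀ x ∈ c0, (c0.count x : ℕ∞) ≤ n.2.val x
  step : ∀ n ∈ M, ∀ t ∈ Tr, ∀ g' ∈ ctl t.1 n.1,
    (∀ x ∈ t.2.1, (t.2.1.count x : ℕ∞) ≤ n.2.val x) →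
    ∃ n' ∈ M, n'.1 = g' ∧ (n, t, n') ∈ E ∧ EdgeOK n t n'
  good : ∀ F ∈ subs E, Good F

theorem mem_subs_filter {α : Type*} (p : α → Bool) (l : List α) : l.filter p ∈ subs l := by
  induction l with
  | nil => simp [subs]
  | cons a l ih =>
    simp only [subs, List.foldr_cons, List.mem_append, List.mem_map] at ih ⊢
    by_cases h : p a = true
    · exact Or.inr ⟨_, ih, by simp [h]⟩
    · exact Or.inl (by simpa [h] using ih)

theorem mem_of_mem_subs {α : Type*} {l F : List α} (h : F ∈ subs l) : ∀ e ∈ F, e ∈ l := by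
  induction l generalizing F with
  | nil => simp [subs] at h; simp [h]
  | cons a l ih =>
    simp only [subs, List.foldr_cons, List.mem_append, List.mem_map] at h
    rcases h with h | ⟨F', h, rfl⟩
    · exact fun e he => List.mem_cons_of_mem _ (ih h e he)
    · intro e he
      rcases List.mem_cons.1 he with rfl | he
      · exact List.mem_cons_self
      · exact List.mem_cons_of_mem _ (ih h e he)

/-- The weight of a multiset of tokens. -/
def wt (y : List τ) (c : Multiset τ) : ℕ := (c.map fun p => y.count p).sum

theorem wt_add (y : List τ) (c d : Multiset τ) : wt y (c + d) = wt y c + wt y d := by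
  simp [wt]

theorem wt_coe (y F : List τ) : wt y (F : Multiset τ) = dot y F := by
  simp [wt, dot]

theorem wt_mono (y : List τ) {c d : Multiset τ} (h : c ≤ d) : wt y c ≤ wt y d := by
  obtain ⟨e, rfl⟩ := Multiset.le_iff_exists_add.1 h
  rw [wt_add]
  omega

theorem wt_eq_zero {y : List τ} {c : Multiset τ} (h : ∀ p ∈ y, p ∉ c) : wt y c = 0 := by
  simp only [wt, Multiset.sum_eq_zero_iff, Multiset.mem_map]
  rintro x ⟨p, hp, rfl⟩
  exact List.count_eq_zero_of_not_mem fun hy => h p hy hp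

/-- A node covers a configuration. -/
def Covers (n : Node τ) (c : ℕ × Multiset τ) : Prop :=
  n.1 = c.1 ∧ ∀ x, (c.2.count x : ℕ∞) ≤ n.2.val x

theorem Fires.covers {t : Trn τ} {c c' : ℕ × Multiset τ} (h : Fires t c c') {n n' : Node τ}
    (hn : Covers n c) (hE : EdgeOK n t n') (hg : n'.1 = c'.1) : Covers n' c' := by
  obtain ⟨_, rest, u, u2, hc, hc', hu, hu2⟩ := h
  refine ⟨hg, fun x => ?_⟩
  have h1 := hn.2 x
  have h2 := hE x
  have h3 : (u.count x : ℕ∞) ≤ t.2.2.1.val x := by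
    have := Multiset.count_le_of_le x hu
    rw [Multiset.count_add, Multiset.coe_count] at this
    by_cases hx : x ∈ t.2.2.1.2
    · simp [Vec.val, hx]
    · rw [Multiset.count_eq_zero_of_notMem fun h => hx (hu2 x h)] at this
      simp only [Vec.val, hx, if_false]
      exact_mod_cast this
  rw [hc, Multiset.count_add, Multiset.coe_count] at h1
  rw [hc', Multiset.count_add]
  push_cast at h1 ⊢
  refine (ENat.add_le_add_iff_right (ENat.natCast_ne_top (t.2.1.count x))).1 (le_trans ?_ h2)
  calc _ = ((t.2.1.count x : ℕ∞) + rest.count x) + u.count x := by ring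
    _ ≤ _ := add_le_add h1 h3

theorem Fires.enabled {t : Trn τ} {c c' : ℕ × Multiset τ} (h : Fires t c c') {n : Node τ}
    (hn : Covers n c) (x : τ) : (t.2.1.count x : ℕ∞) ≤ n.2.val x := by
  obtain ⟨_, rest, u, u2, hc, hc', hu, hu2⟩ := h
  refine le_trans ?_ (hn.2 x)
  rw [hc, Multiset.count_add, Multiset.coe_count]
  push_cast
  exact le_self_add

theorem Fires.wt_le {t : Trn τ} {c c' : ℕ × Multiset τ} (h : Fires t c c') {y : List τ}
    (hy : ∀ p ∈ y, p ∉ t.2.2.1.2) : wt y c'.2 + dot y t.2.1 ≤ wt y c.2 + dot y t.2.2.1.1 := by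
  obtain ⟨_, rest, u, u2, hc, hc', hu, hu2⟩ := h
  have h1 := wt_mono y hu
  rw [wt_add, wt_eq_zero fun p hp h => hy p hp (hu2 p h), wt_coe] at h1
  rw [hc, hc', wt_add, wt_add, wt_coe]
  omega

theorem Cert.sound {Tr : List (Trn τ)} {g0 : ℕ} {c0 : List τ} {M : List (Node τ)}
    {E : List (Edge τ)} (hC : Cert Tr g0 c0 M E) (c : ℕ → ℕ × Multiset τ) (t : ℕ → Trn τ)
    (h0 : c 0 = (g0, (c0 : Multiset τ))) (ht : ∀ i, t i ∈ Tr)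
    (hs : ∀ i, Fires (t i) (c i) (c (i + 1))) :
    ¬ ∀ i, ∃ j ≥ i, (t j).2.2.2 = true := by
  intro hprod
  have hnodes : ∃ n : ℕ → Node τ, ∀ i, n i ∈ M ∧ Covers (n i) (c i) ∧
      (n i, t i, n (i + 1)) ∈ E := by
    have hnext : ∀ (i : ℕ) (n : {n : Node τ // n ∈ M ∧ Covers n (c i)}),
        ∃ n' : {n : Node τ // n ∈ M ∧ Covers n (c (i + 1))}, (n.1, t i, n'.1) ∈ E := by
      rintro i ⟨n, hnM, hn⟩
      obtain ⟨n', hn'M, hg, hE, hok⟩ := hC.step n hnM (t i) (ht i) (c (i + 1)).1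
        (hn.1 ▸ (hs i).1) fun x _ => (hs i).enabled hn x
      exact ⟨⟨n', hn'M, (hs i).covers hn hok hg⟩, hE⟩
    choose nx hnx using hnext
    obtain ⟨n0, hn0M, hn0g, hn0⟩ := hC.init
    have hcov : Covers n0 (c 0) := by
      rw [h0]
      refine ⟨hn0g, fun x => ?_⟩
      by_cases hx : x ∈ c0
      · simpa using hn0 x hx
      · simp [List.count_eq_zero_of_not_mem hx]
    let n : ∀ i, {n : Node τ // n ∈ M ∧ Covers n (c i)} :=
      fun i => Nat.rec ⟨n0, hn0M, hcov⟩ (fun i n => nx i n) i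
    exact ⟨fun i => (n i).1, fun i => ⟨(n i).2.1, (n i).2.2, hnx i (n i)⟩⟩
  obtain ⟨n, hn⟩ := hnodes
  classical
  let e : ℕ → Edge τ := fun i => (n i, t i, n (i + 1))
  let F := E.filter fun x => decide (∀ i, ∃ j ≥ i, e j = x)
  have hF : ∀ x ∈ F, ∀ i, ∃ j ≥ i, e j = x := fun x hx => by
    simpa using (List.mem_filter.1 hx).2
  obtain ⟨N, hN⟩ : ∃ N, ∀ i ≥ N, e i ∈ F := by
    have hfin : ∀ L : List (Edge τ), ∃ N, ∀ x ∈ L, (¬ ∀ i, ∃ j ≥ i, e j = x) →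
        ∀ i ≥ N, e i ≠ x := by
      intro L
      induction L with
      | nil => exact ⟨0, by simp⟩
      | cons x L ih =>
        obtain ⟨N, hN⟩ := ih
        by_cases hx : ∀ i, ∃ j ≥ i, e j = x
        · exact ⟨N, fun y hy hne => by
            rcases List.mem_cons.1 hy with rfl | hy
            · exact absurd hx hne
            · exact hN y hy hne⟩
        · have hx' := hx
          push Not at hx'
          obtain ⟨N', hN'⟩ := hx'
          refine ⟨max N N', fun y hy hne i hi => ?_⟩
          rcases List.mem_cons.1 hy with rfl | hy
          · exact hN' i (le_trans (le_max_right _ _) hi)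
          · exact hN y hy hne i (le_trans (le_max_left _ _) hi)
    obtain ⟨N, hN⟩ := hfin E
    refine ⟨N, fun i hi => List.mem_filter.2 ⟨(hn i).2.2, ?_⟩⟩
    rw [decide_eq_true_eq]
    by_contra hx
    exact hN (e i) (hn i).2.2 hx i hi rfl
  rcases hC.good F (mem_subs_filter _ _) with hF0 | ⟨y, z, hle, x, hx, hlt⟩ |
    ⟨U, hU, ⟨x, hx, hxU⟩, x', hx', hx'U⟩
  · obtain ⟨j, hj, hp⟩ := hprod N
    have := hF0 _ (hN j hj)
    simp only [e] at this
    rw [hp] at this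
    exact absurd this (by simp)
  · let Φ : ℕ → ℕ := fun i => wt y (c i).2 + z.count (n i)
    have hmono : ∀ i ≥ N, Φ (i + 1) ≤ Φ i := by
      intro i hi
      obtain ⟨h1, h2⟩ := hle _ (hN i hi)
      have h3 := (hs i).wt_le h1
      simp only [e] at h2
      simp only [Φ]
      omega
    have hstrict : ∀ i ≥ N, e i = x → Φ (i + 1) < Φ i := by
      intro i hi hex
      obtain ⟨h1, h2⟩ := hle _ (hN i hi)
      have h3 := (hs i).wt_le h1
      rw [← hex] at hlt
      simp only [e] at hlt
      simp only [Φ]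
      omega
    have hanti : ∀ i ≥ N, ∀ k, Φ (i + k) ≤ Φ i := by
      intro i hi k
      induction k with
      | zero => exact le_rfl
      | succ k ih => exact (hmono (i + k) (by omega)).trans ih
    have : ∀ B i, i ≥ N → Φ i ≤ B → False := by
      intro B
      induction B with
      | zero =>
        intro i hi hB
        obtain ⟨j, hj, he⟩ := hF x hx i
        have h1 := hstrict j (by omega) he
        have h2 := hanti i hi (j - i)
        rw [Nat.add_sub_cancel' hj] at h2
        omega
      | succ B ih =>
        intro i hi hB
        obtain ⟨j, hj, he⟩ := hF x hx i
        have h1 := hstrict j (by omega) he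
        have h2 := hanti i hi (j - i)
        rw [Nat.add_sub_cancel' hj] at h2
        exact ih (j + 1) (by omega) (by omega)
    exact this _ N le_rfl le_rfl
  · have hconst : ∀ k, (n (N + k) ∈ U ↔ n N ∈ U) := by
      intro k
      induction k with
      | zero => rfl
      | succ k ih =>
        rw [← ih]
        have := hU _ (hN (N + k) (by omega))
        simp only [e] at this
        rw [← add_assoc]
        tauto
    obtain ⟨j, hj, he⟩ := hF x hx N
    obtain ⟨j', hj', he'⟩ := hF x' hx' N
    have h1 := hconst (j - N)
    have h2 := hconst (j' - N)
    rw [Nat.add_sub_cancel' hj] at h1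
    rw [Nat.add_sub_cancel' hj'] at h2
    rw [← he] at hxU
    rw [← he'] at hx'U
    simp only [e] at hxU hx'U
    tauto

end Net

/-! ### Limits of downward closed sets of multisets -/

section Adherence

variable {τ : Type} [DecidableEq τ]

/-- Every finite multiset below `f` is below an element of `P`. -/
def Adh (P : Set (Multiset τ)) (f : τ → ℕ∞) : Prop :=
  ∀ u : Multiset τ, (∀ x, (u.count x : ℕ∞) ≤ f x) → ∃ c ∈ P, u ≤ c

theorem exists_multiset_count (s : Finset τ) (φ : τ → ℕ) (h : ∀ x, x ∉ s → φ x = 0) :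
    ∃ m : Multiset τ, ∀ x, m.count x = φ x := by
  refine ⟨∑ x ∈ s, φ x • {x}, fun x => ?_⟩
  rw [Multiset.count_sum']
  simp only [Multiset.count_nsmul, Multiset.count_singleton, mul_ite, mul_one, mul_zero,
    Finset.sum_ite_eq]
  split
  · rfl
  · next hx => exact (h x hx).symm

theorem exists_list_count (s : Finset τ) (φ : τ → ℕ) (h : ∀ x, x ∉ s → φ x = 0) :
    ∃ l : List τ, ∀ x, l.count x = φ x := by
  obtain ⟨m, hm⟩ := exists_multiset_count s φ h
  refine ⟨m.toList, fun x => ?_⟩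
  rw [← hm, ← Multiset.coe_count, Multiset.coe_toList]

theorem exists_vec (s : Finset τ) (f : τ → ℕ∞) (h : ∀ x, x ∉ s → f x = 0) :
    ∃ u : Vec τ, u.val = f := by
  obtain ⟨l, hl⟩ := exists_list_count s (fun x => (f x).toNat) fun x hx => by simp [h x hx]
  classical
  refine ⟨(l, (s.filter fun x => f x = ⊤).toList), funext fun x => ?_⟩
  by_cases hx : f x = ⊤
  · have : x ∈ s := by
      by_contra hs
      rw [h x hs] at hx
      exact absurd hx (by simp)
    simp [Vec.val, hx, this]
  · simp only [Vec.val, Finset.mem_toList, Finset.mem_filter, hx, and_false, if_false, hl]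
    exact ENat.natCast_toNat hx

theorem Adh.eq_zero {P : Set (Multiset τ)} {f : τ → ℕ∞} (hf : Adh P f) {s : Finset τ}
    (hP : ∀ c ∈ P, ∀ x ∈ c, x ∈ s) {x : τ} (hx : x ∉ s) : f x = 0 := by
  by_contra h0
  obtain ⟨c, hc, hle⟩ := hf {x} fun y => by
    rw [Multiset.count_singleton]
    split
    · next h =>
      rw [h]
      simpa using Order.one_le_iff_ne_zero.2 h0
    · simp
  exact hx (hP c hc x (Multiset.mem_of_le hle (Multiset.mem_singleton_self x)))

theorem Adh.exists_ge_maximal {P : Set (Multiset τ)} {f : τ → ℕ∞} (hf : Adh P f) :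
    ∃ m, f ≤ m ∧ Maximal (fun f => f ∈ {f | Adh P f}) m := by
  refine zorn_le_nonempty₀ {f | Adh P f} (fun C hC hchain y hy => ?_) f hf
  refine ⟨sSup C, fun u hu => ?_, fun z hz => le_sSup hz⟩
  have key : ∀ s : Finset τ, ∃ g ∈ C, ∀ x ∈ s, (u.count x : ℕ∞) ≤ g x := by
    intro s
    induction s using Finset.induction_on with
    | empty => exact ⟨y, hy, by simp⟩
    | insert a s _ ih =>
      obtain ⟨g, hg, hgs⟩ := ih
      obtain ⟨g', hg', hga⟩ : ∃ g ∈ C, (u.count a : ℕ∞) ≤ g a := by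
        have h1 := hu a
        rw [sSup_apply] at h1
        cases hk : u.count a with
        | zero => exact ⟨y, hy, by simp⟩
        | succ k =>
          rw [hk] at h1
          have h2 : ((k : ℕ) : ℕ∞) < ⨆ f : C, (f : τ → ℕ∞) a :=
            lt_of_lt_of_le (by exact_mod_cast Nat.lt_succ_self k) h1
          obtain ⟨⟨g, hg⟩, hlt⟩ := lt_iSup_iff.1 h2
          refine ⟨g, hg, ?_⟩
          push_cast
          exact Order.add_one_le_of_lt hlt
      rcases hchain.total hg hg' with hle | hle
      · refine ⟨g', hg', fun x hx => ?_⟩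
        rcases Finset.mem_insert.1 hx with rfl | hx
        · exact hga
        · exact (hgs x hx).trans (hle x)
      · refine ⟨g, hg, fun x hx => ?_⟩
        rcases Finset.mem_insert.1 hx with rfl | hx
        · exact hga.trans (hle x)
        · exact hgs x hx
  obtain ⟨g, hg, hgu⟩ := key u.toFinset
  refine hC hg u fun x => ?_
  by_cases hx : x ∈ u
  · exact hgu x (by simpa using hx)
  · simp [Multiset.count_eq_zero_of_notMem hx]

theorem exists_finite_adh (P : Set (Multiset τ)) (s : Finset τ)
    (hP : ∀ c ∈ P, ∀ x ∈ c, x ∈ s) :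
    ∃ I : List (Vec τ), (∀ u ∈ I, Adh P u.val) ∧
      ∀ f, Adh P f → ∃ u ∈ I, ∀ x, f x ≤ u.val x := by
  classical
  let S : Set (τ → ℕ∞) := {f | Maximal (fun f => f ∈ {f | Adh P f}) f}
  have hS : S.Finite := by
    let ρ : (τ → ℕ∞) → (s → ℕ∞) := fun f x => f x
    have hρ : ∀ f ∈ S, ∀ g ∈ S, ρ f ≤ ρ g → f = g := by
      intro f hf g hg hle
      refine hf.eq_of_le hg.1 fun x => ?_
      by_cases hx : x ∈ s
      · exact hle ⟨x, hx⟩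
      · have : Adh P f := hf.1
        rw [this.eq_zero hP hx]
        exact zero_le
    have hanti : IsAntichain (· ≤ ·) (ρ '' S) := by
      rintro _ ⟨f, hf, rfl⟩ _ ⟨g, hg, rfl⟩ hne hle
      exact hne (by rw [hρ f hf g hg hle])
    refine Set.Finite.of_finite_image (WellQuasiOrderedLE.finite_of_isAntichain hanti) ?_
    intro f hf g hg h
    exact hρ f hf g hg h.le
  have hvec : ∀ f ∈ S, ∃ u : Vec τ, u.val = f := fun f hf =>
    exists_vec s f fun x hx => Adh.eq_zero (show Adh P f from hf.1) hP hx
  choose! v hv using hvec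
  refine ⟨hS.toFinset.toList.map v, ?_, ?_⟩
  · intro u hu
    obtain ⟨f, hf, rfl⟩ := List.mem_map.1 hu
    have hf : f ∈ S := by simpa using hf
    rw [hv f hf]
    exact hf.1
  · intro f hf
    obtain ⟨m, hm, hmax⟩ := hf.exists_ge_maximal
    have hmS : m ∈ S := hmax
    refine ⟨v m, List.mem_map.2 ⟨m, by simpa using hmS, rfl⟩, fun x => ?_⟩
    rw [hv m hmS]
    exact hm x

end Adherence

/-! ### Existence of certificates -/

section Completeness

theorem transposition_finset {ι κ : Type*} [DecidableEq ι] [DecidableEq κ] (s : Finset ι)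
    (t : Finset κ) (a : ι → κ → ℤ) :
    (∃ x : ι → ℕ, (∀ i ∈ s, 0 < x i) ∧ ∀ k ∈ t, 0 ≤ ∑ i ∈ s, (x i : ℤ) * a i k) ∨
    (∃ y : κ → ℕ, (∀ k, k ∉ t → y k = 0) ∧ (∀ i ∈ s, ∑ k ∈ t, (y k : ℤ) * a i k ≤ 0) ∧
      ∃ i ∈ s, ∑ k ∈ t, (y k : ℤ) * a i k < 0) := by
  rcases transposition fun (i : s) (k : t) => a i k with ⟨x, hx, h⟩ | ⟨y, hy, i, hi⟩
  · refine Or.inl ⟨fun i => if h : i ∈ s then x ⟨i, h⟩ else 0, fun i hi => by simp [hi, hx],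
      fun k hk => ?_⟩
    rw [← Finset.sum_coe_sort s]
    simpa using h ⟨k, hk⟩
  · refine Or.inr ⟨fun k => if h : k ∈ t then y ⟨k, h⟩ else 0, fun k hk => by simp [hk],
      fun i hi => ?_, i, i.2, ?_⟩
    · rw [← Finset.sum_coe_sort t]
      simpa using hy ⟨i, hi⟩
    · rw [← Finset.sum_coe_sort t]
      simpa using hi

variable {τ : Type} [DecidableEq τ]

/-- Paths of the lossy net, counting productive steps. -/
inductive Path (Tr : List (Trn τ)) (c : ℕ × Multiset τ) : ℕ → ℕ × Multiset τ → Prop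
  | refl : Path Tr c 0 c
  | tail {k : ℕ} {c' c'' : ℕ × Multiset τ} {t : Trn τ} : Path Tr c k c' → t ∈ Tr →
      Fires t c' c'' → Path Tr c (k + t.2.2.2.toNat) c''

omit [DecidableEq τ] in
theorem Path.trans {Tr : List (Trn τ)} {c c' c'' : ℕ × Multiset τ} {k l : ℕ}
    (h : Path Tr c k c') (h' : Path Tr c' l c'') : Path Tr c (k + l) c'' := by
  induction h' with
  | refl => exact h
  | tail _ ht hf ih => exact add_assoc k _ _ ▸ ih.tail ht hf

/-- A reachable self-covering path with a productive step. -/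
def SelfCover (Tr : List (Trn τ)) (g0 : ℕ) (c0 : List τ) : Prop :=
  ∃ (k l : ℕ) (g : ℕ) (c c' : Multiset τ), Path Tr (g0, (c0 : Multiset τ)) k (g, c) ∧
    Path Tr (g, c) (l + 1) (g, c') ∧ c ≤ c'

theorem dot_eq_sum (s : Finset τ) (y F : List τ) (hy : ∀ x, x ∉ s → y.count x = 0) :
    dot y F = ∑ x ∈ s, y.count x * F.count x := by
  induction F with
  | nil => simp [dot]
  | cons p F ih =>
    have h1 : dot y (p :: F) = y.count p + dot y F := by simp [dot]
    rw [h1, ih]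
    have h2 : ∀ x ∈ s, y.count x * (p :: F).count x
        = y.count x * F.count x + if p = x then y.count x else 0 := by
      intro x _
      rw [List.count_cons, mul_add]
      simp
    rw [Finset.sum_congr rfl h2, Finset.sum_add_distrib, Finset.sum_ite_eq]
    split
    · omega
    · next h => rw [hy p h]; omega

theorem sum_map_of_coe_eq {ι : Type*} {s : Finset ι} {x : ι → ℕ} {w : List ι}
    (hw : (w : Multiset ι) = ∑ i ∈ s, x i • ({i} : Multiset ι)) (f : ι → ℕ) :
    (w.map f).sum = ∑ i ∈ s, x i * f i := by
  classical
  have h1 : ((w : Multiset ι).map f).sum = (w.map f).sum := by simp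
  rw [← h1, hw]
  clear hw h1
  induction s using Finset.induction_on with
  | empty => simp
  | insert a s ha ih =>
    rw [Finset.sum_insert ha, Finset.sum_insert ha, Multiset.map_add, Multiset.sum_add, ih]
    simp [Multiset.map_nsmul, Multiset.sum_nsmul]

/-- Number of occurrences of `x` in the preconditions of a list of edges. -/
def preS (w : List (Edge τ)) (x : τ) : ℕ := (w.map fun e => e.2.1.2.1.count x).sum

/-- Number of occurrences of `x` in the finite outputs of a list of edges. -/
def outS (w : List (Edge τ)) (x : τ) : ℕ := (w.map fun e => e.2.1.2.2.1.1.count x).sum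

/-- Number of occurrences of `x` in the infinite outputs of a list of edges. -/
def infS (w : List (Edge τ)) (x : τ) : ℕ := (w.map fun e => e.2.1.2.2.1.2.count x).sum

theorem IsWalk.val_le {w : List (Edge τ)} (hw : ∀ e ∈ w, EdgeOK e.1 e.2.1 e.2.2) (x : τ) :
    ∀ {a b : Node τ}, IsWalk (fun e : Edge τ => e.1) (fun e => e.2.2) a w b →
      a.2.val x + (if 0 < infS w x then ⊤ else (outS w x : ℕ∞)) ≤ b.2.val x + (preS w x : ℕ∞) := by
  induction w with
  | nil =>
    rintro a b rfl
    simp [infS, outS, preS]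
  | cons e w ih =>
    rintro a b ⟨rfl, h⟩
    have h1 := ih (fun e he => hw e (List.mem_cons_of_mem _ he)) h
    have h2 := hw e List.mem_cons_self x
    have e1 : infS (e :: w) x = e.2.1.2.2.1.2.count x + infS w x := by simp [infS]
    have e2 : outS (e :: w) x = e.2.1.2.2.1.1.count x + outS w x := by simp [outS]
    have e3 : preS (e :: w) x = e.2.1.2.1.count x + preS w x := by simp [preS]
    have h3 : (if 0 < infS (e :: w) x then ⊤ else (outS (e :: w) x : ℕ∞))
        ≤ e.2.1.2.2.1.val x + (if 0 < infS w x then ⊤ else (outS w x : ℕ∞)) := by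
      rw [e1, e2]
      by_cases hx : x ∈ e.2.1.2.2.1.2
      · simp [Vec.val, hx]
      · rw [List.count_eq_zero_of_not_mem hx, zero_add]
        split
        · simp
        · simp [Vec.val, hx]
    calc _ ≤ e.1.2.val x + (e.2.1.2.2.1.val x + (if 0 < infS w x then ⊤ else (outS w x : ℕ∞))) := by
          gcongr
      _ = (e.1.2.val x + e.2.1.2.2.1.val x) + (if 0 < infS w x then ⊤ else (outS w x : ℕ∞)) := by
          rw [add_assoc]
      _ ≤ (e.2.2.2.val x + (e.2.1.2.1.count x : ℕ∞))
            + (if 0 < infS w x then ⊤ else (outS w x : ℕ∞)) := by gcongr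
      _ = (e.2.1.2.1.count x : ℕ∞)
            + (e.2.2.2.val x + (if 0 < infS w x then ⊤ else (outS w x : ℕ∞))) := by ring
      _ ≤ (e.2.1.2.1.count x : ℕ∞) + (b.2.val x + (preS w x : ℕ∞)) := by gcongr
      _ = _ := by
          rw [e3]
          push_cast
          ring

theorem exists_path_of_closed_walk {Tr : List (Trn τ)} {w : List (Edge τ)} {a : Node τ}
    (hTr : ∀ e ∈ w, e.2.1 ∈ Tr) (hok : ∀ e ∈ w, EdgeOK e.1 e.2.1 e.2.2)
    (hctl : ∀ e ∈ w, e.2.2.1 ∈ ctl e.2.1.1 e.1.1)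
    (hen : ∀ e ∈ w, ∀ x, (e.2.1.2.1.count x : ℕ∞) ≤ e.1.2.val x)
    (hw : IsWalk (fun e : Edge τ => e.1) (fun e => e.2.2) a w a)
    (hbal : ∀ x, infS w x = 0 → preS w x ≤ outS w x)
    (N : ℕ) (hN : ∀ x, preS w x ≤ N) (c : Multiset τ)
    (hc : ∀ x, if a.2.val x = ⊤ then N ≤ c.count x else a.2.val x ≤ c.count x) :
    ∃ c', c ≤ c' ∧ Path Tr (a.1, c) (w.map fun e => e.2.1.2.2.2.toNat).sum (a.1, c') := by
  have key : ∀ w1 w2 : List (Edge τ), w = w1 ++ w2 → ∀ b,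
      IsWalk (fun e : Edge τ => e.1) (fun e => e.2.2) a w1 b →
      ∃ c', (∀ x, c'.count x + preS w1 x = c.count x + outS w1 x + N * infS w1 x) ∧
        Path Tr (a.1, c) (w1.map fun e => e.2.1.2.2.2.toNat).sum (b.1, c') := by
    intro w1
    induction w1 using List.reverseRecOn with
    | nil =>
      rintro w2 _ b rfl
      exact ⟨c, fun x => by simp [preS, outS, infS], by simpa using Path.refl⟩
    | append_singleton w1 e ih =>
      intro w2 hw12 b hwalk
      obtain ⟨b', hb', rfl, rfl⟩ := isWalk_append.1 hwalk
      obtain ⟨c', hcount, hpath⟩ := ih (e :: w2) (by simpa using hw12) _ hb'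
      have hew : e ∈ w := by rw [hw12]; simp
      have hrest : IsWalk (fun e : Edge τ => e.1) (fun e => e.2.2) e.1 (e :: w2) a := by
        have h := hw
        rw [hw12, List.append_assoc] at h
        obtain ⟨b'', h1, h2⟩ := isWalk_append.1 h
        obtain ⟨rfl, h3⟩ := h2
        exact ⟨rfl, h3⟩
      have hsplit : ∀ x, preS w x = preS w1 x + preS (e :: w2) x := fun x => by
        simp [hw12, preS]
      have hsplit' : ∀ x, outS w x = outS w1 x + outS (e :: w2) x := fun x => by
        simp [hw12, outS]
      have hsplit'' : ∀ x, infS w x = infS w1 x + infS (e :: w2) x := fun x => by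
        simp [hw12, infS]
      have hpre : ∀ x, e.2.1.2.1.count x ≤ c'.count x := by
        intro x
        have h1 := hcount x
        have h2 := hc x
        have h3 : e.2.1.2.1.count x ≤ preS (e :: w2) x := by simp [preS]
        have h4 := hsplit x
        have h5 := hN x
        have h6 := hen e hew x
        split at h2
        · omega
        · next htop =>
          have h7 := IsWalk.val_le hok x hw
          have h8 := IsWalk.val_le (fun e he => hok e (by rw [hw12]; simp at he ⊢; tauto)) x hrest
          obtain ⟨m, hm⟩ := ENat.ne_top_iff_exists.1 htop
          have hinf : infS w x = 0 := by
            by_contra hne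
            rw [if_pos (Nat.pos_of_ne_zero hne), ← hm] at h7
            simp only [add_top, top_le_iff] at h7
            exact ENat.natCast_ne_top (m + preS w x) (by exact_mod_cast h7)
          have h9 := hbal x hinf
          have h10 := hsplit' x
          have h11 := hsplit'' x
          rw [if_neg (by omega), ← hm] at h8
          obtain ⟨mb, hmb⟩ := ENat.ne_top_iff_exists.1 (show e.1.2.val x ≠ ⊤ by
            intro ht
            rw [ht, top_add, top_le_iff] at h8
            exact ENat.natCast_ne_top (m + preS (e :: w2) x) (by exact_mod_cast h8))
          rw [← hmb] at h8 h6
          rw [← hm] at h2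
          norm_cast at h8 h6 h2
          omega
      have hle : (e.2.1.2.1 : Multiset τ) ≤ c' := by
        rw [Multiset.le_iff_count]
        intro x
        rw [Multiset.coe_count]
        exact hpre x
      let u2 : Multiset τ := N • (e.2.1.2.2.1.2 : Multiset τ)
      refine ⟨c' - e.2.1.2.1 + (e.2.1.2.2.1.1 + u2), fun x => ?_, ?_⟩
      · have h1 := hcount x
        have h2 := hpre x
        rw [Multiset.count_add, Multiset.count_add, Multiset.count_sub, Multiset.coe_count,
          Multiset.coe_count, Multiset.count_nsmul, Multiset.coe_count]
        have e1 : infS (w1 ++ [e]) x = infS w1 x + e.2.1.2.2.1.2.count x := by simp [infS]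
        have e2 : outS (w1 ++ [e]) x = outS w1 x + e.2.1.2.2.1.1.count x := by simp [outS]
        have e3 : preS (w1 ++ [e]) x = preS w1 x + e.2.1.2.1.count x := by simp [preS]
        rw [e1, e2, e3, mul_add]
        omega
      · rw [List.map_append, List.sum_append]
        simp only [List.map_cons, List.map_nil, List.sum_cons, List.sum_nil, add_zero]
        refine hpath.tail (hTr e hew) ⟨hctl e hew, _, _, u2, ?_, rfl, le_rfl, ?_⟩
        · exact (add_tsub_cancel_of_le hle).symm
        · intro p hp
          have := Multiset.mem_of_mem_nsmul hp
          simpa using this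
  obtain ⟨c', hcount, hpath⟩ := key w [] (by simp) a hw
  refine ⟨c', Multiset.le_iff_count.2 fun x => ?_, hpath⟩
  have h1 := hcount x
  have h2 := hbal x
  have h3 := hN x
  rcases Nat.eq_zero_or_pos (infS w x) with h | h
  · have := h2 h
    omega
  · have : N ≤ N * infS w x := Nat.le_mul_of_pos_right _ h
    omega

end Completeness

section ExistsCert

variable {τ : Type} [DecidableEq τ]

omit [DecidableEq τ] in
theorem Path.mem_toks {Tr : List (Trn τ)} {toks : Finset τ}
    (hTr : ∀ t ∈ Tr, (∀ x ∈ t.2.2.1.1, x ∈ toks) ∧ ∀ x ∈ t.2.2.1.2, x ∈ toks)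
    {c c' : ℕ × Multiset τ} {k : ℕ} (h : Path Tr c k c') (hc : ∀ x ∈ c.2, x ∈ toks) :
    ∀ x ∈ c'.2, x ∈ toks := by
  induction h with
  | refl => exact hc
  | tail _ ht hf ih =>
    obtain ⟨_, rest, u, u2, h1, h2, h3, h4⟩ := hf
    intro x hx
    rw [h2, Multiset.mem_add] at hx
    rcases hx with hx | hx
    · exact ih x (by rw [h1]; exact Multiset.mem_add.2 (Or.inr hx))
    · rcases Multiset.mem_add.1 (Multiset.mem_of_le h3 hx) with hx | hx
      · exact (hTr _ ht).1 x (by simpa using hx)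
      · exact (hTr _ ht).2 x (h4 x hx)

theorem adh_step {Tr : List (Trn τ)} {c0 : ℕ × Multiset τ} {t : Trn τ} (ht : t ∈ Tr)
    {g g' : ℕ} (hg : g' ∈ ctl t.1 g) {f : τ → ℕ∞}
    (hf : Adh {m | ∃ k, Path Tr c0 k (g, m)} f)
    (hen : ∀ x, (t.2.1.count x : ℕ∞) ≤ f x) :
    Adh {m | ∃ k, Path Tr c0 k (g', m)} fun x => f x + t.2.2.1.val x - (t.2.1.count x : ℕ∞) := by
  intro u hu
  let v : Multiset τ := u.filter (· ∉ t.2.2.1.2) - (t.2.2.1.1 : Multiset τ)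
  obtain ⟨c, ⟨k, hk⟩, hc⟩ := hf (v + (t.2.1 : Multiset τ)) fun x => by
    have h1 := hu x
    have h2 := hen x
    rw [Multiset.count_add, Multiset.count_sub, Multiset.coe_count, Multiset.coe_count,
      Multiset.count_filter]
    by_cases hx : x ∈ t.2.2.1.2
    · simpa [hx] using h2
    · rw [if_pos hx]
      simp only [Vec.val, hx, if_false] at h1
      cases hfx : f x with
      | top => simp
      | coe m =>
        rw [hfx] at h1 h2
        norm_cast at h1 h2 ⊢
        omega
  obtain ⟨d, rfl⟩ := Multiset.le_iff_exists_add.1 hc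
  let u' : Multiset τ := u - v
  refine ⟨(v + d) + u', ⟨_, hk.tail ht ⟨hg, v + d, u', u.filter (· ∈ t.2.2.1.2), ?_, rfl, ?_, ?_⟩⟩,
    ?_⟩
  · simp only
    abel
  · rw [Multiset.le_iff_count]
    intro x
    simp only [u', v, Multiset.count_sub, Multiset.count_add, Multiset.count_filter,
      Multiset.coe_count]
    by_cases hx : x ∈ t.2.2.1.2
    · simp [hx]
    · simp only [hx, not_false_eq_true, if_true, if_false]
      omega
  · intro p hp
    exact (Multiset.mem_filter.1 hp).2
  · rw [Multiset.le_iff_count]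
    intro x
    simp only [u', Multiset.count_add, Multiset.count_sub]
    omega

theorem exists_cert {Tr : List (Trn τ)} {g0 : ℕ} {c0 : List τ} (toks : Finset τ)
    (hc0 : ∀ x ∈ c0, x ∈ toks)
    (hTr : ∀ t ∈ Tr, (∀ x ∈ t.2.1, x ∈ toks) ∧ (∀ x ∈ t.2.2.1.1, x ∈ toks) ∧
      ∀ x ∈ t.2.2.1.2, x ∈ toks)
    (hno : ¬ SelfCover Tr g0 c0) : ∃ M E, Cert Tr g0 c0 M E := by
  classical
  let P : ℕ → Set (Multiset τ) := fun g => {m | ∃ k, Path Tr (g0, (c0 : Multiset τ)) k (g, m)}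
  have hP : ∀ g, ∀ c ∈ P g, ∀ x ∈ c, x ∈ toks := fun g c ⟨k, hk⟩ =>
    hk.mem_toks (fun t ht => (hTr t ht).2) (by simpa using hc0)
  choose I hI1 hI2 using fun g => exists_finite_adh (P g) toks (hP g)
  let gs : List ℕ := g0 :: Tr.flatMap fun t => (t.1.map (·.2)).toList
  have hgs : ∀ g ∈ gs, ∀ t ∈ Tr, ∀ g' ∈ ctl t.1 g, g' ∈ gs := by
    intro g hg t ht g' hg'
    rcases h : t.1 with _ | ⟨p, r⟩
    · rw [h] at hg'
      simp only [ctl, List.mem_singleton] at hg'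
      exact hg' ▸ hg
    · rw [h] at hg'
      have : g' = r := by
        simp only [ctl] at hg'
        split at hg'
        · simpa using hg'
        · simp at hg'
      refine List.mem_cons_of_mem _ (List.mem_flatMap.2 ⟨t, ht, ?_⟩)
      simp [h, this]
  let M : List (Node τ) := gs.flatMap fun g => (I g).map fun u => (g, u)
  have hM : ∀ n : Node τ, n ∈ M ↔ n.1 ∈ gs ∧ n.2 ∈ I n.1 := by
    rintro ⟨g, u⟩
    simp only [M, List.mem_flatMap, List.mem_map, Prod.mk.injEq]
    constructor
    · rintro ⟨g', h1, u', h2, rfl, rfl⟩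
      exact ⟨h1, h2⟩
    · rintro ⟨h1, h2⟩
      exact ⟨g, h1, u, h2, rfl, rfl⟩
  let ok : Edge τ → Prop := fun e => EdgeOK e.1 e.2.1 e.2.2 ∧ e.2.2.1 ∈ ctl e.2.1.1 e.1.1 ∧
    ∀ x, (e.2.1.2.1.count x : ℕ∞) ≤ e.1.2.val x
  let E : List (Edge τ) := (M.product (Tr.product M)).filter ok
  have hE : ∀ e : Edge τ, e ∈ E ↔ (e.1 ∈ M ∧ e.2.1 ∈ Tr ∧ e.2.2 ∈ M) ∧ ok e := by
    rintro ⟨n, t, n'⟩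
    simp only [E, List.mem_filter, decide_eq_true_eq]
    refine and_congr (List.mem_product.trans (and_congr_right fun _ => List.mem_product)) Iff.rfl
  refine ⟨M, E, ⟨?_, ?_, ?_⟩⟩
  · obtain ⟨u, hu, hle⟩ := hI2 g0 (fun x => (c0.count x : ℕ∞)) fun u hu =>
      ⟨c0, ⟨0, .refl⟩, Multiset.le_iff_count.2 fun x => by
        rw [Multiset.coe_count]; exact ENat.natCast_le_natCast.1 (hu x)⟩
    exact ⟨(g0, u), (hM _).2 ⟨List.mem_cons_self, hu⟩, rfl, fun x _ => hle x⟩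
  · intro n hn t ht g' hg' hen
    have hn' := (hM n).1 hn
    have hen' : ∀ x, (t.2.1.count x : ℕ∞) ≤ n.2.val x := by
      intro x
      by_cases hx : x ∈ t.2.1
      · exact hen x hx
      · simp [List.count_eq_zero_of_not_mem hx]
    obtain ⟨u, hu, hle⟩ := hI2 g' _ (adh_step ht hg' (hI1 n.1 n.2 hn'.2) hen')
    have hmem : ((g', u) : Node τ) ∈ M := (hM _).2 ⟨hgs _ hn'.1 t ht g' hg', hu⟩
    have hedge : EdgeOK n t (g', u) := fun x => tsub_le_iff_right.1 (hle x)
    exact ⟨(g', u), hmem, rfl, (hE _).2 ⟨⟨hn, ht, hmem⟩, hedge, hg', hen'⟩, hedge⟩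
  · intro F hF
    have hFE : ∀ e ∈ F, (e.1 ∈ M ∧ e.2.1 ∈ Tr ∧ e.2.2 ∈ M) ∧ ok e := fun e he =>
      (hE e).1 (mem_of_mem_subs hF e he)
    by_contra hG
    simp only [Good, not_or] at hG
    obtain ⟨h1, h2, h3⟩ := hG
    let a : Edge τ → τ ⊕ Node τ → ℤ := fun e k => Sum.elim
      (fun x => (e.2.1.2.2.1.1.count x : ℤ) - e.2.1.2.1.count x)
      (fun n => (if e.2.2 = n then 1 else 0) - (if e.1 = n then 1 else 0)) k
    let T1 : Finset τ := toks.filter fun x => ∀ e ∈ F, x ∉ e.2.1.2.2.1.2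
    rcases transposition_finset F.toFinset (T1.disjSum M.toFinset) a with
      ⟨x, hx, hbal⟩ | ⟨y, hy0, hy, hlt⟩
    · have hnode : ∀ n, ∑ e ∈ F.toFinset, (x e : ℤ) * a e (.inr n) = 0 := by
        have h0 : ∀ n ∉ M, ∑ e ∈ F.toFinset, (x e : ℤ) * a e (.inr n) = 0 := by
          intro n hn
          refine Finset.sum_eq_zero fun e he => ?_
          have hm := (hFE e (List.mem_toFinset.1 he)).1
          have e1 : e.1 ≠ n := fun h => hn (h ▸ hm.1)
          have e2 : e.2.2 ≠ n := fun h => hn (h ▸ hm.2.2)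
          simp [a, e1, e2]
        have htot : ∑ n ∈ M.toFinset, ∑ e ∈ F.toFinset, (x e : ℤ) * a e (.inr n) = 0 := by
          rw [Finset.sum_comm]
          refine Finset.sum_eq_zero fun e he => ?_
          have hm := (hFE e (List.mem_toFinset.1 he)).1
          rw [← Finset.mul_sum]
          simp [a, hm.1, hm.2.2]
        have hnn : ∀ n ∈ M.toFinset, 0 ≤ ∑ e ∈ F.toFinset, (x e : ℤ) * a e (.inr n) :=
          fun n hn => hbal _ (Finset.inr_mem_disjSum.2 hn)
        intro n
        by_cases hn : n ∈ M
        · exact (Finset.sum_eq_zero_iff_of_nonneg hnn).1 htot n (List.mem_toFinset.2 hn)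
        · exact h0 n hn
      let X : Multiset (Edge τ) := ∑ e ∈ F.toFinset, x e • ({e} : Multiset (Edge τ))
      have hX : ∀ e, e ∈ X ↔ e ∈ F := by
        intro e
        simp only [X, Multiset.mem_sum, List.mem_toFinset]
        constructor
        · rintro ⟨e', he', h⟩
          have := Multiset.mem_singleton.1 (Multiset.mem_of_mem_nsmul h)
          exact this ▸ he'
        · intro he
          refine ⟨e, he, ?_⟩
          rw [Multiset.mem_nsmul]
          exact ⟨(hx e (List.mem_toFinset.2 he)).ne', Multiset.mem_singleton_self e⟩
      have hc : ∀ p : Edge τ → Prop, ∀ [DecidablePred p],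
          (X.countP p : ℤ) = ∑ e ∈ F.toFinset, (x e : ℤ) * if p e then 1 else 0 := by
        intro p _
        simp only [X, ← Multiset.coe_countPAddMonoidHom, map_sum, map_nsmul]
        push_cast
        refine Finset.sum_congr rfl fun e _ => ?_
        simp only [Multiset.coe_countPAddMonoidHom, ← Multiset.cons_zero, Multiset.countP_cons,
          Multiset.countP_zero]
        split <;> simp
      push Not at h1
      obtain ⟨ep, hep, hprod⟩ := h1
      obtain ⟨w, b, hw, hwalk⟩ := exists_closed_walk (src := fun e : Edge τ => e.1)
        (dst := fun e : Edge τ => e.2.2) X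
        (fun h0 => by have := (hX ep).2 hep; rw [h0] at this; simp at this)
        (fun n _ => by
          have h := hnode n
          simp only [a, Sum.elim_inr, mul_sub, Finset.sum_sub_distrib] at h
          have e1 := hc fun e => e.1 = n
          have e2 := hc fun e => e.2.2 = n
          have : (X.countP (fun e => e.1 = n) : ℤ) = X.countP (fun e => e.2.2 = n) := by
            rw [e1, e2]
            convert (sub_eq_zero.1 h).symm using 5
          convert Int.natCast_inj.1 this)
        (fun U hU ⟨e1, he1, hu1⟩ e he => by
          by_contra hu
          refine h3 ⟨M.filter (· ∈ U), fun e' he' => ?_, ⟨e1, (hX _).1 he1, ?_⟩, e, (hX _).1 he, ?_⟩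
          · have hm := (hFE e' he').1
            have := hU e' ((hX _).2 he')
            simp only [List.mem_filter, hm.1, hm.2.2, decide_eq_true_eq, true_and]
            tauto
          · simp only [List.mem_filter, decide_eq_true_eq]
            exact ⟨(hFE e1 ((hX _).1 he1)).1.1, hu1⟩
          · simp [hu])
      have hwF : ∀ e ∈ w, e ∈ F := fun e he => (hX e).1 (by rw [← hw]; simpa using he)
      have hFw : ∀ e ∈ F, e ∈ w := fun e he => by
        have := (hX e).2 he
        rw [← hw] at this
        simpa using this
      have hb : b ∈ M := by
        cases w with
        | nil => exact absurd (hFw ep hep) (by simp)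
        | cons e w =>
          obtain ⟨rfl, _⟩ := hwalk
          exact (hFE e (hwF e List.mem_cons_self)).1.1
      let N : ℕ := (w.map fun e => e.2.1.2.1.length).sum
      have hbI := hI1 b.1 b.2 ((hM b).1 hb).2
      obtain ⟨v, hv⟩ := exists_multiset_count toks
        (fun p => if b.2.val p = ⊤ then N else (b.2.val p).toNat) fun p hp => by
          rw [hbI.eq_zero (hP b.1) hp]
          simp
      obtain ⟨c, ⟨k, hk⟩, hvc⟩ := hbI v fun p => by
        rw [hv]
        split
        · next h => rw [h]; exact le_top
        · next h => rw [ENat.natCast_toNat h]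
      have hcc : ∀ p, if b.2.val p = ⊤ then N ≤ c.count p else b.2.val p ≤ c.count p := by
        intro p
        have := Multiset.count_le_of_le p hvc
        rw [hv] at this
        split
        · next h => rwa [if_pos h] at this
        · next h =>
          rw [if_neg h] at this
          rw [← ENat.natCast_toNat h]
          exact_mod_cast this
      obtain ⟨c', hle, hpath⟩ := exists_path_of_closed_walk (fun e he => (hFE e (hwF e he)).1.2.1)
        (fun e he => (hFE e (hwF e he)).2.1) (fun e he => (hFE e (hwF e he)).2.2.1)
        (fun e he => (hFE e (hwF e he)).2.2.2) hwalk
        (fun p hp => by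
          by_cases hpt : p ∈ toks
          · have hpT : p ∈ T1 := by
              refine Finset.mem_filter.2 ⟨hpt, fun e he hmem => ?_⟩
              have h1 : e.2.1.2.2.1.2.count p ≤ infS w p :=
                List.single_le_sum (by simp) _ (List.mem_map.2 ⟨e, hFw e he, rfl⟩)
              have h2 := List.count_pos_iff.2 hmem
              omega
            have h := hbal (.inl p) (Finset.inl_mem_disjSum.2 hpT)
            have e1 : preS w p = _ := sum_map_of_coe_eq hw _
            have e2 : outS w p = _ := sum_map_of_coe_eq hw _
            simp only [a, Sum.elim_inl, mul_sub, Finset.sum_sub_distrib] at h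
            rw [e1, e2]
            zify
            linarith
          · have : preS w p = 0 := by
              simp only [preS, List.sum_eq_zero_iff, List.mem_map]
              rintro _ ⟨e, he, rfl⟩
              exact List.count_eq_zero_of_not_mem fun h =>
                hpt ((hTr _ (hFE e (hwF e he)).1.2.1).1 p h)
            omega)
        N (fun p => List.sum_le_sum fun e _ => List.count_le_length) c hcc
      have hpos : 1 ≤ (w.map fun e => e.2.1.2.2.2.toNat).sum := by
        refine le_trans ?_ (List.single_le_sum (by simp) _ (List.mem_map.2 ⟨ep, hFw ep hep, rfl⟩))
        simp at hprod
        simp [hprod]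
      obtain ⟨l, hl⟩ := Nat.exists_eq_add_of_le' hpos
      rw [hl] at hpath
      exact hno ⟨k, l, b.1, c, c', hk, hpath, hle⟩
    · obtain ⟨yl, hyl⟩ := exists_list_count T1 (fun p => y (.inl p)) fun p hp =>
        hy0 _ (by simpa using hp)
      obtain ⟨zl, hzl⟩ := exists_list_count M.toFinset (fun p => y (.inr p)) fun p hp =>
        hy0 _ (by simpa using hp)
      replace hzl : ∀ p, zl.count p = y (.inr p) := fun p =>
        (congrArg (fun i => @List.count _ i p zl) (lawful_beq_subsingleton instBEqProd instBEqOfDecidableEq)).trans (hzl p)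
      have hyl0 : ∀ p, p ∉ T1 → yl.count p = 0 := fun p hp => by
        rw [hyl]
        exact hy0 _ (by simpa using hp)
      have key : ∀ e ∈ F, ∑ k ∈ T1.disjSum M.toFinset, (y k : ℤ) * a e k
          = ((dot yl e.2.1.2.2.1.1 + zl.count e.2.2 : ℕ) : ℤ)
            - ((dot yl e.2.1.2.1 + zl.count e.1 : ℕ) : ℤ) := by
        intro e he
        have hm := (hFE e he).1
        rw [Finset.sum_disjSum, dot_eq_sum T1 yl _ hyl0, dot_eq_sum T1 yl _ hyl0]
        simp only [a, Sum.elim_inl, Sum.elim_inr, mul_sub, Finset.sum_sub_distrib, mul_ite, mul_one,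
          mul_zero, Finset.sum_ite_eq, List.mem_toFinset, hm.1, hm.2.2, if_true, hyl, hzl]
        push_cast
        ring
      refine h2 ⟨yl, zl, fun e he => ⟨fun p hp hinf => ?_, ?_⟩, ?_⟩
      · have : p ∈ T1 := by
          by_contra hn
          exact List.count_pos_iff.2 hp |>.ne' (hyl0 p hn)
        exact (Finset.mem_filter.1 this).2 e he hinf
      · have := hy e (List.mem_toFinset.2 he)
        rw [key e he] at this
        omega
      · obtain ⟨e, he, hlt⟩ := hlt
        have he := List.mem_toFinset.1 he
        rw [key e he] at hlt
        exact ⟨e, he, by omega⟩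

end ExistsCert

/-! ### Executions of a single thread -/

section Thread

/-- The rules of a DCPS, as lists: creation, interruption, resumption and termination rules. -/
abbrev Sys : Type := List (ℕ × ℕ × ℕ × List ℕ × Option ℕ) × List (ℕ × ℕ × ℕ × List ℕ) ×
  List (ℕ × ℕ × ℕ) × List (ℕ × ℕ)

/-- Expected global states at the beginning and the end of the future segments of a thread. -/
abbrev Skel : Type := List (ℕ × ℕ)

/-- A thread state: mode (`0` suspended, `1` just resumed, `2` running), the global state (`0` if
suspended) and the skeleton of the execution. -/
abbrev TSt : Type := ℕ × ℕ × Skel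

/-- A spawned symbol, together with the length of the skeleton at the time of spawning. -/
abbrev Letter : Type := ℕ × ℕ

/-- The letters emitted when spawning. -/
def spawnL (n : ℕ) (sp : Option ℕ) : List Letter := sp.toList.map fun x => (n, x)

/-- The pushdown rules describing the execution of a single thread. -/
inductive Rule (a : Sys) : TSt → ℕ → TSt → List ℕ → List Letter → Prop
  | resume {p r : ℕ} {S : Skel} {g γ : ℕ} : (p, g, γ) ∈ a.2.2.1 →
      Rule a (0, 0, (p, r) :: S) γ (1, g, (p, r) :: S) [γ] []
  | create {m g : ℕ} {S : Skel} {γ g' : ℕ} {w : List ℕ} {sp : Option ℕ} : m ≠ 0 →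
      (g, γ, g', w, sp) ∈ a.1 → Rule a (m, g, S) γ (2, g', S) w (spawnL S.length sp)
  | swap {g p r : ℕ} {S : Skel} {γ : ℕ} {w : List ℕ} : (g, γ, r, w) ∈ a.2.1 →
      Rule a (2, g, (p, r) :: S) γ (0, 0, S) w []
  | pop {γ : ℕ} : Rule a (0, 0, []) γ (0, 0, []) [] []

/-- All rules applicable in a given thread state with a given top of stack. -/
def succs (a : Sys) (q : TSt) (γ : ℕ) : List (TSt × List ℕ × List Letter) :=
  if q.1 = 0 then
    if q.2.1 = 0 then
      if q.2.2 = [] then [((0, 0, []), [], [])] else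
        (a.2.2.1.filter fun x => (q.2.2.head?.map Prod.fst) = some x.1 ∧ x.2.2 = γ).map
          fun x => ((1, x.2.1, q.2.2), [γ], [])
    else []
  else
    ((a.1.filter fun x => x.1 = q.2.1 ∧ x.2.1 = γ).map fun x =>
      ((2, x.2.2.1, q.2.2), x.2.2.2.1, spawnL q.2.2.length x.2.2.2.2)) ++
    if q.1 = 2 then
      (a.2.1.filter fun x => x.1 = q.2.1 ∧ x.2.1 = γ ∧
          (q.2.2.head?.map Prod.snd) = some x.2.2.1).map
        fun x => ((0, 0, q.2.2.tail), x.2.2.2, [])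
    else []

theorem mem_succs {a : Sys} {q : TSt} {γ : ℕ} {z : TSt × List ℕ × List Letter} :
    z ∈ succs a q γ ↔ Rule a q γ z.1 z.2.1 z.2.2 := by
  obtain ⟨m, g, S⟩ := q
  constructor
  · intro h
    simp only [succs] at h
    split at h
    · next hm =>
      subst hm
      split at h
      · next hg =>
        subst hg
        split at h
        · next hS =>
          subst hS
          rw [List.mem_singleton] at h
          subst h
          exact .pop
        · obtain ⟨⟨p, g, γ'⟩, hx, rfl⟩ := List.mem_map.1 h
          simp only [List.mem_filter, decide_eq_true_eq] at hx
          obtain ⟨hx, hp, rfl⟩ := hx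
          cases S with
          | nil => simp at hp
          | cons y S =>
            obtain ⟨p', r⟩ := y
            simp only [List.head?_cons, Option.map_some, Option.some.injEq] at hp
            subst hp
            exact .resume hx
      · simp at h
    · next hm =>
      rcases List.mem_append.1 h with h | h
      · obtain ⟨⟨g, γ', g', w, sp⟩, hx, rfl⟩ := List.mem_map.1 h
        simp only [List.mem_filter, decide_eq_true_eq] at hx
        obtain ⟨hx, rfl, rfl⟩ := hx
        exact .create hm hx
      · split at h
        · next hm2 =>
          subst hm2
          obtain ⟨⟨g, γ', r, w⟩, hx, rfl⟩ := List.mem_map.1 h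
          simp only [List.mem_filter, decide_eq_true_eq] at hx
          obtain ⟨hx, rfl, rfl, hr⟩ := hx
          cases S with
          | nil => simp at hr
          | cons y S =>
            obtain ⟨p', r'⟩ := y
            simp only [List.head?_cons, Option.map_some, Option.some.injEq] at hr
            subst hr
            exact .swap hx
        · simp at h
  · obtain ⟨q1, w, ls⟩ := z
    intro h
    cases h with
    | resume h =>
      simp only [succs, if_true]
      rw [if_neg (by simp)]
      exact List.mem_map.2 ⟨_, List.mem_filter.2 ⟨h, by simp⟩, rfl⟩
    | create hm h =>
      simp only [succs]
      rw [if_neg hm]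
      exact List.mem_append_left _ (List.mem_map.2 ⟨_, List.mem_filter.2 ⟨h, by simp⟩, rfl⟩)
    | swap h =>
      simp only [succs]
      rw [if_neg (by simp)]
      exact List.mem_append_right _ (List.mem_map.2 ⟨_, List.mem_filter.2 ⟨h, by simp⟩, rfl⟩)
    | pop => simp [succs]

/-- `Run a q w v q'`: starting from `q`, the stack `w` is popped completely, emitting `v` and
ending in `q'`. -/
inductive Run (a : Sys) : TSt → List ℕ → List Letter → TSt → Prop
  | nil {q : TSt} : Run a q [] [] q
  | step {q q1 q' : TSt} {γ : ℕ} {u w : List ℕ} {ls v : List Letter} : Rule a q γ q1 u ls →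
      Run a q1 (u ++ w) v q' → Run a q (γ :: w) (ls ++ v) q'

theorem Run.append {a : Sys} {q q1 q' : TSt} {w w' : List ℕ} {v v' : List Letter}
    (h : Run a q w v q1) (h' : Run a q1 w' v' q') : Run a q (w ++ w') (v ++ v') q' := by
  induction h with
  | nil => exact h'
  | step hr _ ih =>
    rw [List.append_assoc, List.cons_append]
    exact .step hr (by simpa using ih h')

/-- The final thread states: either the thread is never resumed again, or it is terminated. -/
def Fin (a : Sys) (e : Bool) (q : TSt) : Prop :=
  (e = false ∧ q = (0, 0, [])) ∨
    (e = true ∧ ∃ g p r, q = (2, g, [(p, r)]) ∧ (g, r) ∈ a.2.2.2)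

/-! ### Summaries of pushdown executions -/

/-- A summary: source, popped symbol and target, and a bound on the emitted letters. -/
abbrev Entry : Type := (TSt × ℕ × TSt) × Vec Letter

/-- Sum of two vectors. -/
def vadd {τ : Type} (u v : Vec τ) : Vec τ := (u.1 ++ v.1, u.2 ++ v.2)

theorem vadd_val {τ : Type} [DecidableEq τ] (u v : Vec τ) (x : τ) :
    (vadd u v).val x = u.val x + v.val x := by
  by_cases h1 : x ∈ u.2 <;> by_cases h2 : x ∈ v.2 <;> simp [vadd, Vec.val, h1, h2]

/-- Domination of vectors. -/
def VLe {τ : Type} [DecidableEq τ] (u v : Vec τ) : Prop := ∀ x, u.val x ≤ v.val x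

theorem vle_iff {τ : Type} [DecidableEq τ] {u v : Vec τ} :
    VLe u v ↔ (∀ x ∈ u.2, x ∈ v.2) ∧ ∀ x ∈ u.1, x ∈ v.2 ∨ u.1.count x ≤ v.1.count x := by
  constructor
  · intro h
    refine ⟨fun x hx => ?_, fun x hx => ?_⟩
    · by_contra hn
      have := h x
      simp [Vec.val, hx, hn] at this
    · by_cases h2 : x ∈ v.2
      · exact Or.inl h2
      · have := h x
        by_cases h1 : x ∈ u.2
        · simp [Vec.val, h1, h2] at this
        · simp only [Vec.val, h1, h2, if_false] at this
          exact Or.inr (by exact_mod_cast this)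
  · rintro ⟨h1, h2⟩ x
    simp only [Vec.val]
    split
    · next hx => simp [h1 x hx]
    · split
      · simp
      · next hx hv =>
        by_cases hm : x ∈ u.1
        · exact_mod_cast (h2 x hm).resolve_left hv
        · simp [List.count_eq_zero_of_not_mem hm]

/-- A sequence of summaries along a stack. -/
inductive Chain (T : List Entry) : TSt → List ℕ → Vec Letter → TSt → Prop
  | nil {q : TSt} : Chain T q [] ([], []) q
  | cons {q q1 q2 : TSt} {b : ℕ} {w : List ℕ} {u δ : Vec Letter} : ((q, b, q1), u) ∈ T →
      Chain T q1 w δ q2 → Chain T q (b :: w) (vadd u δ) q2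

/-- One step of the enumeration of the sequences of summaries. -/
def chainStep (T : List Entry) (l : List (TSt × Vec Letter)) (b : ℕ) : List (TSt × Vec Letter) :=
  l.flatMap fun s => (T.filter fun t => t.1.1 = s.1 ∧ t.1.2.1 = b).map
    fun t => (t.1.2.2, vadd s.2 t.2)

/-- All final states of sequences of summaries along a stack, with the sum of the vectors. -/
def chains (T : List Entry) (s : TSt × Vec Letter) (w : List ℕ) : List (TSt × Vec Letter) :=
  w.foldl (chainStep T) [s]

theorem mem_chains {T : List Entry} {q : TSt} {u0 : Vec Letter} {w : List ℕ} {q' : TSt}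
    {u : Vec Letter} :
    (q', u) ∈ chains T (q, u0) w ↔ ∃ δ, Chain T q w δ q' ∧ u = vadd u0 δ := by
  have key : ∀ (w : List ℕ) (l : List (TSt × Vec Letter)),
      (q', u) ∈ w.foldl (chainStep T) l ↔
        ∃ s ∈ l, ∃ δ, Chain T s.1 w δ q' ∧ u = vadd s.2 δ := by
    intro w
    induction w with
    | nil =>
      intro l
      simp only [List.foldl_nil]
      constructor
      · intro h
        exact ⟨_, h, _, .nil, by simp [vadd]⟩
      · rintro ⟨⟨q, s⟩, h, δ, hc, rfl⟩
        cases hc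
        simpa [vadd] using h
    | cons b w ih =>
      intro l
      rw [List.foldl_cons, ih]
      simp only [chainStep, List.mem_flatMap, List.mem_map, List.mem_filter, decide_eq_true_eq]
      constructor
      · rintro ⟨_, ⟨s, hs, ⟨⟨q1, b', q2⟩, v⟩, ⟨ht, h1, h2⟩, rfl⟩, δ, hc, rfl⟩
        simp only at h1 h2
        subst h1 h2
        exact ⟨s, hs, _, .cons ht hc, by simp [vadd]⟩
      · rintro ⟨⟨q, s⟩, hs, δ, hc, rfl⟩
        cases hc with
        | cons ht hc =>
          exact ⟨_, ⟨_, hs, _, ⟨ht, rfl, rfl⟩, rfl⟩, _, hc, by simp [vadd]⟩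
  simpa [chains] using key w [(q, u0)]

theorem Chain.split {T : List Entry} {q q' : TSt} {w w' : List ℕ} {u : Vec Letter}
    (h : Chain T q (w ++ w') u q') :
    ∃ u1 u2 q1, u = vadd u1 u2 ∧ Chain T q w u1 q1 ∧ Chain T q1 w' u2 q' := by
  induction w generalizing q u with
  | nil => exact ⟨([], []), u, q, by simp [vadd], .nil, h⟩
  | cons b w ih =>
    cases h with
    | cons ht h =>
      obtain ⟨u1, u2, q1, rfl, h1, h2⟩ := ih h
      exact ⟨_, u2, q1, by simp [vadd], .cons ht h1, h2⟩

/-- The global states at the end of segments. -/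
def tgts (a : Sys) : List ℕ := (a.2.1.map fun x => x.2.2.1) ++ a.2.2.2.map fun x => x.2

/-- `QS` and `Γs` contain all relevant thread states and symbols, and the set of summaries `T` is
closed under all rules. -/
structure TClosed (a : Sys) (K : ℕ) (Γs : List ℕ) (QS : List TSt) (T : List Entry) : Prop where
  nil_mem : (0, 0, []) ∈ QS
  skel : ∀ q ∈ QS, q.1 ≠ 0 ∨ K + 1 ≤ q.2.2.length ∨
    ∀ x ∈ a.2.2.1, ∀ y ∈ tgts a, (0, 0, (x.1, y) :: q.2.2) ∈ QS
  step : ∀ q ∈ QS, ∀ γ ∈ Γs, ∀ z ∈ succs a q γ, z.1 ∈ QS ∧ (∀ x ∈ z.2.1, x ∈ Γs) ∧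
    (∀ l ∈ z.2.2, l.2 ∈ Γs) ∧
    ∀ s ∈ chains T (z.1, (z.2.2, [])) z.2.1, ∃ t ∈ T, t.1 = (q, γ, s.1) ∧ VLe s.2 t.2

theorem TClosed.run {a : Sys} {K : ℕ} {Γs : List ℕ} {QS : List TSt} {T : List Entry}
    (hT : TClosed a K Γs QS T) {q q' : TSt} {w : List ℕ} {v : List Letter} (h : Run a q w v q')
    (hq : q ∈ QS) (hw : ∀ x ∈ w, x ∈ Γs) : ∃ u, Chain T q w u q' ∧ VLe (v, []) u := by
  induction h with
  | nil => exact ⟨_, .nil, fun _ => le_rfl⟩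
  | @step q q1 q' γ u w ls v hr _ ih =>
    obtain ⟨h1, h2, -, h3⟩ := hT.step q hq γ (hw _ List.mem_cons_self) (q1, u, ls) (mem_succs.2 hr)
    obtain ⟨U, hU, hle⟩ := ih h1 fun x hx => (List.mem_append.1 hx).elim (h2 x)
      fun hx => hw x (List.mem_cons_of_mem _ hx)
    obtain ⟨u1, u2, qm, rfl, hc1, hc2⟩ := hU.split
    obtain ⟨⟨_, t⟩, ht, h4, h5⟩ := h3 _ (mem_chains.2 ⟨u1, hc1, rfl⟩)
    simp only at h4 h5
    subst h4
    refine ⟨_, .cons ht hc2, fun x => ?_⟩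
    have e1 := hle x
    have e2 := h5 x
    rw [vadd_val] at e1 e2 ⊢
    have e3 : Vec.val (ls ++ v, []) x = Vec.val (ls, []) x + Vec.val (v, []) x :=
      vadd_val (ls, []) (v, []) x
    rw [e3]
    calc _ ≤ Vec.val (ls, []) x + (u1.val x + u2.val x) := by gcongr
      _ = (Vec.val (ls, []) x + u1.val x) + u2.val x := by rw [add_assoc]
      _ ≤ _ := by gcongr

theorem TClosed.run_single {a : Sys} {K : ℕ} {Γs : List ℕ} {QS : List TSt} {T : List Entry}
    (hT : TClosed a K Γs QS T) {q q' : TSt} {γ : ℕ} {v : List Letter} (h : Run a q [γ] v q')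
    (hq : q ∈ QS) (hγ : γ ∈ Γs) : ∃ u, ((q, γ, q'), u) ∈ T ∧ VLe (v, []) u := by
  obtain ⟨u, hu, hle⟩ := hT.run h hq (by simpa using hγ)
  cases hu with
  | cons ht hc =>
    cases hc
    exact ⟨_, ht, by simpa [vadd] using hle⟩

end Thread

/-! ### The net of threads and its symbolic version -/

section ThreadNet

/-- Tokens: a fresh thread, given by its stack symbol, or a thread committed to an execution. -/
abbrev Tok (V : Type) : Type := ℕ ⊕ (Skel × Bool × V)

instance : DecidableEq TSt := instDecidableEqProd

instance : DecidableEq Entry := instDecidableEqProd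

instance : DecidableEq (Tok Entry) := instDecidableEqSum

/-- What remains of a committed thread after executing a segment. -/
def cont {V : Type} (S : Skel) (e : Bool) (v : V) : List (Tok V) :=
  if S = [] ∧ e = true then [] else [.inr (S, e, v)]

/-- The threads spawned in a segment. -/
def syms {V : Type} (n : ℕ) (l : List Letter) : List (Tok V) :=
  (l.filter fun x => x.1 = n).map fun x => .inl x.2

theorem count_inl_syms {V : Type} [DecidableEq V] (n γ : ℕ) (l : List Letter) :
    Multiset.count (.inl γ) (syms (V := V) n l : Multiset (Tok V)) =
      Multiset.count (n, γ) (l : Multiset Letter) := by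
  induction l with
  | nil => simp [syms]
  | cons x l ih =>
    obtain ⟨m, b⟩ := x
    simp only [syms] at ih ⊢
    rw [← Multiset.cons_coe, Multiset.count_cons, ← ih]
    by_cases h : m = n
    · subst h
      by_cases hb : b = γ
      · subst hb
        simp [← Multiset.cons_coe]
      · rw [if_neg (by simpa using fun h => hb h.symm)]
        rw [List.filter_cons_of_pos (by simp), List.map_cons, ← Multiset.cons_coe,
          Multiset.count_cons_of_ne (by simpa using fun h => hb h.symm), add_zero]
    · rw [if_neg (by simpa using fun h' _ => h h'.symm)]
      simp [h]

theorem count_inr_syms {V : Type} [DecidableEq V] (n : ℕ) (x : Skel × Bool × V) (l : List Letter) :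
    Multiset.count (.inr x) (syms (V := V) n l : Multiset (Tok V)) = 0 := by
  refine Multiset.count_eq_zero_of_notMem fun h => ?_
  obtain ⟨y, -, hy⟩ := List.mem_map.1 (Multiset.mem_coe.1 h)
  simp at hy

theorem mem_syms {V : Type} {n γ : ℕ} {l : List Letter} :
    (.inl γ : Tok V) ∈ syms n l ↔ (n, γ) ∈ l := by
  simp [syms]

/-- The net of threads: a fresh thread may commit to a complete execution, and a committed thread
may execute its next segment. -/
inductive AStep (a : Sys) (K : ℕ) : ℕ × Multiset (Tok (List Letter)) →
    ℕ × Multiset (Tok (List Letter)) → Prop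
  | choose {S : Skel} {γ : ℕ} {v : List Letter} {q' : TSt} {e : Bool} {g : ℕ}
      {R : Multiset (Tok (List Letter))} : S.length ≤ K + 1 → Run a (0, 0, S) [γ] v q' →
      Fin a e q' → AStep a K (g, {.inl γ} + R) (g, {.inr (S, e, v)} + R)
  | fire {p r : ℕ} {S : Skel} {e : Bool} {v : List Letter} {R : Multiset (Tok (List Letter))} :
      AStep a K (p, {.inr ((p, r) :: S, e, v)} + R)
        (r, ((cont S e v ++ syms (S.length + 1) v : List (Tok (List Letter))) : Multiset _) + R)

theorem AStep.frame {a : Sys} {K : ℕ} {c c' : ℕ × Multiset (Tok (List Letter))}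
    (h : AStep a K c c') (D : Multiset (Tok (List Letter))) :
    AStep a K (c.1, c.2 + D) (c'.1, c'.2 + D) := by
  cases h with
  | choose h1 h2 h3 =>
    simp only [add_assoc]
    exact .choose h1 h2 h3
  | fire =>
    simp only [add_assoc]
    exact .fire

theorem AStep.frame_star {a : Sys} {K : ℕ} {c c' : ℕ × Multiset (Tok (List Letter))}
    (h : Relation.ReflTransGen (AStep a K) c c') (D : Multiset (Tok (List Letter))) :
    Relation.ReflTransGen (AStep a K) (c.1, c.2 + D) (c'.1, c'.2 + D) := by
  induction h with
  | refl => exact .refl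
  | tail _ h ih => exact ih.tail (h.frame D)

/-- Existence of a reachable strictly increasing loop in the net of threads. -/
def Pump (a : Sys) (K g0 γ0 : ℕ) : Prop :=
  ∃ (g : ℕ) (c d : Multiset (Tok (List Letter))),
    Relation.ReflTransGen (AStep a K) (g0, {.inl γ0}) (g, c) ∧
    Relation.ReflTransGen (AStep a K) (g, c) (g, c + d) ∧ d ≠ 0

/-- Transitions of the symbolic net. -/
inductive NetTr (a : Sys) (K : ℕ) (Γs : List ℕ) (T : List Entry) : Trn (Tok Entry) → Prop
  | choose {S : Skel} {γ : ℕ} {q' : TSt} {u : Vec Letter} {e : Bool} :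
      (((0, 0, S), γ, q'), u) ∈ T → S.length ≤ K + 1 → Fin a e q' →
      NetTr a K Γs T (none, [.inl γ], ([.inr (S, e, (((0, 0, S), γ, q'), u))], []), false)
  | fire {t : Entry} {p r : ℕ} {S : Skel} {e : Bool} : t ∈ T → (p, r) :: S ∈ t.1.1.2.2.tails →
      NetTr a K Γs T (some (p, r), [.inr ((p, r) :: S, e, t)],
        (cont S e t ++ syms (S.length + 1) t.2.1, syms (S.length + 1) t.2.2), false)
  | drop_sym {γ : ℕ} : γ ∈ Γs → NetTr a K Γs T (none, [.inl γ], ([], []), true)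
  | drop_com {t : Entry} {S : Skel} {e : Bool} : t ∈ T → S ∈ t.1.1.2.2.tails →
      NetTr a K Γs T (none, [.inr (S, e, t)], ([], []), true)

/-- A certificate for boundedness. -/
def Bdd (a : Sys) (K g0 γ0 : ℕ) : Prop :=
  ∃ (Γs : List ℕ) (QS : List TSt) (T : List Entry) (Tr : List (Trn (Tok Entry)))
    (M : List (Node (Tok Entry))) (E : List (Edge (Tok Entry))),
    γ0 ∈ Γs ∧ TClosed a K Γs QS T ∧ (∀ t, NetTr a K Γs T t → t ∈ Tr) ∧ Cert Tr g0 [.inl γ0] M E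

theorem exists_netTr (a : Sys) (K : ℕ) (Γs : List ℕ) (T : List Entry) :
    ∃ Tr : List (Trn (Tok Entry)), ∀ t, t ∈ Tr ↔ NetTr a K Γs T t := by
  have h : {t | NetTr a K Γs T t}.Finite := by
    classical
    let coms : List (Tok Entry) := T.flatMap fun t => t.1.1.2.2.tails.flatMap fun S =>
      [.inr (S, false, t), .inr (S, true, t)]
    have hcoms : ∀ t ∈ T, ∀ S ∈ t.1.1.2.2.tails, ∀ e, (.inr (S, e, t) : Tok Entry) ∈ coms := by
      intro t ht S hS e
      refine List.mem_flatMap.2 ⟨t, ht, List.mem_flatMap.2 ⟨S, hS, ?_⟩⟩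
      cases e <;> simp
    let l1 : List (Trn (Tok Entry)) := coms.filterMap fun x => Sum.elim (fun _ => none)
      (fun y => some (none, [.inl y.2.2.1.2.1], ([.inr y], []), false)) x
    let l2 : List (Trn (Tok Entry)) := coms.filterMap fun x => Sum.elim (fun _ => none)
      (fun y => some (y.1.head?, [.inr y],
        (cont y.1.tail y.2.1 y.2.2 ++ syms (y.1.tail.length + 1) y.2.2.2.1,
          syms (y.1.tail.length + 1) y.2.2.2.2), false)) x
    let l3 : List (Trn (Tok Entry)) := (coms ++ Γs.map fun x => Sum.inl x).map fun x =>
      (none, [x], ([], []), true)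
    refine (List.finite_toSet (l1 ++ l2 ++ l3)).subset ?_
    rintro t h
    simp only [Set.mem_ofPred_eq, List.mem_append]
    cases h with
    | @choose S γ q' u e ht hS hf =>
      exact Or.inl (Or.inl (List.mem_filterMap.2 ⟨_, hcoms _ ht S (by simp) e, rfl⟩))
    | fire ht hS =>
      exact Or.inl (Or.inr (List.mem_filterMap.2 ⟨_, hcoms _ ht _ hS _, rfl⟩))
    | drop_sym h =>
      exact Or.inr (List.mem_map.2 ⟨_, List.mem_append_right _ (List.mem_map_of_mem h), rfl⟩)
    | drop_com ht hS =>
      exact Or.inr (List.mem_map.2 ⟨_, List.mem_append_left _ (hcoms _ ht _ hS _), rfl⟩)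
  exact ⟨h.toFinset.toList, fun t => by simp⟩

/-- Split a multiset below a sum. -/
theorem exists_split {τ : Type} [DecidableEq τ] {f g : τ → ℕ∞} {x : Multiset τ}
    (h : ∀ p, (x.count p : ℕ∞) ≤ f p + g p) :
    ∃ x1 x2 : Multiset τ, x = x1 + x2 ∧ (∀ p, (x1.count p : ℕ∞) ≤ f p) ∧
      ∀ p, (x2.count p : ℕ∞) ≤ g p := by
  obtain ⟨x1, hx1⟩ := exists_multiset_count x.toFinset
    (fun p => if f p = ⊤ then x.count p else min (x.count p) (f p).toNat) fun p hp => by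
      have : x.count p = 0 := Multiset.count_eq_zero.2 (by simpa using hp)
      simp [this]
  have hle : x1 ≤ x := Multiset.le_iff_count.2 fun p => by
    rw [hx1]
    split
    · exact le_rfl
    · exact min_le_left _ _
  refine ⟨x1, x - x1, (add_tsub_cancel_of_le hle).symm, fun p => ?_, fun p => ?_⟩
  · rw [hx1]
    split
    · next h => simp [h]
    · next h =>
      conv_rhs => rw [← ENat.natCast_toNat h]
      exact_mod_cast min_le_right _ _
  · rw [Multiset.count_sub, hx1]
    have := h p
    split
    · simp
    · next h =>
      cases hg : g p with
      | top => simp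
      | coe m =>
        rw [hg, ← ENat.natCast_toNat h] at this
        norm_cast at this ⊢
        omega

theorem Chain.realize {a : Sys} {T : List Entry}
    (hT : ∀ t ∈ T, ∀ x : Multiset Letter, (∀ p, (x.count p : ℕ∞) ≤ t.2.val p) →
      ∃ v : List Letter, Run a t.1.1 [t.1.2.1] v t.1.2.2 ∧ x ≤ v)
    {q q' : TSt} {w : List ℕ} {δ : Vec Letter} (h : Chain T q w δ q') (x : Multiset Letter)
    (hx : ∀ p, (x.count p : ℕ∞) ≤ δ.val p) : ∃ v : List Letter, Run a q w v q' ∧ x ≤ v := by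
  induction h generalizing x with
  | nil =>
    refine ⟨[], .nil, ?_⟩
    rw [Multiset.le_iff_count]
    intro p
    have := hx p
    simp only [Vec.val] at this
    simpa using this
  | @cons q q1 q' b w u δ ht _ ih =>
    obtain ⟨x1, x2, rfl, h1, h2⟩ := exists_split (f := u.val) (g := δ.val) fun p =>
      (hx p).trans (vadd_val _ _ p).le
    obtain ⟨v1, hr1, hle1⟩ := hT _ ht x1 h1
    obtain ⟨v2, hr2, hle2⟩ := ih x2 h2
    refine ⟨v1 ++ v2, hr1.append hr2, ?_⟩
    rw [← Multiset.coe_add]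
    exact add_le_add hle1 hle2

/-- Replace symbolic executions by actual ones. -/
def conc (f : Entry → List Letter) : Tok Entry → Tok (List Letter) :=
  Sum.map id fun x => (x.1, x.2.1, f x.2.2)

theorem map_conc_cont (f : Entry → List Letter) (S : Skel) (e : Bool) (t : Entry) :
    (cont S e t).map (conc f) = cont S e (f t) := by
  simp only [cont]
  split <;> simp [conc]

theorem map_conc_syms (f : Entry → List Letter) (n : ℕ) (l : List Letter) :
    (syms n l).map (conc f) = syms n l := by
  simp [syms, conc]

theorem Path.realize {a : Sys} {K : ℕ} {Γs : List ℕ} {T : List Entry} {Tr : List (Trn (Tok Entry))}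
    (hTr : ∀ t ∈ Tr, NetTr a K Γs T t) (f : ℕ → Entry → List Letter)
    (hf : ∀ n, ∀ t ∈ T, Run a t.1.1 [t.1.2.1] (f n t) t.1.2.2 ∧
      ∀ p, if p ∈ t.2.2 then n ≤ Multiset.count p (f n t : Multiset Letter) else
        Multiset.count p (t.2.1 : Multiset Letter) ≤ Multiset.count p (f n t : Multiset Letter))
    {c c' : ℕ × Multiset (Tok Entry)} {k : ℕ} (h : Path Tr c k c') :
    ∃ n0, ∀ n ≥ n0, ∃ D : Multiset (Tok (List Letter)), k ≤ Multiset.card D ∧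
      Relation.ReflTransGen (AStep a K) (c.1, c.2.map (conc (f n)))
        (c'.1, c'.2.map (conc (f n)) + D) := by
  induction h with
  | refl => exact ⟨0, fun n _ => ⟨0, by simp, by simpa using .refl⟩⟩
  | @tail k c1 c2 t hp ht hfire ih =>
    obtain ⟨n0, hn0⟩ := ih
    obtain ⟨g1, m1⟩ := c1
    obtain ⟨g2, m2⟩ := c2
    obtain ⟨hctl, rest, u, u2, rfl, rfl, hu, hu2⟩ := hfire
    have fin : ∀ n, ∀ D X : Multiset (Tok (List Letter)), ∀ k, k ≤ Multiset.card D →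
        u.map (conc (f n)) ≤ X →
        Relation.ReflTransGen (AStep a K) (c.1, c.2.map (conc (f n)))
          (g2, X + (rest.map (conc (f n)) + D)) →
        ∃ D : Multiset (Tok (List Letter)), k ≤ Multiset.card D ∧
          Relation.ReflTransGen (AStep a K) (c.1, c.2.map (conc (f n)))
            (g2, (rest + u).map (conc (f n)) + D) := by
      intro n D X k hk hX hstar
      obtain ⟨Y, rfl⟩ := Multiset.le_iff_exists_add.1 hX
      refine ⟨Y + D, by rw [Multiset.card_add]; omega, ?_⟩
      convert hstar using 2
      rw [Multiset.map_add]
      abel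
    cases hTr t ht with
    | @choose S γ q' w e hmem hS hfin =>
      refine ⟨n0, fun n hn => ?_⟩
      obtain ⟨D, hD, hstar⟩ := hn0 n hn
      have hg : g2 = g1 := by simpa [ctl] using hctl
      subst hg
      have hu2' : u2 = 0 := Multiset.eq_zero_of_forall_notMem fun x hx => by simpa using hu2 x hx
      rw [hu2', add_zero] at hu
      refine fin n D {.inr (S, e, f n (((0, 0, S), γ, q'), w))} _ (by simpa using hD)
        (by simpa [conc] using Multiset.map_le_map (f := conc (f n)) hu) ?_
      refine hstar.tail ?_
      have := AStep.choose (a := a) (K := K) (g := g2) (R := rest.map (conc (f n)) + D) hS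
        (hf n _ hmem).1 hfin
      convert this using 2
      simp [conc]
    | @fire t p r S e hmem htail =>
      refine ⟨n0 + Multiset.card u2 + t.2.1.length, fun n hn => ?_⟩
      obtain ⟨D, hD, hstar⟩ := hn0 n (by omega)
      have hg : p = g1 ∧ g2 = r := by
        simp only [ctl] at hctl
        split at hctl
        · next h => exact ⟨h, by simpa using hctl⟩
        · simp at hctl
      obtain ⟨rfl, rfl⟩ := hg
      refine fin n D ((cont S e (f n t) ++ syms (S.length + 1) (f n t) : List (Tok (List Letter)))
          : Multiset (Tok (List Letter))) _ (by simpa using hD) ?_ (hstar.tail ?_)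
      · refine (Multiset.map_le_map hu).trans ?_
        simp only [Multiset.map_add, Multiset.map_coe, map_conc_cont,
          map_conc_syms, ← Multiset.coe_add, add_assoc]
        gcongr
        rw [Multiset.le_iff_count]
        rintro (γ | y)
        · rw [Multiset.count_add, count_inl_syms, count_inl_syms]
          have h1 := (hf n t hmem).2 (S.length + 1, γ)
          split at h1
          · have h2 := Multiset.count_le_card (.inl γ) (u2.map (conc (f n)))
            have h3 := Multiset.count_le_card (S.length + 1, γ) (t.2.1 : Multiset Letter)
            rw [Multiset.coe_card] at h3
            rw [Multiset.card_map] at h2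
            omega
          · next hn =>
            have : (u2.map (conc (f n))).count (.inl γ) = 0 := by
              refine Multiset.count_eq_zero.2 fun h => ?_
              obtain ⟨y, hy, he⟩ := Multiset.mem_map.1 h
              cases y with
              | inl γ' =>
                simp only [conc, Sum.map_inl, id, Sum.inl.injEq] at he
                subst he
                exact hn (mem_syms.1 (hu2 _ hy))
              | inr y => simp [conc] at he
            omega
        · have : (u2.map (conc (f n))).count (.inr y) = 0 := by
            refine Multiset.count_eq_zero.2 fun h => ?_
            obtain ⟨x, hx, he⟩ := Multiset.mem_map.1 h
            obtain ⟨z, -, rfl⟩ := List.mem_map.1 (hu2 _ hx)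
            simp [conc] at he
          rw [Multiset.count_add, this, count_inr_syms]
          simp
      · have := AStep.fire (a := a) (K := K) (p := p) (r := g2) (S := S) (e := e) (v := f n t)
          (R := rest.map (conc (f n)) + D)
        convert this using 2
        simp [conc]
    | @drop_sym γ hγ =>
      refine ⟨n0, fun n hn => ?_⟩
      obtain ⟨D, hD, hstar⟩ := hn0 n hn
      have hg : g2 = g1 := by simpa [ctl] using hctl
      subst hg
      have hu0 : u = 0 := by
        have hu2' : u2 = 0 := Multiset.eq_zero_of_forall_notMem fun x hx => by simpa using hu2 x hx
        rw [hu2'] at hu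
        simpa using hu
      refine fin n (D + {.inl γ}) 0 _ (by simpa using hD) (by simp [hu0]) ?_
      convert hstar using 2
      simp only [Multiset.coe_singleton, Multiset.map_add, Multiset.map_singleton, conc,
        Sum.map_inl, id]
      abel
    | @drop_com t S e hmem htail =>
      refine ⟨n0, fun n hn => ?_⟩
      obtain ⟨D, hD, hstar⟩ := hn0 n hn
      have hg : g2 = g1 := by simpa [ctl] using hctl
      subst hg
      have hu0 : u = 0 := by
        have hu2' : u2 = 0 := Multiset.eq_zero_of_forall_notMem fun x hx => by simpa using hu2 x hx
        rw [hu2'] at hu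
        simpa using hu
      refine fin n (D + {.inr (S, e, f n t)}) 0 _ (by simpa using hD) (by simp [hu0]) ?_
      convert hstar using 2
      simp only [Multiset.coe_singleton, Multiset.map_add, Multiset.map_singleton, conc,
        Sum.map_inr]
      abel

end ThreadNet

section Dichotomy

theorem SelfCover.pump {a : Sys} {K : ℕ} {Γs : List ℕ} {T : List Entry}
    {Tr : List (Trn (Tok Entry))} {g0 γ0 : ℕ} (hTr : ∀ t ∈ Tr, NetTr a K Γs T t)
    (f : ℕ → Entry → List Letter)
    (hf : ∀ n, ∀ t ∈ T, Run a t.1.1 [t.1.2.1] (f n t) t.1.2.2 ∧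
      ∀ p, if p ∈ t.2.2 then n ≤ Multiset.count p (f n t : Multiset Letter) else
        Multiset.count p (t.2.1 : Multiset Letter) ≤ Multiset.count p (f n t : Multiset Letter))
    (h : SelfCover Tr g0 [.inl γ0]) : Pump a K g0 γ0 := by
  obtain ⟨k, l, g, c, c', h1, h2, hle⟩ := h
  obtain ⟨x, rfl⟩ := Multiset.le_iff_exists_add.1 hle
  obtain ⟨n1, hn1⟩ := Path.realize hTr f hf h1
  obtain ⟨n2, hn2⟩ := Path.realize hTr f hf h2
  obtain ⟨D1, -, hs1⟩ := hn1 (max n1 n2) (le_max_left _ _)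
  obtain ⟨D2, hD2, hs2⟩ := hn2 (max n1 n2) (le_max_right _ _)
  refine ⟨g, c.map (conc (f (max n1 n2))) + D1, x.map (conc (f (max n1 n2))) + D2,
    by simpa [conc] using hs1, ?_, ?_⟩
  · convert AStep.frame_star hs2 D1 using 2
    rw [Multiset.map_add]
    ac_rfl
  · intro h0
    have := congrArg Multiset.card h0
    rw [Multiset.card_add, Multiset.card_zero] at this
    omega

theorem Vec.val_coe {τ : Type} [DecidableEq τ] (l : List τ) (x : τ) :
    Vec.val (l, []) x = (Multiset.count x (l : Multiset τ) : ℕ∞) := by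
  simp [Vec.val]

/-- All lists over `l` of length at most `n`. -/
def lists {α : Type} (l : List α) (n : ℕ) : List (List α) :=
  n.rec [[]] fun _ r => [] :: l.flatMap fun x => r.map fun s => x :: s

theorem mem_lists {α : Type} {l : List α} {n : ℕ} {s : List α} :
    s ∈ lists l n ↔ s.length ≤ n ∧ ∀ x ∈ s, x ∈ l := by
  induction n generalizing s with
  | zero =>
    rw [nonpos_iff_eq_zero, List.length_eq_zero_iff]
    refine List.mem_singleton.trans ?_
    constructor
    · rintro rfl; simp
    · exact fun h => h.1
  | succ n ih =>
    simp only [lists] at ih ⊢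
    cases s with
    | nil => simp
    | cons y s => simp [ih]; tauto

/-- The relevant stack symbols. -/
def symsOf (a : Sys) (γ0 : ℕ) : List ℕ :=
  γ0 :: ((a.1.flatMap fun x => x.2.2.2.1 ++ x.2.2.2.2.toList) ++ a.2.1.flatMap fun x => x.2.2.2)

/-- The relevant thread states. -/
def statesOf (a : Sys) (K : ℕ) : List TSt :=
  [0, 1, 2].flatMap fun m =>
    (0 :: ((a.1.map fun x => x.2.2.1) ++ a.2.2.1.map fun x => x.2.1)).flatMap fun g =>
      (lists (a.2.2.1.flatMap fun x => (tgts a).map fun y => (x.1, y)) (K + 1)).map fun S =>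
        (m, g, S)

theorem mem_statesOf {a : Sys} {K m g : ℕ} {S : Skel} : (m, g, S) ∈ statesOf a K ↔
    m ≤ 2 ∧ (g = 0 ∨ (∃ x ∈ a.1, x.2.2.1 = g) ∨ ∃ x ∈ a.2.2.1, x.2.1 = g) ∧
      S.length ≤ K + 1 ∧ ∀ s ∈ S, ∃ x ∈ a.2.2.1, ∃ y ∈ tgts a, (x.1, y) = s := by
  simp only [statesOf, List.mem_flatMap, List.mem_map, mem_lists, List.mem_cons, List.mem_append,
    Prod.mk.injEq]
  constructor
  · rintro ⟨m, hm, g, hg, S, hS, rfl, rfl, rfl⟩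
    refine ⟨?_, hg, hS⟩
    simp at hm
    omega
  · rintro ⟨hm, hg, hS⟩
    refine ⟨m, ?_, g, hg, S, hS, rfl, rfl, rfl⟩
    simp
    omega

theorem Rule.mem_statesOf {a : Sys} {K γ0 : ℕ} {q q1 : TSt} {γ : ℕ} {w : List ℕ}
    {ls : List Letter} (h : Rule a q γ q1 w ls) (hq : q ∈ statesOf a K) (hγ : γ ∈ symsOf a γ0) :
    q1 ∈ statesOf a K ∧ (∀ x ∈ w, x ∈ symsOf a γ0) ∧
      ∀ l ∈ ls, l.1 ≤ K + 1 ∧ l.2 ∈ symsOf a γ0 := by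
  cases h with
  | resume h =>
    rw [CBL.mem_statesOf] at hq ⊢
    exact ⟨⟨by omega, Or.inr (Or.inr ⟨_, h, rfl⟩), hq.2.2⟩, by simpa using hγ, by simp⟩
  | @create m g S γ g' w sp hm h =>
    rw [CBL.mem_statesOf] at hq ⊢
    refine ⟨⟨le_rfl, Or.inr (Or.inl ⟨_, h, rfl⟩), hq.2.2⟩, fun x hx => ?_, fun l hl => ?_⟩
    · exact List.mem_cons_of_mem _ (List.mem_append_left _ (List.mem_flatMap.2
        ⟨_, h, List.mem_append_left _ hx⟩))
    · obtain ⟨x, hx, rfl⟩ := List.mem_map.1 hl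
      exact ⟨hq.2.2.1, List.mem_cons_of_mem _ (List.mem_append_left _ (List.mem_flatMap.2
        ⟨_, h, List.mem_append_right _ hx⟩))⟩
  | @swap g p r S γ w h =>
    rw [CBL.mem_statesOf] at hq ⊢
    refine ⟨⟨by omega, Or.inl rfl, ?_, fun s hs => hq.2.2.2 s (List.mem_cons_of_mem _ hs)⟩,
      fun x hx => ?_, by simp⟩
    · have := hq.2.2.1
      rw [List.length_cons] at this
      omega
    · exact List.mem_cons_of_mem _ (List.mem_append_right _ (List.mem_flatMap.2 ⟨_, h, hx⟩))
  | pop => exact ⟨hq, by simp, by simp⟩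

theorem Run.mem_statesOf {a : Sys} {K γ0 : ℕ} {q q' : TSt} {w : List ℕ} {v : List Letter}
    (h : Run a q w v q') (hq : q ∈ statesOf a K) (hw : ∀ x ∈ w, x ∈ symsOf a γ0) :
    q' ∈ statesOf a K ∧ ∀ l ∈ v, l.1 ≤ K + 1 ∧ l.2 ∈ symsOf a γ0 := by
  induction h with
  | nil => exact ⟨hq, by simp⟩
  | step hr _ ih =>
    obtain ⟨h1, h2, h3⟩ := hr.mem_statesOf hq (hw _ List.mem_cons_self)
    obtain ⟨h4, h5⟩ := ih h1 fun x hx => (List.mem_append.1 hx).elim (h2 x)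
      fun hx => hw x (List.mem_cons_of_mem _ hx)
    exact ⟨h4, fun l hl => (List.mem_append.1 hl).elim (h3 l) (h5 l)⟩

theorem exists_tclosed (a : Sys) (K γ0 : ℕ) :
    ∃ T : List Entry, TClosed a K (symsOf a γ0) (statesOf a K) T ∧
      ∀ t ∈ T, ∀ x : Multiset Letter, (∀ p, (x.count p : ℕ∞) ≤ t.2.val p) →
        ∃ v : List Letter, Run a t.1.1 [t.1.2.1] v t.1.2.2 ∧ x ≤ v := by
  let P : TSt → ℕ → TSt → Set (Multiset Letter) := fun q γ q' =>
    {v | ∃ v' : List Letter, (v' : Multiset Letter) = v ∧ Run a q [γ] v' q'}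
  have hfin : ∀ q γ q', ∃ I : List (Vec Letter), q ∈ statesOf a K → γ ∈ symsOf a γ0 →
      (∀ u ∈ I, Adh (P q γ q') u.val) ∧
        ∀ f, Adh (P q γ q') f → ∃ u ∈ I, ∀ x, f x ≤ u.val x := by
    intro q γ q'
    by_cases hq : q ∈ statesOf a K
    · by_cases hγ : γ ∈ symsOf a γ0
      · obtain ⟨I, hI⟩ := exists_finite_adh (P q γ q')
          (Finset.range (K + 2) ×ˢ (symsOf a γ0).toFinset) (by
            rintro _ ⟨v, rfl, hv⟩ x hx
            have := (hv.mem_statesOf hq (by simpa using hγ)).2 x hx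
            rw [Finset.mem_product, Finset.mem_range, List.mem_toFinset]
            exact ⟨by omega, this.2⟩)
        exact ⟨I, fun _ _ => hI⟩
      · exact ⟨[], fun _ h => absurd h hγ⟩
    · exact ⟨[], fun h => absurd h hq⟩
  choose I hI using hfin
  let T : List Entry := (statesOf a K).flatMap fun q => (symsOf a γ0).flatMap fun γ =>
    (statesOf a K).flatMap fun q' => (I q γ q').map fun u => ((q, γ, q'), u)
  have hmem : ∀ q γ q' u, ((q, γ, q'), u) ∈ T ↔ q ∈ statesOf a K ∧ γ ∈ symsOf a γ0 ∧
      q' ∈ statesOf a K ∧ u ∈ I q γ q' := by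
    intro q γ q' u
    simp only [T, List.mem_flatMap, List.mem_map, Prod.mk.injEq]
    constructor
    · rintro ⟨q, hq, γ, hγ, q', hq', u, hu, ⟨rfl, rfl, rfl⟩, rfl⟩
      exact ⟨hq, hγ, hq', hu⟩
    · rintro ⟨hq, hγ, hq', hu⟩
      exact ⟨q, hq, γ, hγ, q', hq', u, hu, ⟨rfl, rfl, rfl⟩, rfl⟩
  have hreal : ∀ t ∈ T, ∀ x : Multiset Letter, (∀ p, (x.count p : ℕ∞) ≤ t.2.val p) →
      ∃ v : List Letter, Run a t.1.1 [t.1.2.1] v t.1.2.2 ∧ x ≤ v := by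
    rintro ⟨⟨q, γ, q'⟩, u⟩ ht x hx
    obtain ⟨hq, hγ, -, hu⟩ := (hmem _ _ _ _).1 ht
    obtain ⟨_, ⟨v, rfl, hv⟩, hle⟩ := (hI q γ q' hq hγ).1 u hu x hx
    exact ⟨v, hv, hle⟩
  refine ⟨T, ⟨?_, ?_, ?_⟩, hreal⟩
  · exact mem_statesOf.2 ⟨by omega, Or.inl rfl, by simp, by simp⟩
  · rintro ⟨m, g, S⟩ hq
    rw [mem_statesOf] at hq
    by_cases hm : m = 0
    · by_cases hS : K + 1 ≤ S.length
      · exact Or.inr (Or.inl hS)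
      · refine Or.inr (Or.inr fun x hx y hy => mem_statesOf.2
          ⟨by omega, Or.inl rfl, by simp only [List.length_cons]; omega, ?_⟩)
        intro s hs
        rcases List.mem_cons.1 hs with rfl | hs
        · exact ⟨x, hx, y, hy, rfl⟩
        · exact hq.2.2.2 s hs
    · exact Or.inl hm
  · rintro q hq γ hγ ⟨q1, w, ls⟩ hz
    have hr := mem_succs.1 hz
    obtain ⟨h1, h2, h3⟩ := hr.mem_statesOf hq hγ
    refine ⟨h1, h2, fun l hl => (h3 l hl).2, ?_⟩
    rintro ⟨q', u⟩ hs
    obtain ⟨δ, hδ, rfl⟩ := mem_chains.1 hs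
    have hrun : ∀ v, Run a q1 w v q' → Run a q [γ] (ls ++ v) q' := fun v hv =>
      .step hr (by simpa using hv)
    obtain ⟨v0, hv0, -⟩ := hδ.realize hreal 0 (by simp)
    have hq' := ((hrun v0 hv0).mem_statesOf hq (by simpa using hγ)).1
    obtain ⟨u, hu, hle⟩ := (hI q γ q' hq hγ).2 (vadd (ls, []) δ).val (by
      intro x hx
      obtain ⟨x1, x2, rfl, h1, h2⟩ := exists_split (f := Vec.val (ls, [])) (g := δ.val) fun p =>
        (hx p).trans (vadd_val _ _ p).le
      obtain ⟨v, hv, hle⟩ := hδ.realize hreal x2 h2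
      refine ⟨_, ⟨ls ++ v, rfl, hrun v hv⟩, ?_⟩
      rw [← Multiset.coe_add]
      refine add_le_add (Multiset.le_iff_count.2 fun p => ?_) hle
      have := h1 p
      rw [Vec.val_coe] at this
      exact_mod_cast this)
    exact ⟨((q, γ, q'), u), (hmem _ _ _ _).2 ⟨hq, hγ, hq', hu⟩, rfl, hle⟩

theorem exists_multiset_vec {τ : Type} [DecidableEq τ] (u : Vec τ) (n : ℕ) :
    ∃ x : Multiset τ, (∀ p, (x.count p : ℕ∞) ≤ u.val p) ∧
      ∀ p, if p ∈ u.2 then n ≤ x.count p else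
        Multiset.count p (u.1 : Multiset τ) ≤ x.count p := by
  obtain ⟨x, hx⟩ := exists_multiset_count (u.1 ++ u.2).toFinset
    (fun p => if p ∈ u.2 then n else Multiset.count p (u.1 : Multiset τ)) fun p hp => by
      rw [List.mem_toFinset, List.mem_append, not_or] at hp
      rw [if_neg hp.2, Multiset.count_eq_zero]
      simpa using hp.1
  refine ⟨x, fun p => ?_, fun p => ?_⟩
  · rw [hx]
    by_cases hp : p ∈ u.2 <;> simp [Vec.val, hp]
  · rw [hx]
    by_cases hp : p ∈ u.2 <;> simp [hp]

theorem bdd_of_not_pump {a : Sys} {K g0 γ0 : ℕ} (h : ¬ Pump a K g0 γ0) : Bdd a K g0 γ0 := by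
  obtain ⟨T, hT, hreal⟩ := exists_tclosed a K γ0
  obtain ⟨Tr, hTr⟩ := exists_netTr a K (symsOf a γ0) T
  have hf : ∀ (n : ℕ) (t : Entry), ∃ v : List Letter, t ∈ T → Run a t.1.1 [t.1.2.1] v t.1.2.2 ∧
      ∀ p, if p ∈ t.2.2 then n ≤ Multiset.count p (v : Multiset Letter) else
        Multiset.count p (t.2.1 : Multiset Letter) ≤ Multiset.count p (v : Multiset Letter) := by
    intro n t
    by_cases ht : t ∈ T
    · obtain ⟨x, hx1, hx2⟩ := exists_multiset_vec t.2 n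
      obtain ⟨v, hv, hle⟩ := hreal t ht x hx1
      refine ⟨v, fun _ => ⟨hv, fun p => ?_⟩⟩
      have h1 := hx2 p
      have h2 := Multiset.count_le_of_le p hle
      split <;> simp_all <;> omega
    · exact ⟨[], fun h => absurd h ht⟩
  choose f hf using hf
  have hno : ¬ SelfCover Tr g0 [.inl γ0] := fun hS =>
    h (hS.pump (fun t ht => (hTr t).1 ht) f hf)
  have hmem : ∀ t ∈ Tr, ∀ x, x ∈ t.2.1 ∨ x ∈ t.2.2.1.1 ∨ x ∈ t.2.2.1.2 →
      x ∈ (([.inl γ0] : List (Tok Entry)) ++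
        Tr.flatMap fun t => t.2.1 ++ (t.2.2.1.1 ++ t.2.2.1.2)).toFinset := by
    intro t ht x hx
    rw [List.mem_toFinset]
    refine List.mem_append_right _ (List.mem_flatMap.2 ⟨t, ht, ?_⟩)
    simpa using hx
  obtain ⟨M, E, hC⟩ := exists_cert _ (by simp)
    (fun t ht => ⟨fun x hx => hmem t ht x (Or.inl hx), fun x hx => hmem t ht x (Or.inr (Or.inl hx)),
      fun x hx => hmem t ht x (Or.inr (Or.inr hx))⟩) hno
  exact ⟨symsOf a γ0, statesOf a K, T, Tr, M, E, List.mem_cons_self, hT, fun t => (hTr t).2, hC⟩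

end Dichotomy

/-! ### From pumps to unbounded runs -/

section Unbounded

/-- `a` lists the rules of `A`. -/
structure Rep (A : DCPS) (a : Sys) : Prop where
  cr : ∀ x, x ∈ a.1 ↔ x ∈ A.creation
  it : ∀ x, x ∈ a.2.1 ↔ x ∈ A.interruption
  rs : ∀ x, x ∈ a.2.2.1 ↔ x ∈ A.resumption
  tm : ∀ x, x ∈ a.2.2.2 ↔ x ∈ A.termination

/-- Steps of a DCPS respecting the context switch bound, with a flag recording that a thread has
just been resumed. -/
inductive RStep (A : DCPS) (K : ℕ) : DConfig × Bool → DConfig × Bool → Prop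
  | thread {c c' : DConfig} {b : Bool} : ThreadStep A c c' → RStep A K (c, b) (c', false)
  | resume {c c' : DConfig} {t : Loc} : ResumeStep A t c c' → t.2 ≤ K →
      RStep A K (c, false) (c', true)
  | swap {c c' : DConfig} : SwapStep A c c' → RStep A K (c, false) (c', false)
  | term {c c' : DConfig} : TermStep A c c' → RStep A K (c, false) (c', false)

theorem exists_path_of_transGen {α : Type*} {R : α → α → Prop} {x y : α}
    (h : Relation.TransGen R x y) :
    ∃ (l : ℕ) (f : ℕ → α), f 0 = x ∧ f (l + 1) = y ∧ ∀ i ≤ l, R (f i) (f (i + 1)) := by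
  induction h with
  | @single y h =>
    refine ⟨0, fun i => if i = 0 then x else y, by simp, by simp, fun i hi => ?_⟩
    obtain rfl : i = 0 := by omega
    simpa using h
  | @tail y z _ h ih =>
    obtain ⟨l, f, h0, h1, h2⟩ := ih
    refine ⟨l + 1, fun i => if i ≤ l + 1 then f i else z, by simpa using h0, by simp,
      fun i hi => ?_⟩
    by_cases hil : i = l + 1
    · subst hil
      simpa [h1] using h
    · simpa [show i ≤ l + 1 by omega, show i ≤ l by omega] using h2 i (by omega)

theorem exists_infinite_path {α : Type*} {R : α → α → Prop} {x : ℕ → α}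
    (h : ∀ k, Relation.TransGen R (x k) (x (k + 1))) :
    ∃ (ρ : ℕ → α) (n : ℕ → ℕ), StrictMono n ∧ ρ 0 = x 0 ∧ (∀ k, ρ (n k) = x k) ∧
      ∀ i, R (ρ i) (ρ (i + 1)) := by
  choose l f h0 h1 h2 using fun k => exists_path_of_transGen (h k)
  let nx : ℕ × ℕ → ℕ × ℕ := fun s => if s.2 < l s.1 then (s.1, s.2 + 1) else (s.1 + 1, 0)
  let s : ℕ → ℕ × ℕ := fun i => nx^[i] (0, 0)
  have hs : ∀ i, s (i + 1) = nx (s i) := fun i => Function.iterate_succ_apply' _ _ _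
  have hle : ∀ i, (s i).2 ≤ l (s i).1 := by
    intro i
    induction i with
    | zero => simp [s]
    | succ i ih =>
      rw [hs]
      simp only [nx]
      split
      · simp; omega
      · simp
  let n : ℕ → ℕ := fun k => k.rec 0 fun k m => m + (l k + 1)
  have hn : ∀ k, n (k + 1) = n k + (l k + 1) := fun k => rfl
  have hsn : ∀ k, s (n k) = (k, 0) := by
    intro k
    induction k with
    | zero => rfl
    | succ k ih =>
      have : ∀ j ≤ l k, s (n k + j) = (k, j) := by
        intro j
        induction j with
        | zero => exact fun _ => ih
        | succ j ihj =>
          intro hj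
          rw [← add_assoc, hs, ihj (by omega)]
          simp only [nx]
          rw [if_pos (by omega)]
      rw [hn, ← add_assoc, hs, this _ le_rfl]
      simp [nx]
  refine ⟨fun i => f (s i).1 (s i).2, n, strictMono_nat_of_lt_succ fun k => by rw [hn]; omega,
    h0 0, fun k => ?_, fun i => ?_⟩
  · simp only [hsn, h0]
  · have := h2 (s i).1 (s i).2 (hle i)
    simp only [hs, nx]
    split
    · exact this
    · next hlt =>
      rw [show (s i).2 = l (s i).1 from le_antisymm (hle i) (not_lt.1 hlt), h1] at this
      simpa [h0, show (s i).2 = l (s i).1 from le_antisymm (hle i) (not_lt.1 hlt)] using this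

theorem exists_run_of_path {A : DCPS} {K : ℕ} {x : ℕ → DConfig} (h0 : x 0 = A.init)
    (hx : ∀ k, Relation.TransGen (RStep A K) (x k, false) (x (k + 1), false))
    (hact : ∀ k, (x k).act = none) :
    ∃ ρ, IsInfRunD A ρ ∧ KBoundedD K ρ ∧ ∀ k, ∃ i, ρ i = x k := by
  obtain ⟨ρ, n, hn, hρ0, hρn, hρ⟩ := exists_infinite_path hx
  refine ⟨fun i => (ρ i).1, ⟨by simp only [hρ0, h0], fun i => ?_, fun i hi => ?_, fun i => ?_⟩,
    fun i => ?_, fun k => ⟨n k, by simp only [hρn]⟩⟩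
  · have := hρ i
    change DStep A (ρ i).1 (ρ (i + 1)).1
    generalize ρ i = s, ρ (i + 1) = s' at this ⊢
    cases this with
    | thread h => exact Or.inl h
    | resume h => exact Or.inr (Or.inr (Or.inl ⟨_, h⟩))
    | swap h => exact Or.inr (Or.inl h)
    | term h => exact Or.inr (Or.inr (Or.inr h))
  · have h1 := hρ i
    have h2 := hρ (i + 1)
    change (ρ i).1.act = none at hi
    change (ρ (i + 1 + 1)).1.act ≠ none
    generalize ρ i = s, ρ (i + 1) = s', ρ (i + 1 + 1) = s'' at h1 h2 hi ⊢
    cases h1 with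
    | thread h =>
      obtain ⟨_, _, _, _, _, _, _, h, _⟩ := h
      exact absurd (hi.symm.trans h) (by simp)
    | resume h =>
      cases h2 with
      | thread h =>
        obtain ⟨_, _, _, _, _, _, _, _, _, h, _⟩ := h
        simp [h]
    | swap h =>
      obtain ⟨_, _, _, _, _, _, h, _⟩ := h
      exact absurd (hi.symm.trans h) (by simp)
    | term h =>
      obtain ⟨_, _, _, h, _⟩ := h
      exact absurd (hi.symm.trans h) (by simp)
  · exact ⟨n i, hn.le_apply, by simp only [hρn, hact]⟩
  · induction i with
    | zero =>
      intro w j h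
      simp [hρ0, hact] at h
    | succ i ih =>
      have := hρ i
      simp only at ih ⊢
      generalize ρ i = s, ρ (i + 1) = s' at this ih ⊢
      intro w j hj
      cases this with
      | thread h =>
        obtain ⟨_, _, _, _, _, _, _, h1, _, h2, _⟩ := h
        simp only at hj
        rw [h2] at hj
        simp only [Option.some.injEq, Prod.mk.injEq] at hj
        exact ih _ _ (by rw [← hj.2]; exact h1)
      | @resume _ _ t h ht =>
        obtain ⟨_, _, _, _, _, _, _, _, _, _, h, _⟩ := h
        simp only at hj
        rw [h] at hj
        simp only [Option.some.injEq] at hj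
        subst hj
        exact ht
      | swap h =>
        obtain ⟨_, _, _, _, _, _, _, _, h, _⟩ := h
        simp [h] at hj
      | term h =>
        obtain ⟨_, _, _, _, _, h, _⟩ := h
        simp [h] at hj

theorem Rule.length_le {a : Sys} {q q1 : TSt} {γ : ℕ} {w : List ℕ} {ls : List Letter}
    (h : Rule a q γ q1 w ls) :
    q1.2.2.length ≤ q.2.2.length ∧ ∀ l ∈ ls, l.1 = q.2.2.length := by
  cases h with
  | create => exact ⟨le_rfl, fun l hl => by obtain ⟨x, -, rfl⟩ := List.mem_map.1 hl; rfl⟩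
  | _ => simp

theorem Run.length_le {a : Sys} {q q' : TSt} {w : List ℕ} {v : List Letter}
    (h : Run a q w v q') : ∀ l ∈ v, l.1 ≤ q.2.2.length := by
  induction h with
  | nil => simp
  | step hr _ ih =>
    intro l hl
    rcases List.mem_append.1 hl with hl | hl
    · exact (hr.length_le.2 l hl).le
    · exact (ih l hl).trans hr.length_le.1

theorem Run.eq_of_nil {a : Sys} {q q' : TSt} {w : List ℕ} {v : List Letter}
    (h : Run a q w v q') (hq : q = (0, 0, [])) : q' = (0, 0, []) := by
  induction h with
  | nil => exact hq
  | step hr _ ih =>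
    subst hq
    cases hr with
    | create h => exact absurd rfl h
    | pop => exact ih rfl

/-- The fresh threads spawned by some letters. -/
def fresh (v : List Letter) : Multiset Loc := (v.map fun l => (([l.2], 0) : Loc) : List Loc)

theorem fresh_append (v v' : List Letter) : fresh (v ++ v') = fresh v + fresh v' := by
  simp [fresh]

theorem fresh_spawnL (n : ℕ) (sp : Option ℕ) : fresh (spawnL n sp) = spawnOf sp := by
  cases sp <;> simp [fresh, spawnL, spawnOf]

theorem Run.exec {A : DCPS} {a : Sys} (hA : Rep A a) {K : ℕ} {q q' : TSt} {w : List ℕ}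
    {v : List Letter} (h : Run a q w v q') {e : Bool} (he : Fin a e q') {m g p r : ℕ} {S : Skel}
    (hq : q = (m, g, (p, r) :: S)) (hm : m ≠ 0) (hm2 : m ≤ 2) (i : ℕ) (M : Multiset Loc) :
    ∃ (v1 v2 : List Letter) (N : Multiset Loc), v = v1 ++ v2 ∧ (∀ l ∈ v1, l.1 = S.length + 1) ∧
      Relation.ReflTransGen (RStep A K) (⟨g, some (w, i), M⟩, decide (m = 1))
        (⟨r, none, M + (N + fresh v1)⟩, false) ∧
      ((∃ w', N = {(w', i + 1)} ∧ Run a (0, 0, S) w' v2 q') ∨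
        (S = [] ∧ e = true ∧ N = 0 ∧ v2 = [])) := by
  induction h generalizing m g M with
  | nil =>
    subst hq
    rcases he with ⟨-, h⟩ | ⟨rfl, g', p', r', h, ht⟩
    · simp at h
    · simp only [Prod.mk.injEq, List.cons.injEq] at h
      obtain ⟨rfl, rfl, ⟨rfl, rfl⟩, rfl⟩ := h
      refine ⟨[], [], 0, rfl, by simp, ?_, Or.inr ⟨rfl, rfl, rfl, rfl⟩⟩
      exact .single (.term ⟨i, r, (hA.tm _).1 ht, rfl, rfl, rfl, by simp [fresh]⟩)
  | @step q q1 q' γ u w ls v hr hrun ih =>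
    subst hq
    cases hr with
    | resume => exact absurd rfl hm
    | @create _ _ _ _ g' _ sp _ hc =>
      obtain ⟨v1, v2, N, rfl, h1, h2, h3⟩ := ih he rfl (by omega) le_rfl (M + spawnOf sp)
      refine ⟨spawnL (S.length + 1) sp ++ v1, v2, N, by simp, fun l hl => ?_, ?_, h3⟩
      · rcases List.mem_append.1 hl with hl | hl
        · obtain ⟨x, -, rfl⟩ := List.mem_map.1 hl
          rfl
        · exact h1 l hl
      · refine .head (.thread (c' := ⟨g', some (u ++ w, i), M + spawnOf sp⟩) ⟨γ, w, i, g', u, sp, (hA.cr _).1 hc, rfl, rfl, rfl, rfl⟩) ?_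
        rw [fresh_append, fresh_spawnL, show M + (N + (spawnOf sp + fresh v1)) =
          M + spawnOf sp + (N + fresh v1) by ac_rfl]
        exact h2
    | swap hc =>
      refine ⟨[], v, {(u ++ w, i + 1)}, rfl, by simp, ?_, Or.inl ⟨_, rfl, hrun⟩⟩
      exact .single (.swap ⟨γ, w, i, r, u, (hA.it _).1 hc, rfl, rfl, rfl, by simp [fresh]⟩)

/-- A thread that can execute the segments to which a token is committed. -/
def TokLoc (a : Sys) (K : ℕ) (x : Tok (List Letter)) (l : Loc) : Prop :=
  Sum.elim (fun γ => l = ([γ], 0)) (fun y => l.2 + y.1.length ≤ K + 1 ∧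
    ∃ v0 v q, y.2.2 = v0 ++ v ∧ (∀ l ∈ v0, y.1.length < l.1) ∧ Run a (0, 0, y.1) l.1 v q ∧
      Fin a y.2.1 q) x

theorem rel_syms {a : Sys} {K n : ℕ} {v : List Letter} (h : ∀ l ∈ v, l.1 = n) :
    Multiset.Rel (TokLoc a K) (syms n v : List (Tok (List Letter))) (fresh v) := by
  rw [syms, List.filter_eq_self.2 (by simpa using fun x y hx => h (x, y) hx), fresh,
    ← Multiset.map_coe, ← Multiset.map_coe, Multiset.rel_map]
  exact Multiset.rel_refl_of_refl_on fun _ _ => rfl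

theorem AStep.exec {A : DCPS} {a : Sys} (hA : Rep A a) {K : ℕ}
    {c c' : ℕ × Multiset (Tok (List Letter))} (h : AStep a K c c') {m : Multiset Loc}
    (hm : Multiset.Rel (TokLoc a K) c.2 m) :
    ∃ m', Relation.ReflTransGen (RStep A K) (⟨c.1, none, m⟩, false) (⟨c'.1, none, m'⟩, false) ∧
      Multiset.Rel (TokLoc a K) c'.2 m' := by
  cases h with
  | @choose S γ v q' e g R hS hrun he =>
    refine ⟨m, .refl, ?_⟩
    simp only [Multiset.singleton_add, Multiset.rel_cons_left] at hm ⊢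
    obtain ⟨l, m1, rfl, h1, h2⟩ := hm
    exact ⟨_, _, ⟨by simpa using hS, [], v, q', rfl, by simp, hrun, he⟩, h1, h2⟩
  | @fire p r S e v R =>
    simp only [Multiset.singleton_add, Multiset.rel_cons_left] at hm
    obtain ⟨⟨w, i⟩, m1, hl, h1, rfl⟩ := hm
    obtain ⟨hi, v0, v', q, rfl, hv0, hrun, he⟩ := hl
    simp only [List.length_cons] at hi hv0 hrun
    cases hrun with
    | nil =>
      rcases he with ⟨-, h⟩ | ⟨-, _, _, _, h, -⟩ <;> simp at h
    | @step _ q1 _ γ u w ls v' hr hrun =>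
      cases hr with
      | create h => exact absurd rfl h
      | @resume _ _ _ g _ hres =>
        obtain ⟨v1, v2, N, rfl, hv1, hstar, hN⟩ :=
          hrun.exec hA (K := K) he rfl (by omega) (by omega) i m1
        refine ⟨m1 + (N + fresh v1), .head (.resume (t := (γ :: w, i))
          ⟨γ, w, i, g, m1, (hA.rs _).1 hres, rfl, rfl, ?_, rfl, rfl, rfl⟩ (by simp; omega)) hstar,
          ?_⟩
        · exact add_comm {(γ :: w, i)} m1
        have hsyms : (syms (S.length + 1) (v0 ++ ([] ++ (v1 ++ v2))) : List (Tok (List Letter))) =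
            syms (S.length + 1) v1 := by
          have h0 : v0.filter (fun x => x.1 = S.length + 1) = [] := by
            simpa using fun x y hx => (hv0 (x, y) hx).ne'
          have h2 : v2.filter (fun x => x.1 = S.length + 1) = [] := by
            rcases hN with ⟨w', -, h⟩ | ⟨-, -, -, rfl⟩
            · simpa using fun x y hx => (Nat.lt_succ_of_le (h.length_le (x, y) hx)).ne
            · rfl
          simp only [syms, List.nil_append, List.filter_append, h0, h2, List.append_nil]
        rw [add_comm m1, ← Multiset.coe_add, hsyms]
        refine Multiset.Rel.add (Multiset.Rel.add ?_ (rel_syms hv1)) h1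
        rcases hN with ⟨w', rfl, hw'⟩ | ⟨rfl, rfl, rfl, rfl⟩
        · have hcond : ¬ (S = [] ∧ e = true) := by
            rintro ⟨rfl, rfl⟩
            rcases he with ⟨h, -⟩ | ⟨-, _, _, _, h, -⟩
            · simp at h
            · simpa [h] using hw'.eq_of_nil rfl
          rw [cont, if_neg hcond]
          refine Multiset.Rel.cons ⟨by simp only; omega, v0 ++ v1, v2, q, by simp, fun l hl => ?_,
            hw', he⟩ .zero
          rcases List.mem_append.1 hl with hl | hl
          · exact (Nat.lt_succ_self _).trans (hv0 l hl)
          · exact (hv1 l hl).symm ▸ Nat.lt_succ_self _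
        · simp [cont]

theorem AStep.exec_star {A : DCPS} {a : Sys} (hA : Rep A a) {K : ℕ}
    {c c' : ℕ × Multiset (Tok (List Letter))} (h : Relation.ReflTransGen (AStep a K) c c')
    {m : Multiset Loc} (hm : Multiset.Rel (TokLoc a K) c.2 m) :
    ∃ m', Relation.ReflTransGen (RStep A K) (⟨c.1, none, m⟩, false) (⟨c'.1, none, m'⟩, false) ∧
      Multiset.Rel (TokLoc a K) c'.2 m' := by
  induction h with
  | refl => exact ⟨m, .refl, hm⟩
  | tail _ h ih =>
    obtain ⟨m1, h1, h2⟩ := ih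
    obtain ⟨m2, h3, h4⟩ := h.exec hA h2
    exact ⟨m2, h1.trans h3, h4⟩

theorem Pump.exists_unbounded {A : DCPS} {a : Sys} (hA : Rep A a) {K : ℕ}
    (h : Pump a K A.g0 A.gamma0) :
    ∃ ρ, IsInfRunD A ρ ∧ KBoundedD K ρ ∧ ∀ B, ∃ i, B < pendCount (ρ i) := by
  obtain ⟨g, c, d, h1, h2, hd⟩ := h
  have hd : 0 < Multiset.card d := Multiset.card_pos.2 hd
  obtain ⟨m0, hm0, hrel0⟩ := AStep.exec_star hA (m := {([A.gamma0], 0)}) h1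
    (Multiset.Rel.cons (r := TokLoc a K) (by exact rfl) .zero)
  have hnext : ∀ (k : ℕ) (m : {m // Multiset.Rel (TokLoc a K) (c + k • d) m}),
      ∃ m' : {m // Multiset.Rel (TokLoc a K) (c + (k + 1) • d) m},
        Relation.ReflTransGen (RStep A K) (⟨g, none, m.1⟩, false) (⟨g, none, m'.1⟩, false) := by
    rintro k ⟨m, hm⟩
    obtain ⟨m', h3, h4⟩ := AStep.exec_star hA (AStep.frame_star h2 (k • d)) hm
    refine ⟨⟨m', ?_⟩, h3⟩
    convert h4 using 1
    rw [succ_nsmul']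
    simp only [add_assoc]
  choose nx hnx using hnext
  let m : ∀ k, {m // Multiset.Rel (TokLoc a K) (c + k • d) m} :=
    fun k => Nat.rec ⟨m0, by simpa using hrel0⟩ (fun k m => nx k m) k
  have hcard : ∀ k, Multiset.card (m k).1 = Multiset.card c + k * Multiset.card d := fun k => by
    rw [← Multiset.card_eq_card_of_rel (m k).2, Multiset.card_add, Multiset.card_nsmul]
  have htrans : ∀ k, Relation.TransGen (RStep A K) (⟨g, none, (m k).1⟩, false)
      (⟨g, none, (m (k + 1)).1⟩, false) := by
    intro k
    refine (Relation.reflTransGen_iff_eq_or_transGen.1 (hnx k (m k))).resolve_left fun h => ?_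
    have := congrArg (fun x : DConfig × Bool => Multiset.card x.1.pend) h
    replace this : Multiset.card (m (k + 1)).1 = Multiset.card (m k).1 := this
    rw [hcard (k + 1), hcard k, add_mul] at this
    omega
  obtain ⟨ρ, hρ, hK, hx⟩ := exists_run_of_path (A := A) (K := K)
    (x := fun k => k.casesOn A.init fun k => ⟨g, none, (m (k + 1)).1⟩) rfl (by
      rintro (_ | k)
      · exact .trans_right hm0 (htrans 0)
      · exact htrans (k + 1)) (by rintro (_ | k) <;> rfl)
  refine ⟨ρ, hρ, hK, fun B => ?_⟩
  obtain ⟨i, hi⟩ := hx (B + 1)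
  refine ⟨i, ?_⟩
  rw [hi]
  simp only [pendCount, hcard]
  nlinarith

end Unbounded

/-! ### Certificates exclude productive loops -/

section Loop

variable {τ : Type} [DecidableEq τ]

/-- Steps of the lossy net with a flag recording productivity. -/
def FStep (Tr : List (Trn τ)) (s s' : (ℕ × Multiset τ) × Bool) : Prop :=
  ∃ t ∈ Tr, Fires t s.1 s'.1 ∧ t.2.2.2 = s'.2

omit [DecidableEq τ] in
theorem Path.exists_flag {Tr : List (Trn τ)} {c c' : ℕ × Multiset τ} {k : ℕ}
    (h : Path Tr c k c') (b : Bool) :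
    ∃ b', Relation.ReflTransGen (FStep Tr) (c, b) (c', b') ∧
      (k ≠ 0 → ∃ d, Relation.TransGen (FStep Tr) (c, b) (d, true) ∧
        Relation.ReflTransGen (FStep Tr) (d, true) (c', b')) := by
  induction h with
  | refl => exact ⟨b, .refl, fun h => absurd rfl h⟩
  | @tail k c1 c2 t _ ht hf ih =>
    obtain ⟨b1, h1, h2⟩ := ih
    have hstep : FStep Tr (c1, b1) (c2, t.2.2.2) := ⟨t, ht, hf, rfl⟩
    refine ⟨t.2.2.2, h1.tail hstep, fun hk => ?_⟩
    by_cases hk0 : k = 0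
    · have hp : t.2.2.2 = true := by
        by_contra hp
        simp [hk0, hp] at hk
      rw [hp] at hstep ⊢
      exact ⟨c2, .tail' h1 hstep, .refl⟩
    · obtain ⟨d, h3, h4⟩ := h2 hk0
      exact ⟨d, h3, h4.tail hstep⟩

omit [DecidableEq τ] in
theorem transGen_flag {Tr : List (Trn τ)} {c : ℕ × Multiset τ} {b b' : Bool}
    {s : (ℕ × Multiset τ) × Bool} (h : Relation.TransGen (FStep Tr) (c, b) s) :
    Relation.TransGen (FStep Tr) (c, b') s := by
  obtain ⟨x, h1, h2⟩ := Relation.TransGen.head'_iff.1 h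
  exact Relation.TransGen.head' h1 h2

theorem Cert.not_loop {Tr : List (Trn τ)} {g0 : ℕ} {c0 : List τ} {M : List (Node τ)}
    {E : List (Edge τ)} (hC : Cert Tr g0 c0 M E) {k l : ℕ} {c : ℕ × Multiset τ}
    (hp : Path Tr (g0, (c0 : Multiset τ)) k c) (h2 : Path Tr c l c) : l = 0 := by
  by_contra hl
  obtain ⟨b0, hp0, -⟩ := hp.exists_flag false
  obtain ⟨b1, -, hd⟩ := h2.exists_flag b0
  obtain ⟨d, hd1, hd2⟩ := hd hl
  have h0 := Relation.TransGen.trans_right hp0 hd1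
  have h1 := Relation.TransGen.trans_right hd2 (transGen_flag (b' := b1) hd1)
  obtain ⟨ρ, n, hn, hρ0, hρn, hρ⟩ := exists_infinite_path
    (x := fun k => if k = 0 then ((g0, (c0 : Multiset τ)), false) else (d, true)) (by
      rintro (_ | k)
      · simpa using h0
      · simpa using h1)
  choose t ht hf hb using hρ
  refine hC.sound (fun i => (ρ i).1) t (by simp only [hρ0, if_true]) ht hf fun i => ?_
  have hlt : i < n (i + 1) := (Nat.lt_succ_self i).trans_le hn.le_apply
  refine ⟨n (i + 1) - 1, by omega, ?_⟩
  rw [hb, Nat.sub_add_cancel (by omega), hρn, if_neg (Nat.succ_ne_zero i)]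

end Loop

/-! ### Decomposition of a run into segments -/

section Segments

/-- The letters of a list of symbols spawned with a skeleton of length `n`. -/
def lab (n : ℕ) (sp : List ℕ) : List Letter := sp.map fun x => (n, x)

/-- The fresh threads of a list of symbols. -/
def spawned (sp : List ℕ) : Multiset Loc := (sp.map fun x => (([x], 0) : Loc) : List Loc)

theorem lab_append_toList (n : ℕ) (sp : List ℕ) (o : Option ℕ) :
    lab n (sp ++ o.toList) = lab n sp ++ spawnL n o := by
  simp [lab, spawnL]

theorem spawned_append_toList (sp : List ℕ) (o : Option ℕ) :
    spawned (sp ++ o.toList) = spawned sp + spawnOf o := by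
  cases o with
  | none => simp [spawned, spawnOf]
  | some x =>
    simp only [spawned, spawnOf, Option.toList_some, List.map_append, ← Multiset.coe_add]
    rfl

/-- Sequences of rule applications. -/
inductive Steps (a : Sys) (q : TSt) (w : List ℕ) : List Letter → TSt → List ℕ → Prop
  | nil : Steps a q w [] q w
  | snoc {v ls : List Letter} {q1 q2 : TSt} {γ : ℕ} {u w1 : List ℕ} : Steps a q w v q1 (γ :: w1) →
      Rule a q1 γ q2 u ls → Steps a q w (v ++ ls) q2 (u ++ w1)

theorem Steps.run {a : Sys} {q q1 q' : TSt} {w w1 : List ℕ} {v v' : List Letter}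
    (h : Steps a q w v q1 w1) (h' : Run a q1 w1 v' q') : Run a q w (v ++ v') q' := by
  induction h generalizing v' with
  | nil => exact h'
  | snoc _ hr ih =>
    rw [List.append_assoc]
    exact ih (.step hr h')

theorem TClosed.steps {a : Sys} {K : ℕ} {Γs : List ℕ} {QS : List TSt} {T : List Entry}
    (hT : TClosed a K Γs QS T) {q q1 : TSt} {w w1 : List ℕ} {v : List Letter}
    (h : Steps a q w v q1 w1) (hq : q ∈ QS) (hw : ∀ x ∈ w, x ∈ Γs) :
    q1 ∈ QS ∧ (∀ x ∈ w1, x ∈ Γs) ∧ ∀ l ∈ v, l.2 ∈ Γs := by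
  induction h with
  | nil => exact ⟨hq, hw, by simp⟩
  | @snoc v ls q1 q2 γ u w1 _ hr ih =>
    obtain ⟨h1, h2, h3⟩ := ih
    obtain ⟨h4, h5, h6, -⟩ := hT.step _ h1 γ (h2 _ List.mem_cons_self) (q2, u, ls) (mem_succs.2 hr)
    refine ⟨h4, fun x hx => ?_, fun l hl => ?_⟩
    · exact (List.mem_append.1 hx).elim (h5 x) fun hx => h2 x (List.mem_cons_of_mem _ hx)
    · exact (List.mem_append.1 hl).elim (h3 l) (h6 l)

/-- Executing a complete segment of a single thread. -/
def Macro (a : Sys) (K : ℕ) (c c' : ℕ × Multiset Loc) : Prop :=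
  ∃ (γ : ℕ) (w : List ℕ) (i : ℕ) (P0 : Multiset Loc) (sp : List ℕ) (N : Multiset Loc),
    c.2 = {(γ :: w, i)} + P0 ∧ i ≤ K ∧ c'.2 = P0 + (N + spawned sp) ∧
    (∃ x ∈ a.2.2.1, x.1 = c.1) ∧ c'.1 ∈ tgts a ∧
    ((∃ w3, N = {(w3, i + 1)} ∧ ∀ S : Skel,
        Steps a (0, 0, (c.1, c'.1) :: S) (γ :: w) (lab (S.length + 1) sp) (0, 0, S) w3) ∨
      (N = 0 ∧ ∃ q', Fin a true q' ∧ Steps a (0, 0, [(c.1, c'.1)]) (γ :: w) (lab 1 sp) q' []))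

theorem exists_macro {A : DCPS} {a : Sys} (hA : Rep A a) {K : ℕ} {ρ : ℕ → DConfig}
    (hρ : IsInfRunD A ρ) (hK : KBoundedD K ρ) {i : ℕ} (hi : (ρ i).act = none) :
    ∃ j > i, (ρ j).act = none ∧ Macro a K ((ρ i).g, (ρ i).pend) ((ρ j).g, (ρ j).pend) ∧
      ∀ l, i ≤ l → l < j → pendCount (ρ l) ≤ Multiset.card (ρ j).pend + 1 := by
  obtain ⟨-, hstep, halt, hinf⟩ := hρ
  have hres : ∃ t, ResumeStep A t (ρ i) (ρ (i + 1)) := by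
    rcases hstep i with ⟨_, _, _, _, _, _, _, h, -⟩ | ⟨_, _, _, _, _, _, h, -⟩ | h | ⟨_, _, _, h, -⟩
    · simp [hi] at h
    · simp [hi] at h
    · exact h
    · simp [hi] at h
  obtain ⟨t, γ, w, i0, p, P0, hr, rfl, -, hP, hg, hact, hpend⟩ := hres
  have hex : ∃ N, (ρ (i + 1 + N)).act = none := by
    obtain ⟨j, hj, h⟩ := hinf (i + 1)
    exact ⟨j - (i + 1), by rwa [Nat.add_sub_cancel' hj]⟩
  classical
  set N := Nat.find hex with hN
  have hNn : (ρ (i + 1 + N)).act = none := Nat.find_spec hex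
  have hmin : ∀ n < N, (ρ (i + 1 + n)).act ≠ none := fun n hn => Nat.find_min hex hn
  have hN0 : N ≠ 0 := fun h => by
    rw [h, add_zero, hact] at hNn
    simp at hNn
  have hN1 : N ≠ 1 := fun h => halt i hi (by rwa [h] at hNn)
  have inv : ∀ n < N, ∃ (w1 : List ℕ) (sp : List ℕ), (ρ (i + 1 + n)).act = some (w1, i0) ∧
      (ρ (i + 1 + n)).pend = P0 + spawned sp ∧
      ∀ (r : ℕ) (S : Skel), Steps a (0, 0, ((ρ i).g, r) :: S) (γ :: w) (lab (S.length + 1) sp)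
        (if n = 0 then 1 else 2, (ρ (i + 1 + n)).g, ((ρ i).g, r) :: S) w1 := by
    intro n hn
    induction n with
    | zero =>
      refine ⟨γ :: w, [], hact, by simpa [spawned] using hpend, fun r S => ?_⟩
      rw [add_zero, hg]
      exact Steps.snoc .nil (.resume ((hA.rs _).2 hr))
    | succ n ih =>
      obtain ⟨w1, sp, h1, h2, h3⟩ := ih (by omega)
      rw [← add_assoc]
      have hne : (ρ (i + 1 + n + 1)).act ≠ none := hmin (n + 1) hn
      rcases hstep (i + 1 + n) with ⟨γ1, w2, i1, g1, u, o, hc, ha1, hg1, ha2, hp⟩ |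
        ⟨_, _, _, _, _, _, _, _, h, _⟩ | ⟨_, _, _, _, _, _, _, _, h, _⟩ | ⟨_, _, _, _, _, h, _⟩
      · rw [h1, Option.some.injEq, Prod.mk.injEq] at ha1
        obtain ⟨rfl, rfl⟩ := ha1
        refine ⟨u ++ w2, sp ++ o.toList, ha2, ?_, fun r S => ?_⟩
        · rw [hp, h2, spawned_append_toList, add_assoc]
        · rw [lab_append_toList, hg1, if_neg (Nat.succ_ne_zero n)]
          refine (h3 r S).snoc ?_
          have := Rule.create (a := a) (m := if n = 0 then 1 else 2) (S := ((ρ i).g, r) :: S)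
            (by split <;> simp) ((hA.cr _).2 hc)
          exact this
      · exact absurd h hne
      · exact absurd h (hmin n (by omega))
      · exact absurd h hne
  have hj : i + 1 + N = i + 1 + (N - 1) + 1 := by omega
  obtain ⟨w1, sp, h1, h2, h3⟩ := inv (N - 1) (by omega)
  have hi0 : i0 ≤ K := hK _ _ _ hact
  have hmono : ∀ m, ∀ n, n + m + 1 = N →
      Multiset.card (ρ (i + 1 + n)).pend ≤ Multiset.card (ρ (i + 1 + (N - 1))).pend := by
    intro m
    induction m with
    | zero =>
      intro n hn
      obtain rfl : n = N - 1 := by omega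
      exact le_rfl
    | succ m ih =>
      intro n hn
      refine le_trans ?_ (ih (n + 1) (by omega))
      have hne : (ρ (i + 1 + n + 1)).act ≠ none := hmin (n + 1) (by omega)
      rcases hstep (i + 1 + n) with ⟨_, _, _, _, _, _, _, _, _, _, hp⟩ |
        ⟨_, _, _, _, _, _, _, _, h, _⟩ | ⟨_, _, _, _, _, _, _, _, h, _⟩ | ⟨_, _, _, _, _, h, _⟩
      · rw [← add_assoc, hp]
        simp
      · exact absurd h hne
      · exact absurd h (hmin n (by omega))
      · exact absurd h hne
  have hcard : Multiset.card (ρ (i + 1 + (N - 1))).pend ≤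
      Multiset.card (ρ (i + 1 + N)).pend →
      ∀ l, i ≤ l → l < i + 1 + N → pendCount (ρ l) ≤ Multiset.card (ρ (i + 1 + N)).pend + 1 := by
    intro hle l hl hlN
    obtain rfl | hl := hl.eq_or_lt
    · have e := hmono (N - 1) 0 (by omega)
      rw [add_zero, hpend] at e
      simp only [pendCount, hi, hP, Multiset.card_add, Multiset.card_singleton]
      omega
    · have e := hmono (N - 1 - (l - (i + 1))) (l - (i + 1)) (by omega)
      rw [Nat.add_sub_cancel' hl] at e
      simp only [pendCount]
      split <;> omega
  refine ⟨i + 1 + N, by omega, hNn, ?_⟩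
  have hP' : (ρ i).pend = {(γ :: w, i0)} + P0 := by rw [hP, add_comm]
  rw [if_neg (show N - 1 ≠ 0 by omega)] at h3
  rw [hj] at hNn hcard ⊢
  rcases hstep (i + 1 + (N - 1)) with ⟨_, _, _, _, _, _, _, _, _, h, _⟩ |
    ⟨γ1, w2, i1, g1, u, hc, ha1, hg1, ha2, hp⟩ | ⟨_, _, _, _, _, _, _, _, h, _⟩ |
    ⟨i1, g1, hc, ha1, hg1, ha2, hp⟩
  · rw [hNn] at h
    simp at h
  · rw [h1, Option.some.injEq, Prod.mk.injEq] at ha1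
    obtain ⟨rfl, rfl⟩ := ha1
    refine ⟨⟨γ, w, i0, P0, sp, {(u ++ w2, i0 + 1)}, hP', hi0, ?_, ⟨_, (hA.rs _).2 hr, rfl⟩, ?_,
      Or.inl ⟨_, rfl, fun S => ?_⟩⟩, hcard (by rw [hp]; simp)⟩
    · simp only
      rw [hp, h2, add_assoc, add_comm (spawned sp)]
    · simp only [tgts, hg1]
      exact List.mem_append_left _ (List.mem_map.2 ⟨_, (hA.it _).2 hc, rfl⟩)
    · have := (h3 g1 S).snoc (.swap ((hA.it _).2 hc))
      simpa only [hg1, List.append_nil] using this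
  · rw [h1] at h
    simp at h
  · rw [h1, Option.some.injEq, Prod.mk.injEq] at ha1
    obtain ⟨rfl, rfl⟩ := ha1
    refine ⟨⟨γ, w, i0, P0, sp, 0, hP', hi0, ?_, ⟨_, (hA.rs _).2 hr, rfl⟩, ?_,
      Or.inr ⟨rfl, _, Or.inr ⟨rfl, _, (ρ i).g, _, rfl, (hA.tm _).2 hc⟩, ?_⟩⟩, hcard (by rw [hp])⟩
    · simp only
      rw [hp, h2, zero_add]
    · simp only [tgts, hg1]
      exact List.mem_append_right _ (List.mem_map.2 ⟨_, (hA.tm _).2 hc, rfl⟩)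
    · simp only [hg1]
      exact h3 g1 []

end Segments

/-! ### Symbolic simulation of runs -/

section Simulation

theorem rel_singleton_add {α β : Type*} {r : α → β → Prop} {x : α} {s : Multiset α}
    {t : Multiset β} :
    Multiset.Rel r ({x} + s) t ↔ ∃ y t', r x y ∧ Multiset.Rel r s t' ∧ t = {y} + t' := by
  simp only [Multiset.singleton_add, Multiset.rel_cons_left]

theorem rel_singleton_left {α β : Type*} {r : α → β → Prop} {x : α} {t : Multiset β} :
    Multiset.Rel r {x} t ↔ ∃ y, r x y ∧ t = {y} := by
  rw [← add_zero ({x} : Multiset α), rel_singleton_add]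
  simp [Multiset.rel_zero_left]

/-- A thread annotated with its future execution. -/
abbrev Ann : Type := Loc × (Skel × Bool × List Letter)

variable {a : Sys} {K : ℕ} {Γs : List ℕ} {QS : List TSt} {T : List Entry}

/-- The annotation of a thread is an actual execution. -/
def Anno (a : Sys) (K : ℕ) (Γs : List ℕ) (QS : List TSt) (l : Loc) (z : Ann) : Prop :=
  z.1 = l ∧ (∀ x ∈ l.1, x ∈ Γs) ∧ l.2 + z.2.1.length ≤ K + 1 ∧ (0, 0, z.2.1) ∈ QS ∧
    ∃ q, Run a (0, 0, z.2.1) l.1 z.2.2.2 q ∧ Fin a z.2.2.1 q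

/-- A token represents an annotated thread. -/
def SR (Γs : List ℕ) (T : List Entry) (z : Ann) (x : Tok Entry) : Prop :=
  (∃ t ∈ T, x = .inr (z.2.1, z.2.2.1, t) ∧ z.2.1 ∈ t.1.1.2.2.tails ∧
    ∀ p : Letter, p.1 ≤ z.2.1.length → Vec.val (z.2.2.2, []) p ≤ t.2.val p) ∨
  ∃ γ ∈ Γs, x = .inl γ ∧ z.1 = ([γ], 0)

theorem rel_anno_nil (hT : TClosed a K Γs QS T) {P : Multiset Loc}
    (hP : ∀ l ∈ P, (∀ x ∈ l.1, x ∈ Γs) ∧ l.2 ≤ K + 1) :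
    Multiset.Rel (Anno a K Γs QS) P (P.map fun l => (l, [], false, [])) := by
  rw [Multiset.rel_map_right]
  refine Multiset.rel_refl_of_refl_on fun l hl => ⟨rfl, (hP l hl).1, by simpa using (hP l hl).2,
    hT.nil_mem, (0, 0, []), ?_, Or.inl ⟨rfl, rfl⟩⟩
  induction l.1 with
  | nil => exact .nil
  | cons b w ih => exact .step .pop ih

theorem rel_spawned {sp : List ℕ} (hsp : ∀ x ∈ sp, x ∈ Γs) {Z : Multiset Ann}
    (h : Multiset.Rel (Anno a K Γs QS) (spawned sp) Z) :
    Multiset.Rel (SR Γs T) Z (sp.map fun x => (.inl x : Tok Entry) : List (Tok Entry)) := by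
  induction sp generalizing Z with
  | nil =>
    simp only [spawned, List.map_nil, Multiset.coe_nil, Multiset.rel_zero_left] at h
    simp [h]
  | cons x sp ih =>
    simp only [spawned, List.map_cons, ← Multiset.cons_coe, Multiset.rel_cons_left] at h
    obtain ⟨z, Z, hz, hZ, rfl⟩ := h
    rw [List.map_cons, ← Multiset.cons_coe]
    exact .cons (Or.inr ⟨x, hsp x List.mem_cons_self, rfl, hz.1⟩)
      (ih (fun y hy => hsp y (List.mem_cons_of_mem _ hy)) hZ)

/-- The execution of the resumed thread, obtained from that of its remainder. -/
theorem Macro.annotate (hT : TClosed a K Γs QS T) {c c' : ℕ × Multiset Loc} {γ : ℕ} {w : List ℕ}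
    {i : ℕ} {sp : List ℕ} {N : Multiset Loc} {Z : Multiset Ann} (hiK : i ≤ K)
    (h : (∃ w3, N = {(w3, i + 1)} ∧ ∀ S : Skel,
        Steps a (0, 0, (c.1, c'.1) :: S) (γ :: w) (lab (S.length + 1) sp) (0, 0, S) w3) ∨
      (N = 0 ∧ ∃ q', Fin a true q' ∧ Steps a (0, 0, [(c.1, c'.1)]) (γ :: w) (lab 1 sp) q' []))
    (hZ : Multiset.Rel (Anno a K Γs QS) N Z) :
    ∃ (S : Skel) (e : Bool) (v : List Letter) (q' : TSt), (0, 0, S) ∈ QS ∧ i + S.length ≤ K ∧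
      Run a (0, 0, (c.1, c'.1) :: S) (γ :: w) (lab (S.length + 1) sp ++ v) q' ∧ Fin a e q' ∧
      ∀ t ∈ T, S ∈ t.1.1.2.2.tails →
        (∀ p : Letter, p.1 ≤ S.length → Vec.val (v, []) p ≤ t.2.val p) →
        Multiset.Rel (SR Γs T) Z (cont S e t : List (Tok Entry)) := by
  rcases h with ⟨w3, rfl, h⟩ | ⟨rfl, q', hq', h⟩
  · rw [rel_singleton_left] at hZ
    obtain ⟨⟨l, S, e, v⟩, ⟨rfl, h1, h2, h3, q', h4, h5⟩, rfl⟩ := hZ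
    simp only at h1 h2 h3 h4 h5
    refine ⟨S, e, v, q', h3, by omega, (h S).run h4, h5, fun t ht hS hle => ?_⟩
    rw [cont, if_neg, Multiset.coe_singleton, rel_singleton_left]
    · exact ⟨_, Or.inl ⟨t, ht, rfl, hS, hle⟩, rfl⟩
    · rintro ⟨rfl, rfl⟩
      have := h4.eq_of_nil rfl
      subst this
      rcases h5 with ⟨h5, -⟩ | ⟨-, _, _, _, h5, -⟩ <;> simp at h5
  · rw [Multiset.rel_zero_left] at hZ
    subst hZ
    refine ⟨[], true, [], q', hT.nil_mem, by simpa using hiK, h.run .nil, hq', fun t _ _ _ => ?_⟩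
    simp [cont]

theorem count_lab (n y : ℕ) (sp : List ℕ) :
    Multiset.count (n, y) (lab n sp : Multiset Letter) = Multiset.count y (sp : Multiset ℕ) := by
  rw [lab, ← Multiset.map_coe]
  exact Multiset.count_map_eq_count' _ _ (Prod.mk_right_injective n) y

/-- Executing the next segment of a committed token. -/
theorem fire_path {Tr : List (Trn (Tok Entry))} (hTr : ∀ t, NetTr a K Γs T t → t ∈ Tr)
    {p r : ℕ} {S : Skel} {e : Bool} {t : Entry} (ht : t ∈ T) (hS : (p, r) :: S ∈ t.1.1.2.2.tails)
    {sp : List ℕ} {v : List Letter}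
    (hle : ∀ x : Letter, x.1 ≤ S.length + 1 →
      Vec.val (lab (S.length + 1) sp ++ v, []) x ≤ t.2.val x) (R : Multiset (Tok Entry)) :
    Path Tr (p, {.inr ((p, r) :: S, e, t)} + R) 0
      (r, R + (Multiset.ofList (cont S e t) +
        Multiset.ofList (sp.map fun x => (.inl x : Tok Entry)))) := by
  have h := Path.tail (Path.refl (Tr := Tr) (c := (p, {.inr ((p, r) :: S, e, t)} + R)))
    (hTr _ (.fire (e := e) ht hS))
    (c'' := (r, R + (Multiset.ofList (cont S e t) +
        Multiset.ofList (sp.map fun x => (.inl x : Tok Entry))))) ?_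
  · exact h
  classical
  set X : Multiset (Tok Entry) := Multiset.ofList (sp.map fun x => (.inl x : Tok Entry)) with hX
  refine ⟨by simp [ctl], R, _, X.filter fun x => x ∈ syms (S.length + 1) t.2.2, rfl, rfl, ?_, ?_⟩
  · rw [← Multiset.coe_add, add_assoc]
    refine add_le_add_right ?_ _
    rw [Multiset.le_iff_count]
    intro x
    rw [Multiset.count_add, Multiset.count_filter]
    split
    · omega
    · next hx =>
      rw [add_zero]
      rcases x with y | y
      · rw [count_inl_syms]
        rw [mem_syms] at hx
        have h1 : Multiset.count (.inl y) X =
            Multiset.count (S.length + 1, y) (lab (S.length + 1) sp : Multiset Letter) := by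
          rw [count_lab, hX, ← Multiset.map_coe]
          exact Multiset.count_map_eq_count' _ _ Sum.inl_injective y
        have h2 := hle (S.length + 1, y) le_rfl
        rw [Vec.val_coe] at h2
        rw [Vec.val, if_neg hx, ← Multiset.coe_count, ← Multiset.coe_add, Multiset.count_add] at h2
        norm_cast at h2
        omega
      · refine (Multiset.count_eq_zero.2 fun hy => ?_).trans_le (Nat.zero_le _)
        simp [hX] at hy
  · intro x hx
    exact (Multiset.mem_filter.1 hx).2

theorem Macro.simulate (hT : TClosed a K Γs QS T) {Tr : List (Trn (Tok Entry))}
    (hTr : ∀ t, NetTr a K Γs T t → t ∈ Tr) {c c' : ℕ × Multiset Loc} (h : Macro a K c c')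
    (hc : ∀ l ∈ c.2, ∀ x ∈ l.1, x ∈ Γs) {Z' : Multiset Ann}
    (hZ' : Multiset.Rel (Anno a K Γs QS) c'.2 Z') :
    ∃ Z, Multiset.Rel (Anno a K Γs QS) c.2 Z ∧ ∀ B, Multiset.Rel (SR Γs T) Z B →
      ∃ B', Multiset.Rel (SR Γs T) Z' B' ∧ Path Tr (c.1, B) 0 (c'.1, B') := by
  obtain ⟨γ, w, i, P0, sp, N, h1, hi, h2, ⟨⟨p, g, γ'⟩, hx, hp⟩, htgt, h3⟩ := h
  rw [h2, Multiset.rel_add_left] at hZ'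
  obtain ⟨Z0, Z'', hZ0, hZ'', rfl⟩ := hZ'
  rw [Multiset.rel_add_left] at hZ''
  obtain ⟨ZN, Zs, hZN, hZs, rfl⟩ := hZ''
  obtain ⟨S, e, v, q', hS, hSK, hrun, hfin, hcont⟩ := Macro.annotate hT hi h3 hZN
  have hw : ∀ x ∈ γ :: w, x ∈ Γs := hc (γ :: w, i) (by simp [h1])
  have hq : ∀ S : Skel, (0, 0, S) ∈ QS → S.length ≤ K → (0, 0, (c.1, c'.1) :: S) ∈ QS := by
    intro S hS hSK
    rcases hT.skel _ hS with h | h | h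
    · simp at h
    · simp only at h
      omega
    · have := h _ hx _ htgt
      rwa [hp] at this
  have hsp : ∀ x ∈ sp, x ∈ Γs := by
    intro x hx
    rcases h3 with ⟨w3, -, h⟩ | ⟨-, q1, -, h⟩
    · exact (hT.steps (h S) (hq S hS (by omega)) hw).2.2 (S.length + 1, x)
        (List.mem_map_of_mem hx)
    · exact (hT.steps h (hq [] hT.nil_mem (by simp)) hw).2.2 (1, x) (List.mem_map_of_mem hx)
  set v' := lab (S.length + 1) sp ++ v with hv'
  refine ⟨{((γ :: w, i), (c.1, c'.1) :: S, e, v')} + Z0, ?_, fun B hB => ?_⟩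
  · rw [h1, rel_singleton_add]
    exact ⟨_, _, ⟨rfl, hw, by simp only [List.length_cons]; omega, hq S hS (by omega), q', hrun,
      hfin⟩, hZ0, rfl⟩
  rw [rel_singleton_add] at hB
  obtain ⟨x, B0, hx, hB0, rfl⟩ := hB
  have key : ∀ t ∈ T, (c.1, c'.1) :: S ∈ t.1.1.2.2.tails →
      (∀ x : Letter, x.1 ≤ S.length + 1 → Vec.val (v', []) x ≤ t.2.val x) →
      ∃ B', Multiset.Rel (SR Γs T) (Z0 + (ZN + Zs)) B' ∧
        Path Tr (c.1, {.inr ((c.1, c'.1) :: S, e, t)} + B0) 0 (c'.1, B') := by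
    intro t ht hSt hle
    refine ⟨_, ?_, fire_path hTr ht hSt hle B0⟩
    refine hB0.add (.add (hcont t ht ?_ fun p hp => ?_) (rel_spawned hsp hZs))
    · rw [List.mem_tails] at hSt ⊢
      exact (List.suffix_cons _ _).trans hSt
    · refine le_trans ?_ (hle p (by omega))
      simp only [Vec.val, hv', List.not_mem_nil, if_false, List.count_append]
      exact_mod_cast Nat.le_add_left _ _
  rcases hx with ⟨t, ht, rfl, hSt, hle⟩ | ⟨γ1, hγ1, rfl, hx⟩
  · exact key t ht hSt fun x hx => hle x (by simpa using hx)
  · simp only [Prod.mk.injEq, List.cons.injEq] at hx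
    obtain ⟨⟨rfl, rfl⟩, rfl⟩ := hx
    obtain ⟨u, hu, hle⟩ := hT.run_single hrun (hq S hS (by omega)) hγ1
    obtain ⟨B', hB', hpath⟩ := key _ hu (by simp) fun x _ => hle x
    refine ⟨B', hB', ?_⟩
    have h := Path.tail (Path.refl (Tr := Tr) (c := (c.1, {.inl γ} + B0)))
      (hTr _ (.choose (e := e) hu (by simp only [List.length_cons]; omega) hfin))
      (c'' := (c.1, {.inr ((c.1, c'.1) :: S, e, (((0, 0, (c.1, c'.1) :: S), γ, q'), u))} + B0))
      ⟨by simp [ctl], B0, _, 0, rfl, add_comm _ _, by simp, by simp⟩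
    exact h.trans hpath

theorem Macro.closed (hT : TClosed a K Γs QS T) {c c' : ℕ × Multiset Loc} (h : Macro a K c c')
    (hc : ∀ l ∈ c.2, (∀ x ∈ l.1, x ∈ Γs) ∧ l.2 ≤ K + 1) :
    ∀ l ∈ c'.2, (∀ x ∈ l.1, x ∈ Γs) ∧ l.2 ≤ K + 1 := by
  obtain ⟨γ, w, i, P0, sp, N, h1, hi, h2, ⟨⟨p, g, γ'⟩, hx, hp⟩, htgt, h3⟩ := h
  have hw : ∀ x ∈ γ :: w, x ∈ Γs := (hc (γ :: w, i) (by simp [h1])).1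
  have hq : (0, 0, [(c.1, c'.1)]) ∈ QS := by
    rcases hT.skel _ hT.nil_mem with h | h | h
    · simp at h
    · simp at h
    · have := h _ hx _ htgt
      rwa [hp] at this
  have hsp : (∀ x ∈ sp, x ∈ Γs) ∧ ∀ l ∈ N, (∀ x ∈ l.1, x ∈ Γs) ∧ l.2 ≤ K + 1 := by
    rcases h3 with ⟨w3, rfl, h⟩ | ⟨rfl, q1, -, h⟩
    · obtain ⟨-, h4, h5⟩ := hT.steps (h []) hq hw
      refine ⟨fun x hx => h5 (1, x) (List.mem_map_of_mem hx), fun l hl => ?_⟩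
      rw [Multiset.mem_singleton] at hl
      subst hl
      exact ⟨h4, by simpa using hi⟩
    · exact ⟨fun x hx => (hT.steps h hq hw).2.2 (1, x) (List.mem_map_of_mem hx), by simp⟩
  intro l hl
  rw [h2, Multiset.mem_add, Multiset.mem_add] at hl
  rcases hl with hl | hl | hl
  · exact hc l (by rw [h1]; exact Multiset.mem_add.2 (Or.inr hl))
  · exact hsp.2 l hl
  · obtain ⟨x, hx, rfl⟩ := List.mem_map.1 (Multiset.mem_coe.1 hl)
    exact ⟨by simpa using hsp.1 x hx, by simp⟩

theorem exists_symbolic (hT : TClosed a K Γs QS T) {Tr : List (Trn (Tok Entry))}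
    (hTr : ∀ t, NetTr a K Γs T t → t ∈ Tr) (n : ℕ) {c : ℕ → ℕ × Multiset Loc}
    (h : ∀ k, Macro a K (c k) (c (k + 1)))
    (hc : ∀ k, ∀ l ∈ (c k).2, (∀ x ∈ l.1, x ∈ Γs) ∧ l.2 ≤ K + 1) :
    ∃ Z, Multiset.Rel (Anno a K Γs QS) (c 0).2 Z ∧ ∀ B, Multiset.Rel (SR Γs T) Z B →
      ∃ α : ℕ → Multiset (Tok Entry), α 0 = B ∧
        (∀ j < n, Path Tr ((c j).1, α j) 0 ((c (j + 1)).1, α (j + 1))) ∧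
        ∀ j ≤ n, ∃ Z, Multiset.Rel (Anno a K Γs QS) (c j).2 Z ∧ Multiset.Rel (SR Γs T) Z (α j) := by
  induction n generalizing c with
  | zero =>
    have hZ := rel_anno_nil hT (hc 0)
    refine ⟨_, hZ, fun B hB => ⟨fun _ => B, rfl, by simp, fun j hj => ?_⟩⟩
    obtain rfl : j = 0 := by omega
    exact ⟨_, hZ, hB⟩
  | succ n ih =>
    obtain ⟨Z', hZ', hsim⟩ := ih (c := fun k => c (k + 1)) (fun k => h (k + 1))
      fun k => hc (k + 1)
    obtain ⟨Z, hZ, hback⟩ := (h 0).simulate hT hTr (fun l hl => (hc 0 l hl).1) hZ'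
    refine ⟨Z, hZ, fun B hB => ?_⟩
    obtain ⟨B', hB', hpath⟩ := hback B hB
    obtain ⟨α, hα0, hα1, hα2⟩ := hsim B' hB'
    refine ⟨fun j => Nat.casesOn j B α, rfl, fun j hj => ?_, fun j hj => ?_⟩
    · cases j with
      | zero =>
        simp only [hα0]
        exact hpath
      | succ j => exact hα1 j (by omega)
    · cases j with
      | zero => exact ⟨Z, hZ, hB⟩
      | succ j => exact hα2 j (by omega)

end Simulation

/-! ### Certificates imply boundedness of all runs -/

section Compactness

theorem exists_limit {β : Type*} {R : ℕ → β → β → Prop} {F : ℕ → Set β}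
    (hF : ∀ j, (F j).Finite) {b : β}
    (h : ∀ n, ∃ α : ℕ → β, α 0 = b ∧ (∀ j < n, R j (α j) (α (j + 1))) ∧ ∀ j ≤ n, α j ∈ F j) :
    ∃ α : ℕ → β, α 0 = b ∧ (∀ j, R j (α j) (α (j + 1))) ∧ ∀ j, α j ∈ F j := by
  choose f h0 h1 h2 using h
  have hlim : ∀ j, ∃ x ∈ F j, ∀ᶠ n in (Filter.hyperfilter ℕ : Filter ℕ), f n j = x := fun j =>
    (Ultrafilter.eventually_exists_mem_iff (hF j)).1
      (Filter.Eventually.mono (Nat.hyperfilter_le_atTop (Filter.eventually_ge_atTop j))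
        fun n hn => ⟨_, h2 n j hn, rfl⟩)
  choose α hα hlim using hlim
  refine ⟨α, ?_, fun j => ?_, hα⟩
  · obtain ⟨n, hn⟩ := (hlim 0).exists
    rw [← hn, h0]
  · have hgt : ∀ᶠ n in (Filter.hyperfilter ℕ : Filter ℕ), j < n :=
      Nat.hyperfilter_le_atTop (Filter.eventually_gt_atTop j)
    obtain ⟨n, hn, hn', hlt⟩ := ((hlim j).and ((hlim (j + 1)).and hgt)).exists
    rw [← hn, ← hn']
    exact h1 n j hlt

theorem finite_multisets {β : Type*} (l : List β) (n : ℕ) :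
    {m : Multiset β | Multiset.card m = n ∧ ∀ x ∈ m, x ∈ l}.Finite := by
  classical
  refine (Multiset.finite_toSet (Multiset.powerset (n • (l : Multiset β)))).subset ?_
  rintro m ⟨rfl, hm⟩
  refine Multiset.mem_powerset.2 (Multiset.le_iff_count.2 fun x => ?_)
  by_cases hx : x ∈ m
  · rw [Multiset.count_nsmul]
    have h1 : 0 < Multiset.count x (l : Multiset β) := Multiset.count_pos.2 (hm x hx)
    exact (Multiset.count_le_card x m).trans (Nat.le_mul_of_pos_right _ h1)
  · simp [Multiset.count_eq_zero_of_notMem hx]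

theorem path_drop {τ : Type} {Tr : List (Trn τ)} (g : ℕ) (c D : Multiset τ)
    (hD : ∀ x ∈ D, ((none, [x], ([], []), true) : Trn τ) ∈ Tr) :
    Path Tr (g, c + D) (Multiset.card D) (g, c) := by
  induction D using Multiset.induction with
  | empty => simpa using .refl
  | cons x D ih =>
    have h := Path.tail (Path.refl (Tr := Tr) (c := (g, c + x ::ₘ D)))
      (hD x (Multiset.mem_cons_self x D)) (c'' := (g, c + D))
      ⟨by simp [ctl], c + D, 0, 0, by simp, by simp, by simp, by simp⟩
    have h' := h.trans (ih fun y hy => hD y (Multiset.mem_cons_of_mem hy))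
    rw [Multiset.card_cons, add_comm (Multiset.card D)]
    simpa using h'

theorem Path.of_chain {τ : Type} {Tr : List (Trn τ)} {x : ℕ → ℕ × Multiset τ}
    (h : ∀ j, Path Tr (x j) 0 (x (j + 1))) {i j : ℕ} (hij : i ≤ j) : Path Tr (x i) 0 (x j) := by
  induction j, hij using Nat.le_induction with
  | base => exact .refl
  | succ j _ ih => exact ih.trans (h j)

theorem Cert.card_bounded {τ : Type} [DecidableEq τ] {Tr : List (Trn τ)} {g0 : ℕ} {c0 : List τ}
    {M : List (Node τ)} {E : List (Edge τ)} (hC : Cert Tr g0 c0 M E) {g : ℕ → ℕ}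
    {α : ℕ → Multiset τ} (hg : (Set.range g).Finite) (hg0 : g 0 = g0) (hα0 : α 0 = (c0 : Multiset τ))
    (h : ∀ j, Path Tr (g j, α j) 0 (g (j + 1), α (j + 1)))
    (hd : ∀ j, ∀ x ∈ α j, ((none, [x], ([], []), true) : Trn τ) ∈ Tr) :
    ∃ B, ∀ j, Multiset.card (α j) ≤ B := by
  by_contra! hub
  have hnext : ∀ m, ∃ k > m, Multiset.card (α m) < Multiset.card (α k) := by
    intro m
    obtain ⟨k, hk⟩ := hub ((Finset.range (m + 1)).sup fun j => Multiset.card (α j))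
    have hle : ∀ j ≤ m, Multiset.card (α j) < Multiset.card (α k) := fun j hj =>
      (Finset.le_sup (f := fun j => Multiset.card (α j))
        (Finset.mem_range.2 (Nat.lt_succ_of_le hj))).trans_lt hk
    refine ⟨k, ?_, hle m le_rfl⟩
    by_contra hn
    exact (hle k (by omega)).false
  choose nx hnx hcard using hnext
  let s : ℕ → ℕ := fun n => nx^[n] 0
  have hs : StrictMono s := strictMono_nat_of_lt_succ fun n => by
    simp only [s, Function.iterate_succ_apply']
    exact hnx _
  have hsc : StrictMono fun n => Multiset.card (α (s n)) := strictMono_nat_of_lt_succ fun n => by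
    simp only [s, Function.iterate_succ_apply']
    exact hcard _
  let toks : Finset τ := (Tr.flatMap fun t => t.2.1).toFinset
  have htoks : ∀ j, ∀ x ∈ α j, x ∈ toks := fun j x hx =>
    List.mem_toFinset.2 (List.mem_flatMap.2 ⟨_, hd j x hx, by simp⟩)
  obtain ⟨f, hf⟩ := WellQuasiOrdered.exists_monotone_subseq
    (wellQuasiOrdered_le (α := {x // x ∈ toks} → ℕ)) fun n x => (α (s n)).count x.1
  have := hg.to_subtype
  obtain ⟨i, j, hij, heq⟩ := Finite.exists_ne_map_eq_of_infinite
    fun n => (⟨g (s (f n)), _, rfl⟩ : Set.range g)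
  wlog hlt : i < j generalizing i j
  · exact this j i hij.symm heq.symm (by omega)
  replace heq : g (s (f i)) = g (s (f j)) := congrArg Subtype.val heq
  have hfl : f i < f j := f.strictMono hlt
  have hle : α (s (f i)) ≤ α (s (f j)) := by
    rw [Multiset.le_iff_count]
    intro x
    by_cases hx : x ∈ toks
    · exact hf i j hlt.le ⟨x, hx⟩
    · rw [Multiset.count_eq_zero_of_notMem fun h => hx (htoks _ x h)]
      exact Nat.zero_le _
  obtain ⟨D, hD⟩ := Multiset.le_iff_exists_add.1 hle
  have h1 := Path.of_chain (x := fun j => (g j, α j)) h (Nat.zero_le (s (f i)))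
  have h2 := Path.of_chain (x := fun j => (g j, α j)) h (hs hfl).le
  simp only [hg0, hα0, ← heq] at h1 h2
  have h3 := path_drop (Tr := Tr) (g (s (f i))) (α (s (f i))) D fun x hx =>
    hd (s (f j)) x (by rw [hD]; exact Multiset.mem_add.2 (Or.inr hx))
  rw [← hD] at h3
  have h4 := hC.not_loop h1 (h2.trans h3)
  have h5 : Multiset.card (α (s (f i))) < Multiset.card (α (s (f j))) := hsc hfl
  rw [hD, Multiset.card_add] at h5
  omega

theorem Rep.exists_segments {A : DCPS} {a : Sys} (hA : Rep A a) {K : ℕ} {ρ : ℕ → DConfig}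
    (hρ : IsInfRunD A ρ) (hK : KBoundedD K ρ) :
    ∃ c : ℕ → ℕ × Multiset Loc, c 0 = (A.g0, {([A.gamma0], 0)}) ∧
      (∀ k, Macro a K (c k) (c (k + 1))) ∧
      ∀ l, ∃ k, pendCount (ρ l) ≤ Multiset.card (c k).2 + 1 := by
  choose nx hnx hact hmac hcnt using fun (i : {i // (ρ i).act = none}) =>
    exists_macro hA hρ hK i.2
  let s : ℕ → {i // (ρ i).act = none} := fun k =>
    (fun i => ⟨nx i, hact i⟩)^[k] ⟨0, by rw [hρ.1]; rfl⟩
  have hs : ∀ k, s (k + 1) = ⟨nx (s k), hact (s k)⟩ := fun k => Function.iterate_succ_apply' _ _ _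
  refine ⟨fun k => ((ρ (s k)).g, (ρ (s k)).pend), ?_, fun k => ?_, fun l => ?_⟩
  · simp only [s, Function.iterate_zero, id, hρ.1]
    rfl
  · simp only [hs]
    exact hmac (s k)
  · have hmono : StrictMono fun k => (s k : ℕ) := strictMono_nat_of_lt_succ fun k => by
      rw [hs]
      exact hnx (s k)
    have hex : ∃ k, l < s (k + 1) :=
      ⟨l, (Nat.lt_succ_self l).trans_le hmono.le_apply⟩
    obtain ⟨m, hlt, hle⟩ : ∃ m, l < s (m + 1) ∧ s m ≤ l := by
      classical
      refine ⟨Nat.find hex, Nat.find_spec hex, ?_⟩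
      rcases hk : Nat.find hex with _ | k
      · exact Nat.zero_le _
      · have := Nat.find_min hex (m := k) (by omega)
        omega
    refine ⟨m + 1, ?_⟩
    rw [hs] at hlt
    simp only [hs]
    exact hcnt _ l hle hlt

theorem Bdd.bounded {A : DCPS} {a : Sys} (hA : Rep A a) {K : ℕ} (h : Bdd a K A.g0 A.gamma0)
    {ρ : ℕ → DConfig} (hρ : IsInfRunD A ρ) (hK : KBoundedD K ρ) :
    ∃ B, ∀ i, pendCount (ρ i) ≤ B := by
  obtain ⟨Γs, QS, T, Tr, M, E, hγ0, hT, hTr, hC⟩ := h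
  obtain ⟨c, hc0, hmac, hcnt⟩ := hA.exists_segments hρ hK
  have hclosed : ∀ k, ∀ l ∈ (c k).2, (∀ x ∈ l.1, x ∈ Γs) ∧ l.2 ≤ K + 1 := by
    intro k
    induction k with
    | zero =>
      rw [hc0]
      intro l hl
      rw [Multiset.mem_singleton] at hl
      subst hl
      simpa using hγ0
    | succ k ih => exact (hmac k).closed hT ih
  have hdrop : ∀ {Z : Multiset Ann} {B : Multiset (Tok Entry)}, Multiset.Rel (SR Γs T) Z B →
      ∀ x ∈ B, ((none, [x], ([], []), true) : Trn (Tok Entry)) ∈ Tr := by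
    intro Z B hB x hx
    obtain ⟨z, -, ⟨t, ht, rfl, hS, -⟩ | ⟨γ, hγ, rfl, -⟩⟩ :=
      Multiset.exists_mem_of_rel_of_mem (Multiset.rel_flip.2 hB) hx
    · exact hTr _ (.drop_com ht hS)
    · exact hTr _ (.drop_sym hγ)
  have hfin : ∀ j, {m : Multiset (Tok Entry) | Multiset.card m = Multiset.card (c j).2 ∧
      ∀ x ∈ m, ((none, [x], ([], []), true) : Trn (Tok Entry)) ∈ Tr}.Finite := fun j =>
    (finite_multisets (Tr.flatMap fun t => t.2.1) _).subset fun m hm =>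
      ⟨hm.1, fun x hx => List.mem_flatMap.2 ⟨_, hm.2 x hx, by simp⟩⟩
  obtain ⟨α, hα0, hα, hαF⟩ := exists_limit
    (R := fun j x y => Path Tr ((c j).1, x) 0 ((c (j + 1)).1, y)) hfin (b := {.inl A.gamma0})
    fun n => by
      obtain ⟨Z, hZ, hsim⟩ := exists_symbolic hT hTr n hmac hclosed
      obtain ⟨α, h0, h1, h2⟩ := hsim {.inl A.gamma0} (by
        rw [hc0] at hZ
        obtain ⟨z, hz, rfl⟩ := rel_singleton_left.1 hZ
        exact rel_singleton_left.2 ⟨_, Or.inr ⟨_, hγ0, rfl, hz.1⟩, rfl⟩)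
      refine ⟨α, h0, h1, fun j hj => ?_⟩
      obtain ⟨Z, hZ, hB⟩ := h2 j hj
      exact ⟨(Multiset.card_eq_card_of_rel hB).symm.trans (Multiset.card_eq_card_of_rel hZ).symm,
        hdrop hB⟩
  obtain ⟨B, hB⟩ := hC.card_bounded (g := fun j => (c j).1) (α := α) (by
    refine ((A.g0 :: tgts a).finite_toSet).subset ?_
    rintro _ ⟨j, rfl⟩
    cases j with
    | zero => simp [hc0]
    | succ j =>
      obtain ⟨_, _, _, _, _, _, _, _, _, _, h, _⟩ := hmac j
      exact List.mem_cons_of_mem _ h) (by simp [hc0]) hα0 hα fun j => (hαF j).2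
  refine ⟨B + 1, fun i => ?_⟩
  obtain ⟨k, hk⟩ := hcnt i
  have := hB k
  rw [(hαF k).1] at this
  omega

end Compactness

/-! ### Primitive recursiveness of the basic operations -/

section PrimrecTools

attribute [fun_prop] Primrec Primrec.id Primrec.const Primrec.comp Primrec.pair

variable {α β γ δ : Type*} [Primcodable α] [Primcodable β] [Primcodable γ] [Primcodable δ]

@[fun_prop]
theorem primrec_fst {f : α → β × γ} (hf : Primrec f) : Primrec fun a => (f a).1 :=
  Primrec.fst.comp hf

@[fun_prop]
theorem primrec_snd {f : α → β × γ} (hf : Primrec f) : Primrec fun a => (f a).2 :=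
  Primrec.snd.comp hf

@[fun_prop]
theorem primrec_inl {f : α → β} (hf : Primrec f) : Primrec fun a => (Sum.inl (f a) : β ⊕ γ) :=
  Primrec.sumInl.comp hf

@[fun_prop]
theorem primrec_inr {f : α → γ} (hf : Primrec f) : Primrec fun a => (Sum.inr (f a) : β ⊕ γ) :=
  Primrec.sumInr.comp hf

@[fun_prop]
theorem primrec_some {f : α → β} (hf : Primrec f) : Primrec fun a => some (f a) :=
  Primrec.option_some.comp hf

@[fun_prop]
theorem primrec_succ {f : α → ℕ} (hf : Primrec f) : Primrec fun a => f a + 1 :=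
  Primrec.succ.comp hf

@[fun_prop]
theorem primrec_add {f g : α → ℕ} (hf : Primrec f) (hg : Primrec g) :
    Primrec fun a => f a + g a :=
  Primrec.nat_add.comp hf hg

@[fun_prop]
theorem primrec_cons {f : α → β} {l : α → List β} (hf : Primrec f) (hl : Primrec l) :
    Primrec fun a => f a :: l a :=
  Primrec.list_cons.comp hf hl

@[fun_prop]
theorem primrec_append {f g : α → List β} (hf : Primrec f) (hg : Primrec g) :
    Primrec fun a => f a ++ g a :=
  Primrec.list_append.comp hf hg

@[fun_prop]
theorem primrec_length {l : α → List β} (hl : Primrec l) : Primrec fun a => (l a).length :=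
  Primrec.list_length.comp hl

@[fun_prop]
theorem primrec_tail {l : α → List β} (hl : Primrec l) : Primrec fun a => (l a).tail :=
  Primrec.list_tail.comp hl

@[fun_prop]
theorem primrec_head? {l : α → List β} (hl : Primrec l) : Primrec fun a => (l a).head? :=
  Primrec.list_head?.comp hl

@[fun_prop]
theorem primrec_toList {o : α → Option β} (ho : Primrec o) : Primrec fun a => (o a).toList :=
  Primrec.optionToList.comp ho

@[fun_prop]
theorem primrec_map {l : α → List β} {f : α → β → γ} (hl : Primrec l)
    (hf : Primrec fun x : α × β => f x.1 x.2) : Primrec fun a => (l a).map (f a) :=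
  Primrec.list_map hl hf.to₂

@[fun_prop]
theorem primrec_optionMap {o : α → Option β} {f : α → β → γ} (ho : Primrec o)
    (hf : Primrec fun x : α × β => f x.1 x.2) : Primrec fun a => (o a).map (f a) :=
  Primrec.option_map ho hf.to₂

@[fun_prop]
theorem primrec_flatMap {l : α → List β} {f : α → β → List γ} (hl : Primrec l)
    (hf : Primrec fun x : α × β => f x.1 x.2) : Primrec fun a => (l a).flatMap (f a) :=
  Primrec.list_flatMap hl hf.to₂

@[fun_prop]
theorem primrec_foldr {l : α → List β} {f : α → β → γ → γ} {c : α → γ} (hl : Primrec l)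
    (hf : Primrec fun x : α × β × γ => f x.1 x.2.1 x.2.2) (hc : Primrec c) :
    Primrec fun a => (l a).foldr (f a) (c a) :=
  Primrec.list_foldr (h := fun a x => f a x.1 x.2) hl hc hf.to₂

@[fun_prop]
theorem primrec_foldl {l : α → List β} {f : α → γ → β → γ} {c : α → γ} (hl : Primrec l)
    (hf : Primrec fun x : α × γ × β => f x.1 x.2.1 x.2.2) (hc : Primrec c) :
    Primrec fun a => (l a).foldl (f a) (c a) :=
  Primrec.list_foldl (h := fun a x => f a x.1 x.2) hl hc hf.to₂

@[fun_prop]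
theorem primrec_filter {l : α → List β} {p : α → β → Bool} (hl : Primrec l)
    (hp : Primrec fun x : α × β => p x.1 x.2) : Primrec fun a => (l a).filter (p a) := by
  have h := Primrec.listFilterMap (g := fun a b => bif p a b then some b else none) hl
    (Primrec.cond hp (Primrec.option_some.comp Primrec.snd) (Primrec.const none)).to₂
  refine h.of_eq fun a => ?_
  rw [← List.filterMap_eq_filter]
  congr 1
  funext b
  cases h : p a b <;> simp [Option.guard, h]

@[fun_prop]
theorem primrec_listCount [BEq β] [LawfulBEq β] {l : α → List β} {f : α → β} (hl : Primrec l)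
    (hf : Primrec f) : Primrec fun a => (l a).count (f a) := by
  classical
  refine (primrec_count hf hl).of_eq fun a => ?_
  simp only [List.count_eq_countP]
  exact congrArg (fun p => List.countP p (l a)) (funext fun b => by simp [beq_eq_decide])

@[fun_prop]
theorem primrec_tails {l : α → List β} (hl : Primrec l) : Primrec fun a => (l a).tails := by
  have h : Primrec fun a => (l a).foldr (fun b r => (r.head?.toList.flatMap fun s => [b :: s]) ++ r)
    [[]] := by fun_prop
  refine h.of_eq fun a => ?_
  generalize l a = L
  induction L with
  | nil => rfl
  | cons b L ih =>
    rw [List.foldr_cons, ih]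
    cases L <;> simp

@[fun_prop]
theorem primrec_decide {p : α → Prop} [DecidablePred p] (hp : PrimrecPred p) :
    Primrec fun a => decide (p a) :=
  hp.decide

@[fun_prop]
theorem primrec_ite {p : α → Prop} [DecidablePred p] (hp : PrimrecPred p) {f g : α → β}
    (hf : Primrec f) (hg : Primrec g) : Primrec fun a => if p a then f a else g a :=
  Primrec.ite hp hf hg

attribute [fun_prop] PrimrecPred

@[fun_prop]
theorem primrecPred_eq {f g : α → β} (hf : Primrec f) (hg : Primrec g) :
    PrimrecPred fun a => f a = g a :=
  Primrec.eq.comp hf hg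

@[fun_prop]
theorem primrecPred_le {f g : α → ℕ} (hf : Primrec f) (hg : Primrec g) :
    PrimrecPred fun a => f a ≤ g a :=
  Primrec.nat_le.comp hf hg

@[fun_prop]
theorem primrecPred_and {p q : α → Prop} (hp : PrimrecPred p) (hq : PrimrecPred q) :
    PrimrecPred fun a => p a ∧ q a :=
  hp.and hq

@[fun_prop]
theorem primrecPred_or {p q : α → Prop} (hp : PrimrecPred p) (hq : PrimrecPred q) :
    PrimrecPred fun a => p a ∨ q a :=
  hp.or hq

@[fun_prop]
theorem primrecPred_not {p : α → Prop} (hp : PrimrecPred p) : PrimrecPred fun a => ¬p a :=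
  hp.not

theorem primrecPred_bex {p : α → β → Prop} {l : α → List β}
    (hp : PrimrecPred fun x : α × β => p x.1 x.2) (hl : Primrec l) :
    PrimrecPred fun a => ∃ b ∈ l a, p a b :=
  (PrimrecRel.exists_mem_list (R := fun (b : β) (a : α) => p a b)
    (hp.comp (Primrec.snd.pair Primrec.fst))).comp hl Primrec.id

theorem primrecPred_ball {p : α → β → Prop} {l : α → List β}
    (hp : PrimrecPred fun x : α × β => p x.1 x.2) (hl : Primrec l) :
    PrimrecPred fun a => ∀ b ∈ l a, p a b :=
  (PrimrecRel.forall_mem_list (R := fun (b : β) (a : α) => p a b)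
    (hp.comp (Primrec.snd.pair Primrec.fst))).comp hl Primrec.id

@[fun_prop]
theorem primrecPred_mem {f : α → β} {l : α → List β} (hf : Primrec f) (hl : Primrec l) :
    PrimrecPred fun a => f a ∈ l a :=
  (primrecPred_bex (p := fun a b => b = f a) (by fun_prop) hl).of_eq fun a => by simp

theorem Sig.imp {p q : α → Prop} (hp : PrimrecPred p) (hq : Sig q) : Sig fun a => p a → q a :=
  ((Sig.of_primrec hp.not).or hq).of_iff fun _ => by tauto

end PrimrecTools

/-! ### Certificates are semidecidable -/

section SigCert

variable {α : Type*} [Primcodable α] {τ : Type} [Primcodable τ]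

theorem primrec_dot [DecidableEq τ] {y F : α → List τ} (hy : Primrec y) (hF : Primrec F) :
    Primrec fun a => dot (y a) (F a) := by
  have h : Primrec fun a => (F a).foldr (fun p n => (y a).count p + n) 0 := by fun_prop
  refine h.of_eq fun a => ?_
  simp only [dot, List.sum_eq_foldr, List.foldr_map]

theorem primrec_subs {l : α → List τ} (hl : Primrec l) : Primrec fun a => subs (l a) := by
  unfold subs
  fun_prop

theorem primrec_ctl {o : α → Option (ℕ × ℕ)} {g : α → ℕ} (ho : Primrec o) (hg : Primrec g) :
    Primrec fun a => ctl (o a) (g a) := by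
  unfold ctl
  exact Primrec.option_casesOn ho (by fun_prop) (Primrec₂.mk (by fun_prop))

attribute [fun_prop] primrec_dot primrec_subs primrec_ctl

omit [Primcodable τ] in
theorem forall_count_le_iff [DecidableEq τ] (l : List τ) (n : Vec τ) :
    (∀ x ∈ l, (l.count x : ℕ∞) ≤ n.val x) ↔ ∀ x ∈ l, x ∈ n.2 ∨ l.count x ≤ n.1.count x := by
  refine forall₂_congr fun x _ => ?_
  by_cases h : x ∈ n.2 <;> simp [Vec.val, h]

omit [Primcodable τ] in
theorem edgeOK_iff [DecidableEq τ] (n : Node τ) (t : Trn τ) (n' : Node τ) :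
    EdgeOK n t n' ↔ ∀ x ∈ n.2.1 ++ n.2.2 ++ (t.2.2.1.1 ++ t.2.2.1.2), x ∈ n'.2.2 ∨
      (x ∉ n.2.2 ∧ x ∉ t.2.2.1.2 ∧
        n.2.1.count x + t.2.2.1.1.count x ≤ n'.2.1.count x + t.2.1.count x) := by
  have key : ∀ x, n.2.val x + t.2.2.1.val x ≤ n'.2.val x + (t.2.1.count x : ℕ∞) ↔
      x ∈ n'.2.2 ∨ (x ∉ n.2.2 ∧ x ∉ t.2.2.1.2 ∧
        n.2.1.count x + t.2.2.1.1.count x ≤ n'.2.1.count x + t.2.1.count x) := by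
    intro x
    by_cases h1 : x ∈ n'.2.2 <;> by_cases h2 : x ∈ n.2.2 <;> by_cases h3 : x ∈ t.2.2.1.2 <;>
      simp [Vec.val, h1, h2, h3]
    all_goals norm_cast
  simp only [EdgeOK, key]
  refine ⟨fun h x _ => h x, fun h x => ?_⟩
  by_cases hx : x ∈ n.2.1 ++ n.2.2 ++ (t.2.2.1.1 ++ t.2.2.1.2)
  · exact h x hx
  · simp only [List.mem_append, not_or] at hx
    refine Or.inr ⟨hx.1.2, hx.2.2, ?_⟩
    rw [List.count_eq_zero_of_not_mem hx.1.1, List.count_eq_zero_of_not_mem hx.2.1]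
    exact Nat.zero_le _

theorem primrecPred_edgeOK [DecidableEq τ] {n n' : α → Node τ} {t : α → Trn τ} (hn : Primrec n)
    (ht : Primrec t) (hn' : Primrec n') : PrimrecPred fun a => EdgeOK (n a) (t a) (n' a) := by
  simp only [edgeOK_iff]
  exact primrecPred_ball (by fun_prop) (by fun_prop)

theorem Sig.good [DecidableEq τ] {F : α → List (Edge τ)} (hF : Primrec F) :
    Sig fun a => Good (F a) := by
  refine Sig.or ?_ (Sig.or ?_ ?_)
  · exact .of_primrec (primrecPred_ball (by fun_prop) hF)
  · refine Sig.ex (Sig.ex (Sig.of_primrec (primrecPred_and ?_ ?_)))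
    · refine primrecPred_ball (primrecPred_and (primrecPred_ball ?_ ?_) ?_) ?_ <;> fun_prop
    · simp only [← Nat.succ_le_iff, Nat.succ_eq_add_one]
      refine primrecPred_bex ?_ ?_ <;> fun_prop
  · refine Sig.ex (Sig.of_primrec (primrecPred_and ?_ (primrecPred_and ?_ ?_)))
    · refine primrecPred_ball ?_ ?_ <;> fun_prop
    · refine primrecPred_bex ?_ ?_ <;> fun_prop
    · refine primrecPred_bex ?_ ?_ <;> fun_prop

theorem Sig.cert [DecidableEq τ] {Tr : α → List (Trn τ)} {g0 : α → ℕ} {c0 : α → List τ}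
    {M : α → List (Node τ)} {E : α → List (Edge τ)} (hTr : Primrec Tr) (hg0 : Primrec g0)
    (hc0 : Primrec c0) (hM : Primrec M) (hE : Primrec E) :
    Sig fun a => Cert (Tr a) (g0 a) (c0 a) (M a) (E a) := by
  have h1 : Sig fun a => ∃ n ∈ M a, n.1 = g0 a ∧
      ∀ x ∈ c0 a, x ∈ n.2.2 ∨ (c0 a).count x ≤ n.2.1.count x := by
    refine .of_primrec (primrecPred_bex (primrecPred_and ?_ (primrecPred_ball ?_ ?_)) ?_) <;>
      fun_prop
  have h2 : Sig fun a => ∀ n ∈ M a, ∀ t ∈ Tr a, ∀ g' ∈ ctl t.1 n.1,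
      (∀ x ∈ t.2.1, x ∈ n.2.2 ∨ t.2.1.count x ≤ n.2.1.count x) →
      ∃ n' ∈ M a, n'.1 = g' ∧ (n, t, n') ∈ E a ∧ EdgeOK n t n' := by
    refine Sig.ball (Sig.ball (Sig.ball (Sig.imp (primrecPred_ball ?_ ?_)
      (.of_primrec (primrecPred_bex (primrecPred_and ?_ (primrecPred_and ?_
        (primrecPred_edgeOK ?_ ?_ ?_))) ?_))) ?_) ?_) ?_ <;> fun_prop
  have h3 : Sig fun a => ∀ F ∈ subs (E a), Good F := Sig.ball (Sig.good (by fun_prop)) (by fun_prop)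
  refine (h1.and (h2.and h3)).of_iff fun a => ?_
  simp only [← forall_count_le_iff]
  exact ⟨fun h => ⟨h.1, h.2, h.3⟩, fun h => ⟨h.1, h.2.1, h.2.2⟩⟩

end SigCert

/-! ### Semidecidability of boundedness certificates and of pumps -/

section SigThread

instance : Primcodable TSt := Primcodable.prod

instance : Primcodable Entry := Primcodable.prod

instance : Primcodable (Tok Entry) := Primcodable.sum

instance : Primcodable (Tok (List Letter)) := Primcodable.sum

instance : Primcodable (Trn (Tok Entry)) := Primcodable.prod

variable {α : Type*} [Primcodable α]

@[fun_prop]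
theorem primrec_spawnL {n : α → ℕ} {sp : α → Option ℕ} (hn : Primrec n) (hsp : Primrec sp) :
    Primrec fun a => spawnL (n a) (sp a) := by
  unfold spawnL
  fun_prop

@[fun_prop]
theorem primrec_succs {a : α → Sys} {q : α → TSt} {γ : α → ℕ} (ha : Primrec a) (hq : Primrec q)
    (hγ : Primrec γ) : Primrec fun x => succs (a x) (q x) (γ x) := by
  unfold succs
  fun_prop

@[fun_prop]
theorem primrec_vadd {τ : Type} [Primcodable τ] {u v : α → Vec τ} (hu : Primrec u)
    (hv : Primrec v) : Primrec fun a => vadd (u a) (v a) := by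
  unfold vadd
  fun_prop

@[fun_prop]
theorem primrec_chains {T : α → List Entry} {s : α → TSt × Vec Letter} {w : α → List ℕ}
    (hT : Primrec T) (hs : Primrec s) (hw : Primrec w) :
    Primrec fun a => chains (T a) (s a) (w a) := by
  unfold chains chainStep
  fun_prop

@[fun_prop]
theorem primrec_tgts {a : α → Sys} (ha : Primrec a) : Primrec fun x => tgts (a x) := by
  unfold tgts
  fun_prop

@[fun_prop]
theorem primrec_cont {V : Type} [Primcodable V] {S : α → Skel} {e : α → Bool} {v : α → V}
    (hS : Primrec S) (he : Primrec e) (hv : Primrec v) :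
    Primrec fun a => cont (S a) (e a) (v a) := by
  unfold cont
  fun_prop

@[fun_prop]
theorem primrec_syms {V : Type} [Primcodable V] {n : α → ℕ} {l : α → List Letter}
    (hn : Primrec n) (hl : Primrec l) : Primrec fun a => syms (V := V) (n a) (l a) := by
  unfold syms
  fun_prop

theorem fin_iff (a : Sys) (e : Bool) (q : TSt) : Fin a e q ↔ (e = false ∧ q = (0, 0, [])) ∨
    (e = true ∧ ∃ x ∈ a.2.2.2, q.1 = 2 ∧ q.2.1 = x.1 ∧ q.2.2.map Prod.snd = [x.2]) := by
  refine or_congr Iff.rfl (and_congr_right fun _ => ⟨?_, ?_⟩)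
  · rintro ⟨g, p, r, rfl, h⟩
    exact ⟨_, h, rfl, rfl, rfl⟩
  · obtain ⟨m, g, S⟩ := q
    rintro ⟨⟨g', r⟩, h, rfl, rfl, hS⟩
    obtain ⟨⟨p, r'⟩, rfl, rfl⟩ := List.map_eq_singleton_iff.1 hS
    exact ⟨_, p, _, rfl, h⟩

@[fun_prop]
theorem primrecPred_fin {a : α → Sys} {e : α → Bool} {q : α → TSt} (ha : Primrec a)
    (he : Primrec e) (hq : Primrec q) : PrimrecPred fun x => Fin (a x) (e x) (q x) := by
  simp only [fin_iff]
  refine primrecPred_or (by fun_prop) (primrecPred_and (by fun_prop)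
    (primrecPred_bex (by fun_prop) (by fun_prop)))

@[fun_prop]
theorem primrecPred_vle {τ : Type} [Primcodable τ] [DecidableEq τ] {u v : α → Vec τ}
    (hu : Primrec u) (hv : Primrec v) : PrimrecPred fun a => VLe (u a) (v a) := by
  simp only [vle_iff]
  exact primrecPred_and (primrecPred_ball (by fun_prop) (by fun_prop))
    (primrecPred_ball (by fun_prop) (by fun_prop))

theorem primrecPred_tClosed {a : α → Sys} {K : ℕ} {Γs : α → List ℕ} {QS : α → List TSt}
    {T : α → List Entry} (ha : Primrec a) (hΓ : Primrec Γs) (hQ : Primrec QS) (hT : Primrec T) :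
    PrimrecPred fun x => TClosed (a x) K (Γs x) (QS x) (T x) := by
  have h1 : PrimrecPred fun x => ∀ q ∈ QS x, q.1 ≠ 0 ∨ K + 1 ≤ q.2.2.length ∨
      ∀ y ∈ (a x).2.2.1, ∀ z ∈ tgts (a x), (0, 0, (y.1, z) :: q.2.2) ∈ QS x := by
    refine primrecPred_ball (primrecPred_or ?_ (primrecPred_or ?_
      (primrecPred_ball (primrecPred_ball ?_ ?_) ?_))) ?_ <;> fun_prop
  have h2 : PrimrecPred fun x => ∀ q ∈ QS x, ∀ γ ∈ Γs x, ∀ z ∈ succs (a x) q γ, z.1 ∈ QS x ∧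
      (∀ y ∈ z.2.1, y ∈ Γs x) ∧ (∀ l ∈ z.2.2, l.2 ∈ Γs x) ∧
      ∀ s ∈ chains (T x) (z.1, (z.2.2, [])) z.2.1,
        ∃ t ∈ T x, t.1 = (q, γ, s.1) ∧ VLe s.2 t.2 := by
    refine primrecPred_ball (primrecPred_ball (primrecPred_ball (primrecPred_and ?_
      (primrecPred_and (primrecPred_ball ?_ ?_) (primrecPred_and (primrecPred_ball ?_ ?_)
        (primrecPred_ball (primrecPred_bex ?_ ?_) ?_)))) ?_) ?_) ?_ <;> fun_prop
  have h3 : PrimrecPred fun x => ((0, 0, []) : TSt) ∈ QS x := by fun_prop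
  exact (h3.and (h1.and h2)).of_eq fun x =>
    ⟨fun h => ⟨h.1, h.2.1, h.2.2⟩, fun h => ⟨h.1, h.2, h.3⟩⟩

theorem forall_netTr_iff (a : Sys) (K : ℕ) (Γs : List ℕ) (T : List Entry)
    (Tr : List (Trn (Tok Entry))) : (∀ t, NetTr a K Γs T t → t ∈ Tr) ↔
      (∀ t ∈ T, ∀ e ∈ [false, true], ¬(t.1.1.1 = 0 ∧ t.1.1.2.1 = 0 ∧
          t.1.1.2.2.length ≤ K + 1 ∧ Fin a e t.1.2.2) ∨
        (none, [.inl t.1.2.1], ([.inr (t.1.1.2.2, e, t)], []), false) ∈ Tr) ∧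
      (∀ t ∈ T, ∀ e ∈ [false, true], ∀ S ∈ t.1.1.2.2.tails,
        (none, [.inr (S, e, t)], ([], []), true) ∈ Tr ∧
        (S = [] ∨ (S.head?, [.inr (S, e, t)],
          (cont S.tail e t ++ syms (S.tail.length + 1) t.2.1, syms (S.tail.length + 1) t.2.2),
          false) ∈ Tr)) ∧
      ∀ γ ∈ Γs, (none, [.inl γ], ([], []), true) ∈ Tr := by
  have hb : ∀ e : Bool, e ∈ [false, true] := by decide
  constructor
  · refine fun h => ⟨?_, ?_, fun γ hγ => h _ (.drop_sym hγ)⟩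
    · rintro ⟨⟨⟨m, g, S⟩, γ, q'⟩, u⟩ ht e -
      rw [or_iff_not_imp_left, not_not]
      rintro ⟨rfl, rfl, h3, h4⟩
      exact h _ (.choose ht h3 h4)
    · intro t ht e _ S hS
      refine ⟨h _ (.drop_com ht hS), ?_⟩
      cases S with
      | nil => exact Or.inl rfl
      | cons x S => exact Or.inr (h _ (.fire ht hS))
  · rintro ⟨h1, h2, h3⟩ t ht
    cases ht with
    | choose ht hS hf => exact (h1 _ ht _ (hb _)).resolve_left fun h => h ⟨rfl, rfl, hS, hf⟩
    | fire ht hS => exact (h2 _ ht _ (hb _) _ hS).2.resolve_left (List.cons_ne_nil _ _)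
    | drop_sym h => exact h3 _ h
    | drop_com ht hS => exact (h2 _ ht _ (hb _) _ hS).1

theorem primrecPred_forall_netTr {a : α → Sys} {K : ℕ} {Γs : α → List ℕ} {T : α → List Entry}
    {Tr : α → List (Trn (Tok Entry))} (ha : Primrec a) (hΓ : Primrec Γs) (hT : Primrec T)
    (hTr : Primrec Tr) : PrimrecPred fun x => ∀ t, NetTr (a x) K (Γs x) (T x) t → t ∈ Tr x := by
  simp only [forall_netTr_iff]
  refine primrecPred_and (primrecPred_ball (primrecPred_ball ?_ ?_) ?_) (primrecPred_and
    (primrecPred_ball (primrecPred_ball (primrecPred_ball ?_ ?_) ?_) ?_)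
    (primrecPred_ball ?_ ?_)) <;> fun_prop

theorem sig_bdd (K : ℕ) : Sig fun x : Sys × ℕ × ℕ => Bdd x.1 K x.2.1 x.2.2 := by
  refine Sig.ex (Sig.ex (Sig.ex (Sig.ex (Sig.ex (Sig.ex (Sig.and (.of_primrec ?_)
    (Sig.and (.of_primrec (primrecPred_tClosed ?_ ?_ ?_ ?_))
      (Sig.and (.of_primrec (primrecPred_forall_netTr ?_ ?_ ?_ ?_))
        (Sig.cert ?_ ?_ ?_ ?_ ?_))))))))) <;> fun_prop

/-- One step of a single thread, accumulating the emitted letters. -/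
def LeftStep (a : Sys) (s s' : TSt × List ℕ × List Letter) : Prop :=
  ∃ (γ : ℕ) (w : List ℕ), s.2.1 = γ :: w ∧ ∃ z ∈ succs a s.1 γ,
    s' = (z.1, z.2.1 ++ w, s.2.2 ++ z.2.2)

theorem run_iff {a : Sys} {q q' : TSt} {w : List ℕ} {v : List Letter} :
    Run a q w v q' ↔ Relation.ReflTransGen (LeftStep a) (q, w, []) (q', [], v) := by
  constructor
  · intro h
    suffices H : ∀ v0, Relation.ReflTransGen (LeftStep a) (q, w, v0) (q', [], v0 ++ v) by
      simpa using H []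
    induction h with
    | nil => simpa using fun v0 => Relation.ReflTransGen.refl
    | step hr _ ih =>
      intro v0
      rw [← List.append_assoc]
      exact (ih _).head ⟨_, _, rfl, (_, _, _), mem_succs.2 hr, rfl⟩
  · intro h
    suffices H : ∀ s : TSt × List ℕ × List Letter,
        Relation.ReflTransGen (LeftStep a) s (q', [], v) → ∃ v', v = s.2.2 ++ v' ∧
          Run a s.1 s.2.1 v' q' by
      obtain ⟨v', rfl, hv⟩ := H _ h
      exact hv
    intro s hs
    induction hs using Relation.ReflTransGen.head_induction_on with
    | refl => exact ⟨[], by simp, .nil⟩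
    | @head s s' hs _ ih =>
      obtain ⟨γ, w, hw, z, hz, rfl⟩ := hs
      obtain ⟨v', rfl, hv⟩ := ih
      refine ⟨z.2.2 ++ v', by simp, ?_⟩
      rw [hw]
      exact .step (mem_succs.1 hz) hv

theorem Sig.run {a : α → Sys} {q q' : α → TSt} {w : α → List ℕ} {v : α → List Letter}
    (ha : Primrec a) (hq : Primrec q) (hw : Primrec w) (hv : Primrec v) (hq' : Primrec q') :
    Sig fun x => Run (a x) (q x) (w x) (v x) (q' x) := by
  simp only [run_iff]
  have h : Sig fun x : Sys × (TSt × List ℕ × List Letter) × (TSt × List ℕ × List Letter) =>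
      LeftStep x.1 x.2.1 x.2.2 := by
    refine Sig.ex (Sig.ex (.of_primrec (primrecPred_and ?_ (primrecPred_bex ?_ ?_)))) <;> fun_prop
  exact (Sig.reflTransGen h).comp (f := fun x => (a x, (q x, w x, []), (q' x, [], v x)))
    (by fun_prop)

theorem aStep_coe_iff {a : Sys} {K : ℕ} {c c' : ℕ × List (Tok (List Letter))} :
    AStep a K (c.1, c.2) (c'.1, c'.2) ↔
      (∃ (S : Skel) (γ : ℕ) (v : List Letter) (q' : TSt) (e : Bool)
        (R : List (Tok (List Letter))), S.length ≤ K + 1 ∧ Run a (0, 0, S) [γ] v q' ∧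
        Fin a e q' ∧ c.1 = c'.1 ∧ c.2.Perm (.inl γ :: R) ∧ c'.2.Perm (.inr (S, e, v) :: R)) ∨
      ∃ (S : Skel) (e : Bool) (v : List Letter) (R : List (Tok (List Letter))),
        c.2.Perm (.inr ((c.1, c'.1) :: S, e, v) :: R) ∧
        c'.2.Perm (cont S e v ++ syms (S.length + 1) v ++ R) := by
  obtain ⟨g, l⟩ := c
  obtain ⟨g', l'⟩ := c'
  constructor
  · intro h
    simp only at h
    generalize hx : (g, (l : Multiset (Tok (List Letter)))) = x at h
    generalize hy : (g', (l' : Multiset (Tok (List Letter)))) = y at h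
    cases h with
    | @choose S γ v q' e g R h1 h2 h3 =>
      rw [Prod.mk.injEq] at hx hy
      obtain ⟨rfl, hx⟩ := hx
      obtain ⟨rfl, hy⟩ := hy
      refine Or.inl ⟨S, γ, v, q', e, R.toList, h1, h2, h3, rfl, ?_, ?_⟩
      · rw [← Multiset.coe_eq_coe, hx, ← Multiset.cons_coe, Multiset.coe_toList,
          Multiset.singleton_add]
      · rw [← Multiset.coe_eq_coe, hy, ← Multiset.cons_coe, Multiset.coe_toList,
          Multiset.singleton_add]
    | @fire p r S e v R =>
      rw [Prod.mk.injEq] at hx hy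
      obtain ⟨rfl, hx⟩ := hx
      obtain ⟨rfl, hy⟩ := hy
      refine Or.inr ⟨S, e, v, R.toList, ?_, ?_⟩
      · rw [← Multiset.coe_eq_coe, hx, ← Multiset.cons_coe, Multiset.coe_toList,
          Multiset.singleton_add]
      · rw [← Multiset.coe_eq_coe, hy, ← Multiset.coe_add _ R.toList, Multiset.coe_toList]
  · rintro (⟨S, γ, v, q', e, R, h1, h2, h3, rfl, hx, hy⟩ | ⟨S, e, v, R, hx, hy⟩)
    · rw [Multiset.coe_eq_coe.2 hx, Multiset.coe_eq_coe.2 hy]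
      exact .choose (R := (R : Multiset _)) h1 h2 h3
    · rw [Multiset.coe_eq_coe.2 hx, Multiset.coe_eq_coe.2 hy]
      exact .fire (R := (R : Multiset _))

theorem sig_aStep (K : ℕ) : Sig fun x : Sys × (ℕ × List (Tok (List Letter))) ×
    (ℕ × List (Tok (List Letter))) => AStep x.1 K (x.2.1.1, x.2.1.2) (x.2.2.1, x.2.2.2) := by
  simp only [aStep_coe_iff]
  refine Sig.or (Sig.ex (Sig.ex (Sig.ex (Sig.ex (Sig.ex (Sig.ex (Sig.and (.of_primrec ?_)
    (Sig.and (Sig.run ?_ ?_ ?_ ?_ ?_) (Sig.and (.of_primrec ?_) (Sig.and (.of_primrec ?_)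
      (Sig.and (Sig.perm ?_ ?_) (Sig.perm ?_ ?_)))))))))))) (Sig.ex (Sig.ex (Sig.ex (Sig.ex
        (Sig.and (Sig.perm ?_ ?_) (Sig.perm ?_ ?_)))))) <;> fun_prop

theorem AStep.exists_list {a : Sys} {K : ℕ} {c : ℕ × List (Tok (List Letter))}
    {y : ℕ × Multiset (Tok (List Letter))}
    (h : Relation.ReflTransGen (AStep a K) (c.1, c.2) y) : ∃ l : List (Tok (List Letter)),
      (l : Multiset _) = y.2 ∧ Relation.ReflTransGen (fun c c' : ℕ × List (Tok (List Letter)) =>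
        AStep a K (c.1, c.2) (c'.1, c'.2)) c (y.1, l) := by
  induction h with
  | refl => exact ⟨c.2, rfl, .refl⟩
  | @tail y z _ hs ih =>
    obtain ⟨l, hl, ih⟩ := ih
    refine ⟨z.2.toList, by simp, ih.tail ?_⟩
    simpa [hl] using hs

theorem pump_iff (a : Sys) (K g0 γ0 : ℕ) : Pump a K g0 γ0 ↔
    ∃ (g : ℕ) (c c' d : List (Tok (List Letter))),
      Relation.ReflTransGen (fun c c' : ℕ × List (Tok (List Letter)) =>
        AStep a K (c.1, c.2) (c'.1, c'.2)) (g0, [.inl γ0]) (g, c) ∧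
      Relation.ReflTransGen (fun c c' : ℕ × List (Tok (List Letter)) =>
        AStep a K (c.1, c.2) (c'.1, c'.2)) (g, c) (g, c') ∧ c'.Perm (c ++ d) ∧ d ≠ [] := by
  constructor
  · rintro ⟨g, c, d, h1, h2, hd⟩
    obtain ⟨l, rfl, h1⟩ := AStep.exists_list (c := (g0, [.inl γ0])) h1
    obtain ⟨l', hl', h2⟩ := AStep.exists_list (c := (g, l)) h2
    refine ⟨g, l, l', d.toList, h1, h2, ?_, by simpa using hd⟩
    rw [← Multiset.coe_eq_coe, hl', ← Multiset.coe_add, Multiset.coe_toList]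
  · rintro ⟨g, c, c', d, h1, h2, hp, hd⟩
    let f : ℕ × List (Tok (List Letter)) → ℕ × Multiset (Tok (List Letter)) := fun c =>
      (c.1, c.2)
    refine ⟨g, c, d, Relation.ReflTransGen.lift (p := AStep a K) f (fun _ _ h => h) _ _ h1, ?_,
      by simpa⟩
    rw [Multiset.coe_add, ← Multiset.coe_eq_coe.2 hp]
    exact Relation.ReflTransGen.lift (p := AStep a K) f (fun _ _ h => h) _ _ h2

theorem sig_pump (K : ℕ) : Sig fun x : Sys × ℕ × ℕ => Pump x.1 K x.2.1 x.2.2 := by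
  simp only [pump_iff]
  have h := Sig.reflTransGen (R := fun (a : Sys) (c c' : ℕ × List (Tok (List Letter))) =>
    AStep a K (c.1, c.2) (c'.1, c'.2)) (sig_aStep K)
  refine Sig.ex (Sig.ex (Sig.ex (Sig.ex (Sig.and ?_ (Sig.and ?_ (Sig.and (Sig.perm ?_ ?_)
    (.of_primrec ?_)))))))
  · exact h.comp (f := fun x : ((((Sys × ℕ × ℕ) × ℕ) × List (Tok (List Letter))) ×
      List (Tok (List Letter))) × List (Tok (List Letter)) =>
      (x.1.1.1.1.1, (x.1.1.1.1.2.1, [.inl x.1.1.1.1.2.2]), (x.1.1.1.2, x.1.1.2))) (by fun_prop)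
  · exact h.comp (f := fun x : ((((Sys × ℕ × ℕ) × ℕ) × List (Tok (List Letter))) ×
      List (Tok (List Letter))) × List (Tok (List Letter)) =>
      (x.1.1.1.1.1, (x.1.1.1.2, x.1.1.2), (x.1.1.1.2, x.1.2))) (by fun_prop)
  all_goals fun_prop

end SigThread

/-! ### Deciding boundedness -/

section Decision

/-- The rule lists of a DCPS, where all words have the admissible length. -/
def Sys.Wf (a : Sys) : Prop :=
  (∀ r ∈ a.1, r.2.2.2.1.length ≤ 2) ∧
    ∀ r ∈ a.2.1, 1 ≤ r.2.2.2.length ∧ r.2.2.2.length ≤ 2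

theorem primrecPred_wf : PrimrecPred Sys.Wf :=
  PrimrecPred.and
    (primrecPred_ball (p := fun (_ : Sys) (r : ℕ × ℕ × ℕ × List ℕ × Option ℕ) =>
      r.2.2.2.1.length ≤ 2) (by fun_prop) (by fun_prop))
    (primrecPred_ball (p := fun (_ : Sys) (r : ℕ × ℕ × ℕ × List ℕ) =>
      1 ≤ r.2.2.2.length ∧ r.2.2.2.length ≤ 2) (by fun_prop) (by fun_prop))

theorem Rep.wf {A : DCPS} {a : Sys} (hA : Rep A a) : a.Wf :=
  ⟨fun r hr => A.creation_wf r ((hA.cr r).1 hr),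
    fun r hr => A.interruption_wf r ((hA.it r).1 hr)⟩

theorem Sys.Wf.exists_rep {a : Sys} (h : a.Wf) (g0 γ0 : ℕ) :
    ∃ A : DCPS, Rep A a ∧ A.g0 = g0 ∧ A.gamma0 = γ0 :=
  ⟨{ glob := ∅
     alph := ∅
     creation := a.1.toFinset
     interruption := a.2.1.toFinset
     resumption := a.2.2.1.toFinset
     termination := a.2.2.2.toFinset
     g0 := g0
     gamma0 := γ0
     creation_wf := fun r hr => h.1 r (List.mem_toFinset.1 hr)
     interruption_wf := fun r hr => h.2 r (List.mem_toFinset.1 hr) },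
    ⟨fun _ => List.mem_toFinset.symm, fun _ => List.mem_toFinset.symm,
      fun _ => List.mem_toFinset.symm, fun _ => List.mem_toFinset.symm⟩, rfl, rfl⟩

theorem Sys.Wf.bdd_iff_not_pump {a : Sys} (h : a.Wf) {K g0 γ0 : ℕ} :
    Bdd a K g0 γ0 ↔ ¬ Pump a K g0 γ0 := by
  refine ⟨fun hb hp => ?_, bdd_of_not_pump⟩
  obtain ⟨A, hA, rfl, rfl⟩ := h.exists_rep g0 γ0
  obtain ⟨ρ, hρ, hK, hu⟩ := Pump.exists_unbounded hA hp
  obtain ⟨B, hB⟩ := Bdd.bounded hA hb hρ hK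
  obtain ⟨i, hi⟩ := hu B
  exact absurd (hB i) (by omega)

theorem Rep.bdd_iff {A : DCPS} {a : Sys} (hA : Rep A a) {K : ℕ} :
    Bdd a K A.g0 A.gamma0 ↔
      ∀ ρ : ℕ → DConfig, IsInfRunD A ρ → KBoundedD K ρ → ∃ B : ℕ, ∀ i, pendCount (ρ i) ≤ B := by
  refine ⟨fun hb ρ hρ hK => hb.bounded hA hρ hK, fun h => bdd_of_not_pump fun hp => ?_⟩
  obtain ⟨ρ, hρ, hK, hu⟩ := Pump.exists_unbounded hA hp
  obtain ⟨B, hB⟩ := h ρ hρ hK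
  obtain ⟨i, hi⟩ := hu B
  exact absurd (hB i) (by omega)

theorem computablePred_wf_and_bdd (K : ℕ) :
    ComputablePred fun x : Sys × ℕ × ℕ => x.1.Wf ∧ Bdd x.1 K x.2.1 x.2.2 := by
  have hw : PrimrecPred fun x : Sys × ℕ × ℕ => x.1.Wf := primrecPred_wf.comp Primrec.fst
  refine ComputablePred.computable_iff_re_compl_re'.2
    ⟨((Sig.of_primrec hw).and (sig_bdd K)).re,
      (((Sig.of_primrec hw.not).or (sig_pump K)).of_iff fun x => ?_).re⟩
  by_cases h : x.1.Wf
  · simp [h, h.bdd_iff_not_pump]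
  · simp [h]

/-- The lists underlying the components of a DCPS. -/
abbrev Code : Type :=
  List ℕ × List ℕ × List (ℕ × ℕ × ℕ × List ℕ × Option ℕ) × List (ℕ × ℕ × ℕ × List ℕ) ×
    List (ℕ × ℕ × ℕ) × List (ℕ × ℕ) × ℕ × ℕ

/-- The rule lists of a code together with the initial state and the initial symbol. -/
def Code.sys (c : Code) : Sys × ℕ × ℕ :=
  ((c.2.2.1, c.2.2.2.1, c.2.2.2.2.1, c.2.2.2.2.2.1), c.2.2.2.2.2.2)

theorem Code.primrec_sys : Primrec Code.sys := by
  unfold Code.sys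
  fun_prop

theorem exists_list_encode_eq {α : Type*} [Encodable α] (s : Multiset α) :
    ∃ l : List α, (l : Multiset α) = s ∧ Encodable.encode s = Encodable.encode l := by
  obtain ⟨l, hl⟩ : ∃ l : List α, Encodable.encode s = Encodable.encode l := ⟨_, rfl⟩
  have h : (fun l : List α => (l : Multiset α)) <$>
      Encodable.decode (α := List α) (Encodable.encode s) = some s := Encodable.encodek s
  rw [hl, Encodable.encodek] at h
  exact ⟨l, Option.some.inj h, hl⟩

theorem encode_prod_congr {α β γ δ : Type*} [Encodable α] [Encodable β] [Encodable γ]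
    [Encodable δ] {a : α} {b : β} {c : γ} {d : δ} (h : Encodable.encode a = Encodable.encode b)
    (h' : Encodable.encode c = Encodable.encode d) :
    Encodable.encode (a, c) = Encodable.encode (b, d) := by
  rw [Encodable.encode_prod_val, Encodable.encode_prod_val, h, h']

theorem exists_code (A : DCPS) :
    ∃ c : Code, encodeDCPS A = Encodable.encode c ∧ Rep A c.sys.1 ∧
      c.sys.2 = (A.g0, A.gamma0) := by
  obtain ⟨l₁, -, e₁⟩ := exists_list_encode_eq A.glob.val
  obtain ⟨l₂, -, e₂⟩ := exists_list_encode_eq A.alph.val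
  obtain ⟨l₃, h₃, e₃⟩ := exists_list_encode_eq A.creation.val
  obtain ⟨l₄, h₄, e₄⟩ := exists_list_encode_eq A.interruption.val
  obtain ⟨l₅, h₅, e₅⟩ := exists_list_encode_eq A.resumption.val
  obtain ⟨l₆, h₆, e₆⟩ := exists_list_encode_eq A.termination.val
  refine ⟨(l₁, l₂, l₃, l₄, l₅, l₆, A.g0, A.gamma0), ?_, ⟨?_, ?_, ?_, ?_⟩, rfl⟩
  · exact encode_prod_congr e₁ (encode_prod_congr e₂ (encode_prod_congr e₃
      (encode_prod_congr e₄ (encode_prod_congr e₅ (encode_prod_congr e₆ rfl)))))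
  · intro x
    rw [← Finset.mem_val, ← h₃, Multiset.mem_coe]
    rfl
  · intro x
    rw [← Finset.mem_val, ← h₄, Multiset.mem_coe]
    rfl
  · intro x
    rw [← Finset.mem_val, ← h₅, Multiset.mem_coe]
    rfl
  · intro x
    rw [← Finset.mem_val, ← h₆, Multiset.mem_coe]
    rfl

theorem exists_computable_boundedness (K : ℕ) :
    ∃ f : ℕ → Bool, Computable f ∧ ∀ A : DCPS, (f (encodeDCPS A) = true ↔
      ∀ ρ : ℕ → DConfig, IsInfRunD A ρ → KBoundedD K ρ →
        ∃ B : ℕ, ∀ i, pendCount (ρ i) ≤ B) := by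
  obtain ⟨_, hD⟩ := computablePred_wf_and_bdd K
  refine ⟨fun n => Option.casesOn (Encodable.decode (α := Code) n) false fun c =>
    decide (c.sys.1.Wf ∧ Bdd c.sys.1 K c.sys.2.1 c.sys.2.2), ?_, fun A => ?_⟩
  · exact Computable.option_casesOn Computable.decode (Computable.const false)
      (hD.comp (Code.primrec_sys.to_comp.comp Computable.snd)).to₂
  · obtain ⟨c, hc, hA, h0⟩ := exists_code A
    have hd : Encodable.decode (α := Code) (encodeDCPS A) = some c := by
      rw [hc]
      exact Encodable.encodek c
    rw [← hA.bdd_iff]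
    beta_reduce
    rw [hd]
    simp [h0, hA.wf]

end Decision

/-- For each `K ≥ 1`, the `K`-bounded boundedness problem
for DCPS is decidable: there is an algorithm that, given a DCPS `A`, decides
whether every `K`-context switch bounded run of `A` is bounded, i.e. whether
for every such run there is `B ∈ ℕ` bounding the number of pending threads in
every configuration along the run. -/
theorem boundedness_decidable :
    ∀ K : ℕ, 1 ≤ K →
      ∃ f : ℕ → Bool, Computable f ∧
        ∀ A : DCPS,
          (f (encodeDCPS A) = true ↔
            ∀ rho : ℕ → DConfig, IsInfRunD A rho → KBoundedD K rho →
              ∃ B : ℕ, ∀ i, pendCount (rho i) ≤ B) := by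
  intro K _
  exact exists_computable_boundedness K

end CBL
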